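/- Let T be a computable consistent extension of PA and n ≥ 1. The following are equivalent: (1) there is a Σ_n sentence in HDCons(Π_n,T); (2) Th_{Σ_n}(T) ⊆ HCons(Π_n,T); (3) Th_{Π_n}(T) ⊆ HCons(Σ_n,T); (4) T is Σ_n↓Π_n-conservative over PA, i.e., for every Σ_n sentence σ and Π_n sentence π, if T ⊢ σ ∧ π then PA ⊢ σ ∨ π. -/

import Mathlib

open FirstOrder Language
open scoped FirstOrder

namespace Guaspari

/-- The first-order language of arithmetic: a constant `0`, a unary function `S`,
binary functions `+` (coded `false`) and `·` (coded `true`), and a binary relation `≤`. -/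
def LA : FirstOrder.Language :=
  ⟨fun n => match n with | 0 => Unit | 1 => Unit | 2 => Bool | _ => Empty,
   fun n => match n with | 2 => Unit | _ => Empty⟩

/-- Sentences of the language of arithmetic. -/
abbrev Snt : Type := LA.Sentence

/-- Theories (sets of sentences) in the language of arithmetic. -/
abbrev Thy : Type := LA.Theory

/-- The term `0`. -/
def zeroT {α : Type} {n : ℕ} : LA.Term (α ⊕ Fin n) :=
  Constants.term (show LA.Constants from Unit.unit)

/-- The term `S t`. -/
def succT {α : Type} {n : ℕ} (t : LA.Term (α ⊕ Fin n)) : LA.Term (α ⊕ Fin n) :=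
  Functions.apply₁ (show LA.Functions 1 from Unit.unit) t

/-- The term `t + u`. -/
def addT {α : Type} {n : ℕ} (t u : LA.Term (α ⊕ Fin n)) : LA.Term (α ⊕ Fin n) :=
  Functions.apply₂ (show LA.Functions 2 from false) t u

/-- The term `t * u`. -/
def mulT {α : Type} {n : ℕ} (t u : LA.Term (α ⊕ Fin n)) : LA.Term (α ⊕ Fin n) :=
  Functions.apply₂ (show LA.Functions 2 from true) t u

/-- The atomic formula `t ≤ u`. -/
def leF {α : Type} {n : ℕ} (t u : LA.Term (α ⊕ Fin n)) : LA.BoundedFormula α n :=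
  Relations.boundedFormula₂ (show LA.Relations 2 from Unit.unit) t u

/-- The `i`-th (de Bruijn-indexed) bound variable as a term. -/
def vT {m : ℕ} (i : Fin m) : LA.Term (Empty ⊕ Fin m) := Term.var (Sum.inr i)

/-- The induction axiom for the formula `φ(x₀,…,x_{k-1}, x_k)` with induction on `x_k`,
universally closed over the parameters `x₀,…,x_{k-1}`. -/
def indAxiom {k : ℕ} (φ : LA.BoundedFormula Empty (k + 1)) : Snt :=
  let base := ∀' ((vT (Fin.last k) =' zeroT) ⟹ φ)
  let step := ∀' (φ ⟹
    ∀' ((vT (Fin.last (k + 1)) =' succT (vT (Fin.castSucc (Fin.last k)))) ⟹ φ.liftAt 1 k))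
  ((base ⊓ step) ⟹ ∀' φ).alls

/-- The axioms of Peano arithmetic `PA`: the basic axioms for `0`, `S`, `+`, `·`, `≤`,
together with the full induction scheme. -/
def PAAx : Thy :=
  {∀' ∼(succT (vT 0) =' zeroT),
   ∀' ∀' ((succT (vT 0) =' succT (vT 1)) ⟹ (vT 0 =' vT 1)),
   ∀' (addT (vT 0) zeroT =' vT 0),
   ∀' ∀' (addT (vT 0) (succT (vT 1)) =' succT (addT (vT 0) (vT 1))),
   ∀' (mulT (vT 0) zeroT =' zeroT),
   ∀' ∀' (mulT (vT 0) (succT (vT 1)) =' addT (mulT (vT 0) (vT 1)) (vT 0)),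
   ∀' ∀' (leF (vT 0) (vT 1) ⇔ ∃' (addT (vT 2) (vT 0) =' vT 1))} ∪
  {φ | ∃ (k : ℕ) (ψ : LA.BoundedFormula Empty (k + 1)), φ = indAxiom ψ}

/-- `Prv T φ`: the sentence `φ` is provable from the theory `T` (equivalently, by the
Gödel completeness theorem, `φ` holds in every model of `T`). -/
def Prv (T : Thy) (φ : Snt) : Prop := T ⊨ᵇ φ

/-- `Th T`: the set of sentences provable from `T`. -/
def Th (T : Thy) : Set Snt := {φ | Prv T φ}

/-- `Con T`: the theory `T` is consistent. -/
def Con (T : Thy) : Prop := ¬ Prv T ⊥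

/-- The theory `T + φ`. -/
def add (T : Thy) (φ : Snt) : Thy := insert φ T

/-- `T` is an extension of `PA`. -/
def ExtPA (T : Thy) : Prop := ∀ φ ∈ PAAx, Prv T φ

/-- `V` is a subtheory of `T` (containing `PA`, as assumed throughout the paper). -/
def SubThy (V T : Thy) : Prop := ExtPA V ∧ ∀ φ, Prv V φ → Prv T φ

/-- Δ₀ (bounded) formulas. -/
inductive IsDelta0 : ∀ {m : ℕ}, LA.BoundedFormula Empty m → Prop
  | falsum {m : ℕ} : IsDelta0 (⊥ : LA.BoundedFormula Empty m)
  | equal {m : ℕ} (t u : LA.Term (Empty ⊕ Fin m)) : IsDelta0 (t =' u)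
  | le {m : ℕ} (t u : LA.Term (Empty ⊕ Fin m)) : IsDelta0 (leF t u)
  | imp {m : ℕ} {φ ψ : LA.BoundedFormula Empty m} :
      IsDelta0 φ → IsDelta0 ψ → IsDelta0 (φ ⟹ ψ)
  | ball {m : ℕ} (t : LA.Term (Empty ⊕ Fin m)) {φ : LA.BoundedFormula Empty (m + 1)} :
      IsDelta0 φ →
      IsDelta0 (∀' (leF (vT (Fin.last m)) (t.relabel (Sum.map id Fin.castSucc)) ⟹ φ))
  | bex {m : ℕ} (t : LA.Term (Empty ⊕ Fin m)) {φ : LA.BoundedFormula Empty (m + 1)} :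
      IsDelta0 φ →
      IsDelta0 (∃' (leF (vT (Fin.last m)) (t.relabel (Sum.map id Fin.castSucc)) ⊓ φ))

mutual
  /-- `Σ_k` formulas (cumulatively: every `Π_k` formula is `Σ_{k+1}`). -/
  inductive IsSigmaFml : ℕ → ∀ {m : ℕ}, LA.BoundedFormula Empty m → Prop
    | ofDelta0 {m : ℕ} {φ : LA.BoundedFormula Empty m} : IsDelta0 φ → IsSigmaFml 0 φ
    | ofPi {k : ℕ} {m : ℕ} {φ : LA.BoundedFormula Empty m} :
        IsPiFml k φ → IsSigmaFml (k + 1) φ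
    | ex {k : ℕ} {m : ℕ} {φ : LA.BoundedFormula Empty (m + 1)} :
        IsSigmaFml (k + 1) φ → IsSigmaFml (k + 1) (∃' φ)
  /-- `Π_k` formulas (cumulatively: every `Σ_k` formula is `Π_{k+1}`). -/
  inductive IsPiFml : ℕ → ∀ {m : ℕ}, LA.BoundedFormula Empty m → Prop
    | ofDelta0 {m : ℕ} {φ : LA.BoundedFormula Empty m} : IsDelta0 φ → IsPiFml 0 φ
    | ofSigma {k : ℕ} {m : ℕ} {φ : LA.BoundedFormula Empty m} :
        IsSigmaFml k φ → IsPiFml (k + 1) φ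
    | all {k : ℕ} {m : ℕ} {φ : LA.BoundedFormula Empty (m + 1)} :
        IsPiFml (k + 1) φ → IsPiFml (k + 1) (∀' φ)
end

/-- The set of `Σ_k` sentences. -/
def SigmaS (k : ℕ) : Set Snt := {φ | IsSigmaFml k φ}

/-- The set of `Π_k` sentences. -/
def PiS (k : ℕ) : Set Snt := {φ | IsPiFml k φ}

/-- The set of `Σ_k ∧ Π_k` sentences, i.e. sentences of the form `σ ∧ π` with
`σ` a `Σ_k` sentence and `π` a `Π_k` sentence. -/
def SigAndPiS (k : ℕ) : Set Snt :=
  {φ | ∃ σ ∈ SigmaS k, ∃ π ∈ PiS k, φ = σ ⊓ π}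

/-- `B(Σ_k)` sentences: Boolean combinations of `Σ_k` sentences. -/
inductive IsBoolSigma (k : ℕ) : Snt → Prop
  | base {φ : Snt} : φ ∈ SigmaS k → IsBoolSigma k φ
  | not {φ : Snt} : IsBoolSigma k φ → IsBoolSigma k (∼φ)
  | imp {φ ψ : Snt} : IsBoolSigma k φ → IsBoolSigma k ψ → IsBoolSigma k (φ ⟹ ψ)
  | inf {φ ψ : Snt} : IsBoolSigma k φ → IsBoolSigma k ψ → IsBoolSigma k (φ ⊓ ψ)
  | sup {φ ψ : Snt} : IsBoolSigma k φ → IsBoolSigma k ψ → IsBoolSigma k (φ ⊔ ψ)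

/-- The set of `B(Σ_k)` sentences. -/
def BSigmaS (k : ℕ) : Set Snt := {φ | IsBoolSigma k φ}

/-- The set of `Γ` sentences provable in `T`, `Th_Γ(T)`. -/
def ThIn (Γ : Set Snt) (T : Thy) : Set Snt := Γ ∩ Th T

instance (i : ℕ) : Encodable (LA.Functions i) :=
  match i with
  | 0 => inferInstanceAs (Encodable Unit)
  | 1 => inferInstanceAs (Encodable Unit)
  | 2 => inferInstanceAs (Encodable Bool)
  | (_ + 3) => inferInstanceAs (Encodable Empty)

instance (i : ℕ) : Encodable (LA.Relations i) :=
  match i with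
  | 0 => inferInstanceAs (Encodable Empty)
  | 1 => inferInstanceAs (Encodable Empty)
  | 2 => inferInstanceAs (Encodable Unit)
  | (_ + 3) => inferInstanceAs (Encodable Empty)

/-- A Gödel numbering of sentences, via Mathlib's encoding of bounded formulas. -/
def gnum (φ : Snt) : ℕ :=
  Encodable.encode
    (show List ((Σ k, LA.Term (Empty ⊕ Fin k)) ⊕ ((Σ n, LA.Relations n) ⊕ ℕ)) from
      BoundedFormula.encoding.encode (⟨0, φ⟩ : Σ n, LA.BoundedFormula Empty n))

/-- The (axiom set of the) theory `T` is computable. -/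
def CompThy (T : Thy) : Prop :=
  ComputablePred (fun m : ℕ => ∃ φ ∈ T, gnum φ = m)

/-- `T` is a computable consistent extension of `PA`. -/
def GoodThy (T : Thy) : Prop := CompThy T ∧ Con T ∧ ExtPA T

/-- `φ` is `Γ`-conservative over `T` for a class of sentences `Γ`:
every `Γ` sentence provable in `T + φ` is provable in `T`. -/
def ConsIn (Γ : Set Snt) (T : Thy) (φ : Snt) : Prop :=
  ∀ γ ∈ Γ, Prv (add T φ) γ → Prv T γ

/-- `φ` is hereditarily `Γ`-conservative over `T`: `Γ`-conservative over every
subtheory of `T` (containing `PA`). -/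
def HConsIn (Γ : Set Snt) (T : Thy) (φ : Snt) : Prop :=
  ∀ V : Thy, SubThy V T → ConsIn Γ V φ

/-- `φ` is `Σ_k↓Π_k`-conservative over `V`. -/
def SPCons (k : ℕ) (V : Thy) (φ : Snt) : Prop :=
  ∀ σ ∈ SigmaS k, ∀ π ∈ PiS k, Prv (add V φ) (σ ⊓ π) → Prv V (σ ⊔ π)

/-- `φ` is hereditarily `Σ_k↓Π_k`-conservative over `T`. -/
def HSPCons (k : ℕ) (T : Thy) (φ : Snt) : Prop :=
  ∀ V : Thy, SubThy V T → SPCons k V φ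

/-- The theory `S` is `Σ_k↓Π_k`-conservative over `PA`. -/
def ThySPConsPA (k : ℕ) (S : Thy) : Prop :=
  ∀ σ ∈ SigmaS k, ∀ π ∈ PiS k, Prv S (σ ⊓ π) → Prv PAAx (σ ⊔ π)

/-- `δ` is a `Δ_k(S)` sentence: `S`-provably equivalent to both a `Σ_k` sentence
and a `Π_k` sentence. -/
def IsDeltaIn (k : ℕ) (S : Thy) (δ : Snt) : Prop :=
  (∃ σ ∈ SigmaS k, Prv S (δ ⇔ σ)) ∧ ∃ π ∈ PiS k, Prv S (δ ⇔ π)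

/-- `φ` is `Δ_k(S)`-conservative over `V`. -/
def DeltaConsRel (k : ℕ) (S V : Thy) (φ : Snt) : Prop :=
  ∀ δ : Snt, IsDeltaIn k S δ → Prv (add V φ) δ → Prv V δ

/-- `φ` is `Δ_k`-conservative over `T`, i.e. `Δ_k(Th(T))`-conservative over `T`. -/
def DeltaCons (k : ℕ) (T : Thy) (φ : Snt) : Prop := DeltaConsRel k (Th T) T φ

/-- `φ` is hereditarily `Δ_k`-conservative over `T`. -/
def HDeltaCons (k : ℕ) (T : Thy) (φ : Snt) : Prop :=
  ∀ V : Thy, SubThy V T → DeltaConsRel k (Th V) V φ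

/-- `φ` is doubly `Π_k`-conservative over `T`: `φ` is `Π_k`-conservative and `¬φ` is
`Σ_k`-conservative over `T`. -/
def DCons (k : ℕ) (T : Thy) (φ : Snt) : Prop :=
  ConsIn (PiS k) T φ ∧ ConsIn (SigmaS k) T (∼φ)

/-- `φ` is hereditarily doubly `Π_k`-conservative over `T`. -/
def HDCons (k : ℕ) (T : Thy) (φ : Snt) : Prop :=
  ∀ V : Thy, SubThy V T → DCons k V φ

/-- `(T,U)` is a `B_n`-pair. -/
def Bpair (n : ℕ) (T U : Thy) : Prop :=
  (¬ ThIn (PiS n) T ⊆ Th U ∨ Con (T ∪ ThIn (PiS n) U)) ∧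
  (¬ ThIn (PiS n) U ⊆ Th T ∨ Con (U ∪ ThIn (PiS n) T))

/-- `(T,U)` is a `C_n`-pair. -/
def Cpair (n : ℕ) (T U : Thy) : Prop :=
  Con (T ∪ ThIn (PiS n) U) ∧ Con (U ∪ ThIn (PiS n) T)

/-- `(T,U)` is a `C⁻_n`-pair. -/
def Cmpair (n : ℕ) (T U : Thy) : Prop :=
  Con (T ∪ ThIn (PiS n) U) ∨ Con (U ∪ ThIn (PiS n) T)

/-- `(T,U)` is a `C^∧_n`-pair. -/
def Capair (n : ℕ) (T U : Thy) : Prop :=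
  Con (T ∪ ThIn (SigAndPiS n) U) ∧ Con (U ∪ ThIn (SigAndPiS n) T)

/-- `(T,U)` is a `C^B_n`-pair. -/
def CBpair (n : ℕ) (T U : Thy) : Prop :=
  Con (T ∪ ThIn (BSigmaS n) U)


set_option linter.unusedVariables false
set_option linter.unusedSimpArgs false

/-- Models of PA. -/
class PAM (M : Type) extends LA.Structure M where
  ax : ∀ φ ∈ PAAx, M ⊨ φ

/-- Bounded terms with free variables below `m`. -/
abbrev Tm (m : ℕ) := LA.Term (Empty ⊕ Fin m)
/-- Bounded formulas. -/
abbrev BF (m : ℕ) := LA.BoundedFormula Empty m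

section ops
variable {M : Type} [LA.Structure M]
def zeroM : M := Structure.funMap (L := LA) (show LA.Functions 0 from Unit.unit) ![]
def sucM (x : M) : M := Structure.funMap (L := LA) (show LA.Functions 1 from Unit.unit) ![x]
def addM (x y : M) : M := Structure.funMap (L := LA) (show LA.Functions 2 from false) ![x, y]
def mulM (x y : M) : M := Structure.funMap (L := LA) (show LA.Functions 2 from true) ![x, y]
def leM (x y : M) : Prop := Structure.RelMap (L := LA) (show LA.Relations 2 from Unit.unit) ![x, y]

/-- value of a bounded term -/
def tv {m : ℕ} (v : Fin m → M) (t : Tm m) : M := t.realize (Sum.elim default v)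

/-- realization of a bounded formula -/
def fv {m : ℕ} (v : Fin m → M) (φ : BF m) : Prop := φ.Realize default v

@[simp] theorem tv_zero {m : ℕ} (v : Fin m → M) : tv v zeroT = zeroM := by
  exact congrArg _ (funext fun i => i.elim0)
@[simp] theorem tv_succ {m : ℕ} (v : Fin m → M) (t : Tm m) : tv v (succT t) = sucM (tv v t) := by
  exact Term.realize_functions_apply₁
@[simp] theorem tv_add {m : ℕ} (v : Fin m → M) (t u : Tm m) :
    tv v (addT t u) = addM (tv v t) (tv v u) := by
  exact Term.realize_functions_apply₂
@[simp] theorem tv_mul {m : ℕ} (v : Fin m → M) (t u : Tm m) :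
    tv v (mulT t u) = mulM (tv v t) (tv v u) := by
  exact Term.realize_functions_apply₂
@[simp] theorem tv_var {m : ℕ} (v : Fin m → M) (i : Fin m) : tv v (vT i) = v i := by
  simp [tv, vT]
/-- weakening of a term -/
def liftT {m : ℕ} (t : Tm m) : Tm (m + 1) := t.relabel (Sum.map id Fin.castSucc)
@[simp] theorem tv_lift {m : ℕ} (v : Fin m → M) (x : M) (t : Tm m) :
    tv (Fin.snoc v x) (liftT t) = tv v t := by
  simp only [tv, liftT, Term.realize_relabel]
  congr 1
  funext i
  rcases i with i | i
  · exact i.elim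
  · simp
@[simp] theorem fv_bot {m : ℕ} (v : Fin m → M) : fv v (⊥ : BF m) ↔ False := Iff.rfl
@[simp] theorem fv_eq {m : ℕ} (v : Fin m → M) (t u : Tm m) : fv v (t =' u) ↔ tv v t = tv v u := by
  simp [fv, tv, Term.bdEqual, BoundedFormula.Realize]
@[simp] theorem fv_le {m : ℕ} (v : Fin m → M) (t u : Tm m) :
    fv v (leF t u) ↔ leM (tv v t) (tv v u) := by
  exact BoundedFormula.realize_rel₂
@[simp] theorem fv_imp {m : ℕ} (v : Fin m → M) (φ ψ : BF m) :
    fv v (φ ⟹ ψ) ↔ (fv v φ → fv v ψ) := Iff.rfl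
@[simp] theorem fv_all {m : ℕ} (v : Fin m → M) (φ : BF (m + 1)) :
    fv v (∀' φ) ↔ ∀ x, fv (Fin.snoc v x) φ := Iff.rfl
@[simp] theorem fv_ex {m : ℕ} (v : Fin m → M) (φ : BF (m + 1)) :
    fv v (∃' φ) ↔ ∃ x, fv (Fin.snoc v x) φ := BoundedFormula.realize_ex
@[simp] theorem fv_and {m : ℕ} (v : Fin m → M) (φ ψ : BF m) :
    fv v (φ ⊓ ψ) ↔ (fv v φ ∧ fv v ψ) := BoundedFormula.realize_inf
@[simp] theorem fv_or {m : ℕ} (v : Fin m → M) (φ ψ : BF m) :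
    fv v (φ ⊔ ψ) ↔ (fv v φ ∨ fv v ψ) := BoundedFormula.realize_sup
@[simp] theorem fv_not {m : ℕ} (v : Fin m → M) (φ : BF m) :
    fv v (∼φ) ↔ ¬ fv v φ := BoundedFormula.realize_not
@[simp] theorem fv_iff {m : ℕ} (v : Fin m → M) (φ ψ : BF m) :
    fv v (φ ⇔ ψ) ↔ (fv v φ ↔ fv v ψ) := BoundedFormula.realize_iff
theorem fv_snt (v : Fin 0 → M) (φ : Snt) : fv v φ ↔ M ⊨ φ := by
  rw [Subsingleton.elim v default]; exact Iff.rfl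
theorem fv_alls {m : ℕ} (φ : BF m) : M ⊨ φ.alls ↔ ∀ v : Fin m → M, fv v φ := by
  have := BoundedFormula.realize_alls (φ := φ) (M := M) (v := default)
  exact this
end ops

instance (priority := 2000) pamZero {M : Type} [PAM M] : Zero M := ⟨zeroM⟩
instance (priority := 2000) pamAdd {M : Type} [PAM M] : Add M := ⟨addM⟩
instance (priority := 2000) pamMul {M : Type} [PAM M] : Mul M := ⟨mulM⟩
instance (priority := 2000) pamOne {M : Type} [PAM M] : One M := ⟨sucM zeroM⟩

theorem zeroM_eq {M : Type} [PAM M] : (zeroM : M) = 0 := rfl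
theorem addM_eq {M : Type} [PAM M] (x y : M) : addM x y = x + y := rfl
theorem mulM_eq {M : Type} [PAM M] (x y : M) : mulM x y = x * y := rfl

theorem ind_iff {M : Type} [LA.Structure M] {k : ℕ} (φ : BF (k + 1)) :
    M ⊨ indAxiom φ ↔ ∀ v : Fin k → M, fv (Fin.snoc v zeroM) φ →
      (∀ x, fv (Fin.snoc v x) φ → fv (Fin.snoc v (sucM x)) φ) → ∀ x, fv (Fin.snoc v x) φ := by
  unfold indAxiom
  simp only [fv_alls, fv_imp, fv_and, fv_all, fv_eq, tv_var, Fin.snoc_last, tv_zero, tv_succ,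
    Fin.snoc_castSucc, forall_eq, and_imp]
  have key : ∀ (v : Fin k → M) (x y : M),
      fv (Fin.snoc (Fin.snoc v x : Fin (k+1) → M) y : Fin (k+1+1) → M) (φ.liftAt 1 k) ↔ fv (Fin.snoc v y) φ := by
    intro v x y
    unfold fv
    rw [BoundedFormula.realize_liftAt_one (by omega)]
    rw [iff_iff_eq]
    congr 1
    funext i
    refine Fin.lastCases ?_ (fun i => ?_) i
    · simp only [Function.comp, Fin.val_last, lt_irrefl, if_false, Fin.snoc_last]
      have : (Fin.last k).succ = Fin.last (k+1) := rfl
      rw [this, Fin.snoc_last]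
    · simp [Fin.snoc_castSucc]
  simp only [key]

/-- uniform families of predicates on environments -/
abbrev Pred := ∀ (M : Type) [PAM M], List M → Prop
abbrev TFam := ∀ (M : Type) [PAM M], List M → M
abbrev EFam := ∀ (M : Type) [PAM M], List M → List M

def TD (f : TFam) : Prop := ∀ (m : ℕ) (ts : List (Tm m)), ∃ t : Tm m,
  ∀ (M : Type) [PAM M] (v : Fin m → M), tv v t = f M (ts.map (tv v))
def ED (g : EFam) : Prop := ∀ (m : ℕ) (ts : List (Tm m)), ∃ us : List (Tm m),
  ∀ (M : Type) [PAM M] (v : Fin m → M), us.map (tv v) = g M (ts.map (tv v))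
def FD (P : Pred) : Prop := ∀ (m : ℕ) (ts : List (Tm m)), ∃ φ : BF m,
  ∀ (M : Type) [PAM M] (v : Fin m → M), fv v φ ↔ P M (ts.map (tv v))
def D0 (P : Pred) : Prop := ∀ (m : ℕ) (ts : List (Tm m)), ∃ φ : BF m, IsDelta0 φ ∧
  ∀ (M : Type) [PAM M] (v : Fin m → M), fv v φ ↔ P M (ts.map (tv v))

theorem ED.id : ED (fun _ _ v => v) := fun m ts => ⟨ts, fun _ _ _ => rfl⟩
theorem ED.tail {g : EFam} (h : ED g) : ED (fun M _ v => (g M v).tail) := fun m ts => by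
  obtain ⟨us, hu⟩ := h m ts
  exact ⟨us.tail, fun M _ v => by
    show _ = (g M _).tail
    rw [← hu]; simp⟩
theorem ED.nil : ED (fun _ _ _ => []) := fun m ts => ⟨[], fun _ _ _ => rfl⟩
theorem ED.cons {f : TFam} {g : EFam} (hf : TD f) (h : ED g) : ED (fun M _ v => f M v :: g M v) :=
  fun m ts => by
  obtain ⟨us, hu⟩ := h m ts
  obtain ⟨t, ht⟩ := hf m ts
  exact ⟨t :: us, fun M _ v => by simp [hu, ht]⟩
theorem TD.head {g : EFam} (h : ED g) : TD (fun M _ v => (g M v).headD 0) := fun m ts => by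
  obtain ⟨us, hu⟩ := h m ts
  refine ⟨us.headD zeroT, fun M _ v => ?_⟩
  show _ = (g M _).headD 0
  rw [← hu]
  cases us
  · simp; rfl
  · simp
theorem TD.zero : TD (fun _ _ _ => 0) := fun m ts => ⟨zeroT, fun M _ v => by simp; rfl⟩
theorem TD.one : TD (fun _ _ _ => 1) := fun m ts => ⟨succT zeroT, fun M _ v => by simp; rfl⟩
theorem TD.suc {f : TFam} (hf : TD f) : TD (fun M _ v => sucM (f M v)) := fun m ts => by
  obtain ⟨t, ht⟩ := hf m ts
  exact ⟨succT t, fun M _ v => by simp [ht]⟩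
theorem TD.add {f g : TFam} (hf : TD f) (hg : TD g) : TD (fun M _ v => f M v + g M v) := fun m ts => by
  obtain ⟨t, ht⟩ := hf m ts
  obtain ⟨u, hu⟩ := hg m ts
  exact ⟨addT t u, fun M _ v => by simp [ht, hu]; rfl⟩
theorem TD.mul {f g : TFam} (hf : TD f) (hg : TD g) : TD (fun M _ v => f M v * g M v) := fun m ts => by
  obtain ⟨t, ht⟩ := hf m ts
  obtain ⟨u, hu⟩ := hg m ts
  exact ⟨mulT t u, fun M _ v => by simp [ht, hu]; rfl⟩
theorem TD.sub {f : TFam} {g : EFam} (hf : TD f) (hg : ED g) : TD (fun M _ v => f M (g M v)) :=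
  fun m ts => by
  obtain ⟨us, hu⟩ := hg m ts
  obtain ⟨t, ht⟩ := hf m us
  exact ⟨t, fun M _ v => by rw [ht, hu]⟩

theorem D0.fd {P : Pred} (h : D0 P) : FD P := fun m ts => by
  obtain ⟨φ, -, h⟩ := h m ts
  exact ⟨φ, h⟩
theorem D0.congr {P Q : Pred} (h : D0 P) (hPQ : ∀ (M : Type) [PAM M] (v : List M), P M v ↔ Q M v) :
    D0 Q := fun m ts => by
  obtain ⟨φ, h0, h⟩ := h m ts
  exact ⟨φ, h0, fun M _ v => by rw [h, hPQ]⟩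
theorem FD.congr {P Q : Pred} (h : FD P) (hPQ : ∀ (M : Type) [PAM M] (v : List M), P M v ↔ Q M v) :
    FD Q := fun m ts => by
  obtain ⟨φ, h⟩ := h m ts
  exact ⟨φ, fun M _ v => by rw [h, hPQ]⟩
theorem D0.sub {P : Pred} {g : EFam} (hf : D0 P) (hg : ED g) : D0 (fun M _ v => P M (g M v)) :=
  fun m ts => by
  obtain ⟨us, hu⟩ := hg m ts
  obtain ⟨t, h0, ht⟩ := hf m us
  exact ⟨t, h0, fun M _ v => by rw [ht, hu]⟩
theorem FD.sub {P : Pred} {g : EFam} (hf : FD P) (hg : ED g) : FD (fun M _ v => P M (g M v)) :=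
  fun m ts => by
  obtain ⟨us, hu⟩ := hg m ts
  obtain ⟨t, ht⟩ := hf m us
  exact ⟨t, fun M _ v => by rw [ht, hu]⟩
theorem D0.eq {f g : TFam} (hf : TD f) (hg : TD g) : D0 (fun M _ v => f M v = g M v) := fun m ts => by
  obtain ⟨t, ht⟩ := hf m ts
  obtain ⟨u, hu⟩ := hg m ts
  exact ⟨t =' u, .equal _ _, fun M _ v => by simp [ht, hu]⟩
theorem D0.leM {f g : TFam} (hf : TD f) (hg : TD g) : D0 (fun M _ v => leM (f M v) (g M v)) :=
  fun m ts => by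
  obtain ⟨t, ht⟩ := hf m ts
  obtain ⟨u, hu⟩ := hg m ts
  exact ⟨leF t u, .le _ _, fun M _ v => by simp [ht, hu]⟩
theorem D0.fls : D0 (fun _ _ _ => False) := fun m ts => ⟨⊥, .falsum, fun M _ v => by simp⟩
theorem D0.imp {P Q : Pred} (hP : D0 P) (hQ : D0 Q) : D0 (fun M _ v => P M v → Q M v) := fun m ts => by
  obtain ⟨φ, h0, h⟩ := hP m ts
  obtain ⟨ψ, h0', h'⟩ := hQ m ts
  exact ⟨φ ⟹ ψ, .imp h0 h0', fun M _ v => by rw [fv_imp, h, h']⟩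
theorem D0.not {P : Pred} (hP : D0 P) : D0 (fun M _ v => ¬ P M v) := hP.imp D0.fls
theorem D0.or {P Q : Pred} (hP : D0 P) (hQ : D0 Q) : D0 (fun M _ v => P M v ∨ Q M v) :=
  (hP.not.imp hQ).congr (fun M _ v => by tauto)
theorem D0.and {P Q : Pred} (hP : D0 P) (hQ : D0 Q) : D0 (fun M _ v => P M v ∧ Q M v) :=
  (hP.imp hQ.not).not.congr (fun M _ v => by tauto)
theorem D0.iff {P Q : Pred} (hP : D0 P) (hQ : D0 Q) : D0 (fun M _ v => P M v ↔ Q M v) :=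
  ((hP.imp hQ).and (hQ.imp hP)).congr (fun M _ v => by tauto)
theorem map_lift {M : Type} [LA.Structure M] {m : ℕ} (ts : List (Tm m)) (v : Fin m → M) (x : M) :
    (ts.map liftT).map (tv (Fin.snoc v x : Fin (m+1) → M)) = ts.map (tv v) := by
  simp [List.map_map, Function.comp_def]
theorem D0.ballM {f : TFam} {R : ∀ (M : Type) [PAM M], List M → M → Prop} (hf : TD f)
    (hR : D0 (fun M _ w => R M w.tail (w.headD 0))) :
    D0 (fun M _ v => ∀ x, Guaspari.leM x (f M v) → R M v x) := fun m ts => by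
  obtain ⟨t, ht⟩ := hf m ts
  obtain ⟨φ, h0, h⟩ := hR (m + 1) (vT (Fin.last m) :: ts.map liftT)
  refine ⟨_, IsDelta0.ball t h0, fun M _ v => ?_⟩
  have : t.relabel (Sum.map id Fin.castSucc) = liftT t := rfl
  simp only [this, fv_all, fv_imp, fv_le, tv_var, tv_lift, Fin.snoc_last, h, List.map_cons, ht,
    map_lift, List.tail_cons, List.headD_cons]
theorem FD.all {R : ∀ (M : Type) [PAM M], List M → M → Prop}
    (hR : FD (fun M _ w => R M w.tail (w.headD 0))) :
    FD (fun M _ v => ∀ x, R M v x) := fun m ts => by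
  obtain ⟨φ, h⟩ := hR (m + 1) (vT (Fin.last m) :: ts.map liftT)
  refine ⟨∀' φ, fun M _ v => ?_⟩
  simp only [fv_all, tv_var, Fin.snoc_last, h, List.map_cons,
    map_lift, List.tail_cons, List.headD_cons]
theorem FD.imp {P Q : Pred} (hP : FD P) (hQ : FD Q) : FD (fun M _ v => P M v → Q M v) := fun m ts => by
  obtain ⟨φ, h⟩ := hP m ts
  obtain ⟨ψ, h'⟩ := hQ m ts
  exact ⟨φ ⟹ ψ, fun M _ v => by rw [fv_imp, h, h']⟩
theorem FD.not {P : Pred} (hP : FD P) : FD (fun M _ v => ¬ P M v) := hP.imp D0.fls.fd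
theorem FD.or {P Q : Pred} (hP : FD P) (hQ : FD Q) : FD (fun M _ v => P M v ∨ Q M v) :=
  (hP.not.imp hQ).congr (fun M _ v => by tauto)
theorem FD.and {P Q : Pred} (hP : FD P) (hQ : FD Q) : FD (fun M _ v => P M v ∧ Q M v) :=
  (hP.imp hQ.not).not.congr (fun M _ v => by tauto)
theorem FD.iff {P Q : Pred} (hP : FD P) (hQ : FD Q) : FD (fun M _ v => P M v ↔ Q M v) :=
  ((hP.imp hQ).and (hQ.imp hP)).congr (fun M _ v => by tauto)
theorem FD.ex {R : ∀ (M : Type) [PAM M], List M → M → Prop}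
    (hR : FD (fun M _ w => R M w.tail (w.headD 0))) :
    FD (fun M _ v => ∃ x, R M v x) := by
  refine (FD.not (FD.all (R := fun M _ v x => ¬ R M v x) hR.not)).congr (fun M _ v => ?_)
  push Not
  rfl
theorem FD.eq {f g : TFam} (hf : TD f) (hg : TD g) : FD (fun M _ v => f M v = g M v) := (D0.eq hf hg).fd

theorem ofFn_vars {M : Type} [PAM M] (l : List M) (x : M) :
    ∃ ts : List (Tm (l.length + 1)), ∀ y, ts.map (tv (Fin.snoc (fun i => l[i]) y : Fin (l.length+1) → M)) = y :: l := by
  refine ⟨vT (Fin.last _) :: List.ofFn (fun i : Fin l.length => vT (Fin.castSucc i)), fun y => ?_⟩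
  simp [List.map_ofFn, Function.comp_def]

theorem pam_ind {M : Type} [PAM M] {P : Pred} (hP : FD P) (l : List M)
    (h0 : P M (0 :: l)) (hs : ∀ x, P M (x :: l) → P M (sucM x :: l)) : ∀ x, P M (x :: l) := by
  obtain ⟨ts, hts⟩ := ofFn_vars l 0
  obtain ⟨φ, hφ⟩ := hP _ ts
  have := (ind_iff φ).1 (PAM.ax (M := M) _ (Or.inr ⟨_, _, rfl⟩)) (fun i => l[i])
  simp only [hφ, hts] at this
  exact this h0 hs

/-! basic axioms -/
section basic
variable {M : Type} [PAM M]
theorem suc_ne (x : M) : sucM x ≠ 0 := by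
  have := PAM.ax (M := M) _ (Or.inl (Or.inl rfl))
  rw [← fv_snt default] at this
  simp only [fv_all, fv_not, fv_eq, tv_succ, tv_var, tv_zero] at this
  exact this x
theorem suc_inj {x y : M} (h : sucM x = sucM y) : x = y := by
  have := PAM.ax (M := M) _ (Or.inl (Or.inr (Or.inl rfl)))
  rw [← fv_snt default] at this
  simp only [fv_all, fv_imp, fv_eq, tv_succ, tv_var, tv_zero] at this
  exact this x y h
theorem p_add_zero (x : M) : x + 0 = x := by
  have := PAM.ax (M := M) _ (Or.inl (Or.inr (Or.inr (Or.inl rfl))))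
  rw [← fv_snt default] at this
  simp only [fv_all, fv_eq, tv_succ, tv_var, tv_zero, tv_add] at this
  exact this x
theorem p_add_suc (x y : M) : x + sucM y = sucM (x + y) := by
  have := PAM.ax (M := M) _ (Or.inl (Or.inr (Or.inr (Or.inr (Or.inl rfl)))))
  rw [← fv_snt default] at this
  simp only [fv_all, fv_eq, tv_succ, tv_var, tv_zero, tv_add] at this
  exact this x y
theorem p_mul_zero (x : M) : x * 0 = 0 := by
  have := PAM.ax (M := M) _ (Or.inl (Or.inr (Or.inr (Or.inr (Or.inr (Or.inl rfl))))))
  rw [← fv_snt default] at this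
  simp only [fv_all, fv_eq, tv_succ, tv_var, tv_zero, tv_mul] at this
  exact this x
theorem p_mul_suc (x y : M) : x * sucM y = x * y + x := by
  have := PAM.ax (M := M) _ (Or.inl (Or.inr (Or.inr (Or.inr (Or.inr (Or.inr (Or.inl rfl)))))))
  rw [← fv_snt default] at this
  simp only [fv_all, fv_eq, tv_succ, tv_var, tv_zero, tv_mul, tv_add] at this
  exact this x y
theorem p_le_iff (x y : M) : leM x y ↔ ∃ z, z + x = y := by
  have := PAM.ax (M := M) _ (Or.inl (Or.inr (Or.inr (Or.inr (Or.inr (Or.inr (Or.inr rfl)))))))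
  rw [← fv_snt default] at this
  simp only [fv_all, fv_eq, tv_succ, tv_var, tv_zero, tv_mul, tv_add, fv_iff, fv_le, fv_ex] at this
  exact this x y
end basic

section algebra
variable {M : Type} [PAM M]

theorem p_zero_add (x : M) : 0 + x = x := by
  refine pam_ind (P := fun M _ v => 0 + v.headD 0 = v.headD 0)
    (FD.eq (TD.add TD.zero (TD.head ED.id)) (TD.head ED.id)) [] ?_ ?_ x
  · exact p_add_zero _
  · intro x hx
    simp only [List.headD_cons] at *
    rw [p_add_suc, hx]
theorem p_suc_add (x y : M) : sucM x + y = sucM (x + y) := by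
  refine pam_ind (P := fun M _ v => sucM (v.tail.headD 0) + v.headD 0 = sucM (v.tail.headD 0 + v.headD 0))
    (FD.eq (TD.add (TD.suc (TD.head ED.id.tail)) (TD.head ED.id))
      (TD.suc (TD.add (TD.head ED.id.tail) (TD.head ED.id)))) [x] ?_ ?_ y
  · simp only [List.headD_cons, List.tail_cons, p_add_zero]
  · intro x hx
    simp only [List.headD_cons, List.tail_cons] at *
    rw [p_add_suc, hx, p_add_suc]
theorem p_add_comm (x y : M) : x + y = y + x := by
  refine pam_ind (P := fun M _ v => (v.tail.headD 0) + v.headD 0 = (v.headD 0 + v.tail.headD 0))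
    (FD.eq (TD.add ((TD.head ED.id.tail)) (TD.head ED.id))
      ((TD.add (TD.head ED.id) (TD.head ED.id.tail)))) [x] ?_ ?_ y
  · simp only [List.headD_cons, List.tail_cons, p_add_zero, p_zero_add]
  · intro x hx
    simp only [List.headD_cons, List.tail_cons] at *
    rw [p_add_suc, hx, p_suc_add]
theorem p_add_assoc (x y z : M) : x + y + z = x + (y + z) := by
  refine pam_ind (P := fun M _ v => (v.tail.headD 0) + (v.tail.tail.headD 0) + v.headD 0 = (v.tail.headD 0) + ((v.tail.tail.headD 0) + v.headD 0))
    (FD.eq ((TD.add ((TD.head ED.id.tail)) (TD.head ED.id.tail.tail)).add (TD.head ED.id))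
      ((TD.add (TD.head ED.id.tail) ((TD.head ED.id.tail.tail).add (TD.head ED.id))))) [x, y] ?_ ?_ z
  · simp only [List.headD_cons, List.tail_cons, p_add_zero, p_zero_add]
  · intro x hx
    simp only [List.headD_cons, List.tail_cons] at *
    rw [p_add_suc, hx, p_add_suc, p_add_suc]
theorem p_zero_mul (x : M) : 0 * x = 0 := by
  refine pam_ind (P := fun M _ v => 0 * v.headD 0 = 0)
    (FD.eq (TD.mul TD.zero (TD.head ED.id)) (TD.zero)) [] ?_ ?_ x
  · exact p_mul_zero _
  · intro x hx
    simp only [List.headD_cons] at *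
    rw [p_mul_suc, hx, p_add_zero]
theorem p_suc_eq (x : M) : sucM x = x + 1 := by
  show _ = x + sucM 0
  rw [p_add_suc, p_add_zero]
theorem p_suc_mul (x y : M) : sucM x * y = x * y + y := by
  refine pam_ind (P := fun M _ v => sucM (v.tail.headD 0) * v.headD 0 = (v.tail.headD 0 * v.headD 0) + v.headD 0)
    (FD.eq (TD.mul (TD.suc (TD.head ED.id.tail)) (TD.head ED.id))
      ((TD.add (TD.mul (TD.head ED.id.tail) (TD.head ED.id)) (TD.head ED.id)))) [x] ?_ ?_ y
  · simp only [List.headD_cons, List.tail_cons, p_add_zero, p_mul_zero]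
  · intro x hx
    simp only [List.headD_cons, List.tail_cons] at *
    rw [p_mul_suc, hx, p_mul_suc, p_suc_eq, p_suc_eq]
    simp only [p_add_assoc]
    congr 1
    simp only [← p_add_assoc]
    rw [p_add_comm x]
theorem p_mul_comm (x y : M) : x * y = y * x := by
  refine pam_ind (P := fun M _ v => (v.tail.headD 0) * v.headD 0 = (v.headD 0 * v.tail.headD 0))
    (FD.eq (TD.mul ((TD.head ED.id.tail)) (TD.head ED.id))
      ((TD.mul (TD.head ED.id) (TD.head ED.id.tail)))) [x] ?_ ?_ y
  · simp only [List.headD_cons, List.tail_cons, p_mul_zero, p_zero_mul]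
  · intro x hx
    simp only [List.headD_cons, List.tail_cons] at *
    rw [p_mul_suc, hx, p_suc_mul]
theorem p_mul_add (x y z : M) : x * (y + z) = x * y + x * z := by
  refine pam_ind (P := fun M _ v => (v.tail.headD 0) * ((v.tail.tail.headD 0) + v.headD 0) = (v.tail.headD 0) * (v.tail.tail.headD 0) + (v.tail.headD 0) * v.headD 0)
    (FD.eq (TD.mul (TD.head ED.id.tail) ((TD.head ED.id.tail.tail).add (TD.head ED.id)))
      (((TD.head ED.id.tail).mul (TD.head ED.id.tail.tail)).add ((TD.head ED.id.tail).mul (TD.head ED.id)))) [x, y] ?_ ?_ z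
  · simp only [List.headD_cons, List.tail_cons, p_add_zero, p_mul_zero]
  · intro x hx
    simp only [List.headD_cons, List.tail_cons] at *
    rw [p_add_suc, p_mul_suc, p_mul_suc, hx, p_add_assoc]
theorem p_mul_assoc (x y z : M) : x * y * z = x * (y * z) := by
  refine pam_ind (P := fun M _ v => (v.tail.headD 0) * (v.tail.tail.headD 0) * v.headD 0 = (v.tail.headD 0) * ((v.tail.tail.headD 0) * v.headD 0))
    (FD.eq ((TD.mul ((TD.head ED.id.tail)) (TD.head ED.id.tail.tail)).mul (TD.head ED.id))
      ((TD.mul (TD.head ED.id.tail) ((TD.head ED.id.tail.tail).mul (TD.head ED.id))))) [x, y] ?_ ?_ z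
  · simp only [List.headD_cons, List.tail_cons, p_mul_zero]
  · intro x hx
    simp only [List.headD_cons, List.tail_cons] at *
    rw [p_mul_suc, hx, p_mul_suc, p_mul_add]
theorem p_mul_one (x : M) : x * 1 = x := by
  show x * sucM 0 = x
  rw [p_mul_suc, p_mul_zero, p_zero_add]
theorem p_add_right_cancel (x y z : M) : x + z = y + z → x = y := by
  refine pam_ind (P := fun M _ v => v.tail.headD 0 + v.headD 0 = v.tail.tail.headD 0 + v.headD 0 → v.tail.headD 0 = v.tail.tail.headD 0)
    (FD.imp (FD.eq ((TD.head ED.id.tail).add (TD.head ED.id)) ((TD.head ED.id.tail.tail).add (TD.head ED.id)))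
      (FD.eq (TD.head ED.id.tail) (TD.head ED.id.tail.tail))) [x, y] ?_ ?_ z
  · simp only [List.headD_cons, List.tail_cons, p_add_zero]; exact fun h => h
  · intro x hx
    simp only [List.headD_cons, List.tail_cons] at *
    rw [p_add_suc, p_add_suc]
    exact fun h => hx (suc_inj h)
theorem p_cases (x : M) : x = 0 ∨ ∃ y, x = sucM y := by
  refine pam_ind (P := fun M _ v => v.headD 0 = 0 ∨ ∃ y, v.headD 0 = sucM y)
    ((FD.eq (TD.head ED.id) TD.zero).or
      (FD.ex (R := fun M _ v y => v.headD 0 = sucM y) (FD.eq (TD.head ED.id.tail) (TD.suc (TD.head ED.id))))) [] ?_ ?_ x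
  · exact Or.inl rfl
  · intro x _
    exact Or.inr ⟨x, rfl⟩
instance (priority := 2000) pamLE : LE M := ⟨leM⟩
theorem leM_eq (x y : M) : leM x y ↔ x ≤ y := Iff.rfl
theorem p_le (x y : M) : x ≤ y ↔ ∃ z, z + x = y := p_le_iff x y
theorem p_total (x y : M) : x ≤ y ∨ y ≤ x := by
  simp only [p_le]
  refine pam_ind (P := fun M _ v => (∃ z, z + v.tail.headD 0 = v.headD 0) ∨ (∃ z, z + v.headD 0 = v.tail.headD 0))
    (FD.or (FD.ex (R := fun M _ v z => z + v.tail.headD 0 = v.headD 0) (FD.eq ((TD.head ED.id).add (TD.head ED.id.tail.tail)) (TD.head ED.id.tail)))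
     (FD.ex (R := fun M _ v z => z + v.headD 0 = v.tail.headD 0) (FD.eq ((TD.head ED.id).add (TD.head ED.id.tail)) (TD.head ED.id.tail.tail)))) [x] ?_ ?_ y
  · exact Or.inr ⟨x, p_add_zero _⟩
  · rintro y (⟨z, h⟩ | ⟨z, h⟩)
    · simp only [List.headD_cons, List.tail_cons] at *
      exact Or.inl ⟨sucM z, by rw [p_suc_add, h]⟩
    · simp only [List.headD_cons, List.tail_cons] at *
      rcases p_cases z with rfl | ⟨w, rfl⟩
      · left
        refine ⟨1, ?_⟩
        rw [← h, p_zero_add, p_suc_eq, p_add_comm]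
      · right
        refine ⟨w, ?_⟩
        rw [← h, p_suc_add, p_add_suc]

instance (priority := 2000) pamCS : CommSemiring M where
  add := (· + ·)
  zero := 0
  mul := (· * ·)
  one := 1
  add_assoc := p_add_assoc
  zero_add := p_zero_add
  add_zero := p_add_zero
  add_comm := p_add_comm
  left_distrib := p_mul_add
  right_distrib := fun a b c => by rw [p_mul_comm, p_mul_add, p_mul_comm c, p_mul_comm c]
  zero_mul := p_zero_mul
  mul_zero := p_mul_zero
  mul_assoc := p_mul_assoc
  one_mul := fun a => by rw [p_mul_comm, p_mul_one]
  mul_one := p_mul_one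
  mul_comm := p_mul_comm
  nsmul := nsmulRec

theorem p_add_eq_zero {x y : M} (h : x + y = 0) : y = 0 := by
  rcases p_cases y with rfl | ⟨w, rfl⟩
  · rfl
  · rw [p_add_suc] at h; exact absurd h (suc_ne _)

noncomputable instance (priority := 2000) pamLO : LinearOrder M where
  le := (· ≤ ·)
  le_refl x := (p_le x x).2 ⟨0, zero_add x⟩
  le_trans x y z hxy hyz := by
    obtain ⟨a, rfl⟩ := (p_le _ _).1 hxy
    obtain ⟨b, rfl⟩ := (p_le _ _).1 hyz
    exact (p_le _ _).2 ⟨b + a, add_assoc _ _ _⟩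
  le_antisymm x y hxy hyx := by
    obtain ⟨a, rfl⟩ := (p_le _ _).1 hxy
    obtain ⟨b, hb⟩ := (p_le _ _).1 hyx
    rw [← add_assoc] at hb
    have : b + a = 0 := p_add_right_cancel _ _ x (by rw [hb, zero_add])
    rw [p_add_eq_zero this, zero_add]
  le_total := p_total
  toDecidableLE := Classical.decRel _

theorem p_zero_le (x : M) : 0 ≤ x := (p_le _ _).2 ⟨x, add_zero x⟩

instance (priority := 2000) pamOCM : IsOrderedCancelAddMonoid M where
  add_le_add_left a b h c := by
    obtain ⟨a, rfl⟩ := (p_le _ _).1 h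
    exact (p_le _ _).2 ⟨a, by ring⟩
  le_of_add_le_add_left a b c h := by
    obtain ⟨d, hd⟩ := (p_le _ _).1 h
    exact (p_le _ _).2 ⟨d, p_add_right_cancel _ _ a (by rw [add_comm c, ← hd]; ring)⟩
instance (priority := 2000) pamCanon : CanonicallyOrderedAdd M where
  le_self_add a b := (p_le _ _).2 ⟨b, by ring⟩
  le_add_self a b := (p_le _ _).2 ⟨b, by ring⟩
  exists_add_of_le {a b} h := by
    obtain ⟨d, rfl⟩ := (p_le _ _).1 h
    exact ⟨d, by ring⟩
theorem p_lt_iff (x y : M) : x < y ↔ x + 1 ≤ y := by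
  constructor
  · intro h
    obtain ⟨d, rfl⟩ := (p_le _ _).1 h.le
    rcases p_cases d with rfl | ⟨w, rfl⟩
    · rw [zero_add] at h
      exact absurd h (lt_irrefl _)
    · rw [p_suc_eq]
      exact (p_le _ _).2 ⟨w, by ring⟩
  · intro h
    refine lt_of_le_of_ne (le_trans ((p_le _ _).2 ⟨1, by ring⟩) h) ?_
    rintro rfl
    obtain ⟨d, hd⟩ := (p_le _ _).1 h
    have : sucM d = 0 := p_add_right_cancel _ _ x (by rw [p_suc_eq, zero_add]; rw [← add_assoc, add_right_comm] at hd; exact hd)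
    exact suc_ne _ this
theorem p_zero_lt_one : (0 : M) < 1 := by rw [p_lt_iff, zero_add]
instance (priority := 2000) pamNZ : Nontrivial M := ⟨0, 1, p_zero_lt_one.ne⟩
instance (priority := 2000) pamSO : IsStrictOrderedRing M where
  zero_le_one := p_zero_le _
  mul_lt_mul_of_pos_left := fun a ha b c h => by
    rw [p_lt_iff] at *
    obtain ⟨d, rfl⟩ := (p_le _ _).1 h
    obtain ⟨e, rfl⟩ := (p_le _ _).1 ha
    refine (p_le _ _).2 ⟨e * d + d + e, by ring⟩
  mul_lt_mul_of_pos_right := fun a ha b c h => by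
    rw [p_lt_iff] at *
    obtain ⟨d, rfl⟩ := (p_le _ _).1 h
    obtain ⟨e, rfl⟩ := (p_le _ _).1 ha
    refine (p_le _ _).2 ⟨e * d + d + e, by ring⟩
end algebra

abbrev Rel1 := ∀ (M : Type) [PAM M], List M → M → Prop
class CD0 (P : Pred) : Prop where out : D0 P
class CFD (P : Pred) : Prop where out : FD P
class CT (P : TFam) : Prop where out : TD P
class CE (P : EFam) : Prop where out : ED P
section inst
variable {f g : TFam} {e : EFam} {P Q : Pred}
instance : CE (fun _ _ v => v) := ⟨ED.id⟩
instance : CE (fun _ _ v => []) := ⟨ED.nil⟩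
instance [h : CE e] : CE (fun M _ v => (e M v).tail) := ⟨ED.tail h.out⟩
instance [h : CE e] [h' : CT f] : CE (fun M _ v => f M v :: (e M v)) := ⟨ED.cons h'.out h.out⟩
instance [h : CE e] : CT (fun M _ v => (e M v).headD 0) := ⟨TD.head h.out⟩
instance [h : CT f] [h' : CT g] : CT (fun M _ v => f M v + g M v) := ⟨TD.add h.out h'.out⟩
instance [h : CT f] [h' : CT g] : CT (fun M _ v => f M v * g M v) := ⟨TD.mul h.out h'.out⟩
instance : CT (fun M _ v => 0) := ⟨TD.zero⟩
instance : CT (fun M _ v => 1) := ⟨TD.one⟩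
theorem TD.nat (k : ℕ) : TD (fun M _ v => (k : M)) := by
  induction k with
  | zero => simpa using TD.zero
  | succ k ih => simpa using ih.add TD.one
instance (k : ℕ) : CT (fun M _ v => (k : M)) := ⟨TD.nat k⟩
instance [h : CT f] [h' : CT g] : CD0 (fun M _ v => f M v = g M v) := ⟨D0.eq h.out h'.out⟩
instance [h : CT f] [h' : CT g] : CD0 (fun M _ v => f M v ≤ g M v) := ⟨D0.leM h.out h'.out⟩
instance [h : CT f] [h' : CT g] : CD0 (fun M _ v => f M v < g M v) :=
  ⟨(D0.leM (h.out.add TD.one) h'.out).congr fun M _ v => (p_lt_iff _ _).symm⟩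
instance : CD0 (fun M _ v => False) := ⟨D0.fls⟩
instance [hP : CD0 P] [hQ : CD0 Q] : CD0 (fun M _ v => P M v → Q M v) := ⟨hP.out.imp hQ.out⟩
instance [hP : CD0 P] [hQ : CD0 Q] : CD0 (fun M _ v => P M v ∧ Q M v) := ⟨hP.out.and hQ.out⟩
instance [hP : CD0 P] [hQ : CD0 Q] : CD0 (fun M _ v => P M v ∨ Q M v) := ⟨hP.out.or hQ.out⟩
instance [hP : CD0 P] [hQ : CD0 Q] : CD0 (fun M _ v => P M v ↔ Q M v) := ⟨hP.out.iff hQ.out⟩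
instance [hP : CD0 P] : CD0 (fun M _ v => ¬ P M v) := ⟨hP.out.not⟩
instance {R : Rel1} [hf : CT f] [hR : CD0 (fun M _ w => R M w.tail (w.headD 0))] :
    CD0 (fun M _ v => ∀ x, x ≤ (f M v) → R M v x) := ⟨D0.ballM hf.out hR.out⟩
instance {R : Rel1} [hf : CT f] [hR : CD0 (fun M _ w => R M w.tail (w.headD 0))] :
    CD0 (fun M _ v => ∃ x, x ≤ (f M v) ∧ R M v x) :=
  ⟨(D0.ballM (R := fun M _ v x => ¬ R M v x) hf.out hR.out.not).not.congr fun M _ v => by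
    push Not; rfl⟩
instance {R : Rel1} [hf : CT f] [hR : CD0 (fun M _ w => R M w.tail (w.headD 0))] :
    CD0 (fun M _ v => ∀ x, x < (f M v) → R M v x) :=
  have : CT (fun M _ w => f M w.tail) := ⟨hf.out.sub ED.id.tail⟩
  ⟨(inferInstance : CD0 (fun M _ v => ∀ x, x ≤ f M v → (x = f M v ∨ R M v x))).out.congr fun M _ v => by
    refine forall_congr' fun x => ?_
    rw [le_iff_lt_or_eq]
    have := @ne_of_lt M _ x (f M v)
    tauto⟩
instance {R : Rel1} [hf : CT f] [hR : CD0 (fun M _ w => R M w.tail (w.headD 0))] :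
    CD0 (fun M _ v => ∃ x, x < (f M v) ∧ R M v x) :=
  ⟨(inferInstance : CD0 (fun M _ v => ¬ ∀ x, x < f M v → ¬ (R M v x))).out.congr fun M _ v => by
    push Not; rfl⟩
instance (priority := 100) [h : CD0 P] : CFD P := ⟨h.out.fd⟩
instance [hP : CFD P] [hQ : CFD Q] : CFD (fun M _ v => P M v → Q M v) := ⟨hP.out.imp hQ.out⟩
instance [hP : CFD P] [hQ : CFD Q] : CFD (fun M _ v => P M v ∧ Q M v) := ⟨hP.out.and hQ.out⟩
instance [hP : CFD P] [hQ : CFD Q] : CFD (fun M _ v => P M v ∨ Q M v) := ⟨hP.out.or hQ.out⟩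
instance [hP : CFD P] [hQ : CFD Q] : CFD (fun M _ v => P M v ↔ Q M v) := ⟨hP.out.iff hQ.out⟩
instance [hP : CFD P] : CFD (fun M _ v => ¬ P M v) := ⟨hP.out.not⟩
instance {R : Rel1} [hR : CFD (fun M _ w => R M w.tail (w.headD 0))] :
    CFD (fun M _ v => ∀ x, R M v x) := ⟨FD.all hR.out⟩
instance {R : Rel1} [hR : CFD (fun M _ w => R M w.tail (w.headD 0))] :
    CFD (fun M _ v => ∃ x, R M v x) := ⟨FD.ex hR.out⟩
end inst

section ind
variable {M : Type} [PAM M]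
theorem p_ind (R : Rel1) [hR : CFD (fun M _ w => R M w.tail (w.headD 0))] (l : List M)
    (h0 : R M l 0) (hs : ∀ x, R M l x → R M l (x + 1)) : ∀ x, R M l x :=
  pam_ind (P := fun M _ w => R M w.tail (w.headD 0)) hR.out l h0
    (fun x hx => by rw [p_suc_eq]; exact hs x hx)
theorem p_strong (R : Rel1) [hR : CFD (fun M _ w => R M w.tail (w.headD 0))] (l : List M)
    (hs : ∀ x, (∀ y < x, R M l y) → R M l x) : ∀ x, R M l x := by
  have : ∀ x, ∀ y, y < x → R M l y := by
    have i1 := FD.sub hR.out (inferInstance : CE (fun M _ w => w.headD 0 :: w.tail.tail)).out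
    have i2 : CFD (fun M _ w => R M w.tail.tail (w.headD 0)) := ⟨i1⟩
    refine p_ind (fun M _ l x => ∀ y, y < x → R M l y) l ?_ ?_
    · intro y hy; exact absurd hy (not_lt.2 (p_zero_le _))
    · intro x ih y hy
      exact hs y fun z hz => ih z (lt_of_lt_of_le hz (by rw [p_lt_iff] at hy; grind))
  exact fun x => hs x (this x)
theorem p_least (R : Rel1) [hR : CFD (fun M _ w => R M w.tail (w.headD 0))] (l : List M)
    (h : ∃ x, R M l x) : ∃ x, R M l x ∧ ∀ y < x, ¬ R M l y := by
  by_contra hc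
  push Not at hc
  obtain ⟨x, hx⟩ := h
  refine p_strong (fun M _ l x => ¬ R M l x) l (fun x ih hx => ?_) x hx
  obtain ⟨y, h1, h2⟩ := hc x hx
  exact ih y h1 h2

theorem p_lt_add_one (x y : M) : x < y + 1 ↔ x ≤ y := by
  rw [p_lt_iff]; exact add_le_add_iff_right 1

/-- pairing -/
def pr (x y : M) : M := (x + y) * (x + y) + x
theorem pr_inj {x y x' y' : M} (h : pr x y = pr x' y') : x = x' ∧ y = y' := by
  unfold pr at h
  have key : ∀ a b a' b' : M, (a + b) * (a + b) + a = (a' + b') * (a' + b') + a' → ¬ (a + b < a' + b') := by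
    intro a b a' b' h hlt
    rw [p_lt_iff] at hlt
    have h1 := mul_le_mul' hlt hlt
    have h2 : (a + b) * (a + b) + a < (a + b + 1) * (a + b + 1) := by
      rw [p_lt_iff]
      exact (p_le _ _).2 ⟨a + b + b, by ring⟩
    have h3 : (a' + b') * (a' + b') ≤ (a' + b') * (a' + b') + a' := le_self_add
    rw [← h] at h3
    exact absurd (lt_of_lt_of_le h2 h1) (not_lt.2 h3)
  have e : x + y = x' + y' := le_antisymm (not_lt.1 (key _ _ _ _ h.symm)) (not_lt.1 (key _ _ _ _ h))
  rw [e] at h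
  have := add_left_cancel h
  subst this
  exact ⟨rfl, add_left_cancel e⟩
theorem pr_eq {x y x' y' : M} : pr x y = pr x' y' ↔ x = x' ∧ y = y' :=
  ⟨pr_inj, by rintro ⟨rfl, rfl⟩; rfl⟩
theorem le_sq (x : M) : x ≤ x * x := by
  rcases p_cases x with rfl | ⟨y, rfl⟩
  · simp
  · rw [p_suc_eq]; exact (p_le _ _).2 ⟨y * y + y, by ring⟩
theorem le_pr_left (x y : M) : x ≤ pr x y := le_add_self
theorem le_pr_right (x y : M) : y ≤ pr x y :=
  le_trans (le_trans le_add_self (le_sq (x + y))) le_self_add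
theorem pr_mono {x y x' y' : M} (h : x ≤ x') (h' : y ≤ y') : pr x y ≤ pr x' y' := by
  unfold pr
  exact add_le_add (mul_le_mul' (add_le_add h h') (add_le_add h h')) h
instance {f g : TFam} [CT f] [CT g] : CT (fun M _ v => pr (f M v) (g M v)) :=
  inferInstanceAs (CT (fun M _ v => (f M v + g M v) * (f M v + g M v) + f M v))

theorem p_dvd (a x : M) : a ∣ x ↔ ∃ q, q ≤ x ∧ x = a * q := by
  constructor
  · rintro ⟨q, rfl⟩
    rcases p_cases a with rfl | ⟨b, rfl⟩
    · exact ⟨0, by simp⟩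
    · exact ⟨q, by rw [p_suc_eq]; exact (p_le _ _).2 ⟨b * q, by ring⟩, rfl⟩
  · rintro ⟨q, -, rfl⟩
    exact ⟨q, rfl⟩
instance {f g : TFam} [CT f] [CT g] : CD0 (fun M _ v => (f M v) ∣ (g M v)) :=
  ⟨D0.sub (P := fun M _ v => v.headD 0 ∣ v.tail.headD 0)
    ((inferInstance : CD0 (fun M _ v => ∃ q, q ≤ v.tail.headD 0 ∧ v.tail.headD 0 = v.headD 0 * q)).out.congr
    fun M _ v => (p_dvd _ _).symm) ((inferInstance : CE (fun M _ v => [f M v, g M v])).out)⟩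
theorem p_dvd_cancel {a x y : M} (h1 : a ∣ x + y) (h2 : a ∣ x) : a ∣ y := by
  obtain ⟨n, hn⟩ := h1
  obtain ⟨m, rfl⟩ := h2
  rcases le_total m n with h | h
  · obtain ⟨e, rfl⟩ := (p_le _ _).1 h
    refine ⟨e, ?_⟩
    have : a * m + y = a * m + a * e := by rw [hn]; ring
    exact add_left_cancel this
  · obtain ⟨e, rfl⟩ := (p_le _ _).1 h
    have : (a * e + y) + a * n = 0 + a * n := by rw [zero_add]; nth_rw 2 [← hn]; ring
    have := add_right_cancel this
    have : y = 0 := p_add_eq_zero this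
    rw [this]; exact dvd_zero _
theorem p_dvd_cop {p b c x : M} (hp : p = 1 + c * b) (h : p ∣ x * b) : p ∣ x := by
  have h1 : p ∣ c * (x * b) + x := ⟨x, by rw [hp]; ring⟩
  exact p_dvd_cancel h1 (Dvd.dvd.mul_left h c)
theorem p_key {b i k A : M} (N : M) (hb : ∀ d, d ≤ N → d ≠ 0 → d ∣ b) (hi : i < N) (hk : k < N)
    (hik : i ≠ k) (h : (1 + (i + 1) * b) ∣ A * (1 + (k + 1) * b)) : (1 + (i + 1) * b) ∣ A := by
  have : ∃ d, d ≤ N ∧ d ≠ 0 ∧ (1 + (i + 1) * b) ∣ A * d * b := by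
    rcases le_total i k with hle | hle
    · obtain ⟨d, rfl⟩ := (p_le _ _).1 hle
      refine ⟨d, le_trans le_self_add hk.le, ?_, ?_⟩
      · rintro rfl; exact hik (zero_add _).symm
      · have e : A * (1 + (d + i + 1) * b) = A * (1 + (i + 1) * b) + A * d * b := by ring
        rw [e] at h
        exact p_dvd_cancel h (Dvd.intro_left _ rfl)
    · obtain ⟨d, rfl⟩ := (p_le _ _).1 hle
      refine ⟨d, le_trans le_self_add hi.le, ?_, ?_⟩
      · rintro rfl; exact hik (zero_add _)
      · have e : A * (1 + (k + 1) * b) + A * d * b = A * (1 + (d + k + 1) * b) := by ring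
        refine p_dvd_cancel ?_ h
        rw [e]
        exact (Dvd.intro_left _ rfl)
  obtain ⟨d, h1, h2, h3⟩ := this
  have h4 := p_dvd_cop rfl h3
  obtain ⟨e, he⟩ := hb d h1 h2
  refine p_dvd_cop rfl (x := A) (c := i + 1) (b := b) ?_
  have : A * b = A * d * e := by rw [he]; ring
  rw [this]
  exact Dvd.dvd.mul_right h4 e

theorem p_lcm (N : M) : ∃ b, b ≠ 0 ∧ ∀ d, d ≤ N → d ≠ 0 → d ∣ b := by
  refine p_ind (fun M _ l N => ∃ b, b ≠ 0 ∧ ∀ d, d ≤ N → d ≠ 0 → d ∣ b) [] ?_ ?_ N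
  · exact ⟨1, one_ne_zero, fun d h h' => absurd (le_antisymm h (p_zero_le _)) h'⟩
  · rintro N ⟨b, hb, h⟩
    refine ⟨b * (N + 1), ?_, ?_⟩
    · have h1 : 0 < b := lt_of_le_of_ne (p_zero_le _) (Ne.symm hb)
      have h2 : 0 < N + 1 := lt_of_lt_of_le p_zero_lt_one le_add_self
      exact (mul_pos h1 h2).ne'
    · intro d hd h0
      rcases lt_or_eq_of_le hd with h1 | rfl
      · exact Dvd.dvd.mul_right (h d ((p_lt_add_one _ _).1 h1) h0) _
      · exact Dvd.intro_left _ rfl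

/-- membership in a coded set -/
def El (i V : M) : Prop := ∃ A, A ≤ V ∧ ∃ B, B ≤ V ∧ ∃ N, N ≤ V ∧ V = pr A (pr B N) ∧ i < N ∧
  (1 + (i + 1) * B) ∣ A
instance {f g : TFam} [CT f] [CT g] : CD0 (fun M _ v => El (f M v) (g M v)) := by
  have : CD0 (fun M _ v => El (v.headD 0) (v.tail.headD 0)) := by unfold El; infer_instance
  exact ⟨this.out.sub (inferInstance : CE (fun M _ v => [f M v, g M v])).out⟩
theorem El_pr (i A B N : M) : El i (pr A (pr B N)) ↔ i < N ∧ (1 + (i + 1) * B) ∣ A := by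
  constructor
  · rintro ⟨A', -, B', -, N', -, h, h'⟩
    simp only [pr_eq] at h
    obtain ⟨rfl, rfl, rfl⟩ := h
    exact h'
  · intro h
    exact ⟨A, le_pr_left _ _, B, le_trans (le_pr_left _ _) (le_pr_right _ _), N,
      le_trans (le_pr_right _ _) (le_pr_right _ _), rfl, h⟩
theorem El_lt {i V : M} (h : El i V) : i < V := by
  obtain ⟨A', -, B', -, N', hN, h, h', -⟩ := h
  exact lt_of_lt_of_le h' hN

theorem p_compr (R : Rel1) [hR : CFD (fun M _ w => R M w.tail (w.headD 0))] (l : List M) (N : M) :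
    ∃ V, ∀ i, El i V ↔ i < N ∧ R M l i := by
  obtain ⟨b, hb0, hb⟩ := p_lcm N
  have : ∀ k, k ≤ N → ∃ A, ∀ i, i < N → ((1 + (i + 1) * b) ∣ A ↔ i < k ∧ R M l i) := by
    have i2 : CFD (fun M _ w => R M w.tail.tail.tail.tail.tail (w.headD 0)) :=
      ⟨FD.sub hR.out (inferInstance : CE (fun M _ w => w.headD 0 :: w.tail.tail.tail.tail.tail)).out⟩
    refine p_ind (fun M _ l k => k ≤ l.headD 0 → ∃ A, ∀ i, i < l.headD 0 → ((1 + (i + 1) * (l.tail.headD 0)) ∣ A ↔ i < k ∧ R M l.tail.tail i)) (N :: b :: l) ?_ ?_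
    · intro _
      refine ⟨1, fun i hi => ⟨fun h => ?_, fun h => absurd h.1 (not_lt.2 (p_zero_le _))⟩⟩
      exfalso
      simp only [List.headD_cons, List.tail_cons] at h
      obtain ⟨q, hq⟩ := h
      rcases p_cases q with rfl | ⟨q, rfl⟩
      · simp at hq
      · rw [p_suc_eq] at hq
        have : ((i+1) * b * q + q + i * b) + b + 1 = 0 + 1 := by rw [zero_add]; refine Eq.trans ?_ hq.symm; ring
        exact hb0 (p_add_eq_zero (add_right_cancel this))
    · intro k ih hk
      simp only [List.headD_cons, List.tail_cons] at *
      have hkN : k < N := (p_lt_iff _ _).2 hk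
      obtain ⟨A, hA⟩ := ih hkN.le
      by_cases hRk : R M l k
      · refine ⟨A * (1 + (k + 1) * b), fun i hi => ?_⟩
        by_cases hik : i = k
        · subst hik
          exact ⟨fun _ => ⟨(p_lt_add_one _ _).2 le_rfl, hRk⟩, fun _ => Dvd.intro_left _ rfl⟩
        · have h1 : (1 + (i + 1) * b) ∣ A * (1 + (k + 1) * b) ↔ (1 + (i + 1) * b) ∣ A :=
            ⟨p_key N hb hi hkN hik, fun h => Dvd.dvd.mul_right h _⟩
          rw [h1, hA i hi, p_lt_add_one, le_iff_lt_or_eq]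
          tauto
      · refine ⟨A, fun i hi => ?_⟩
        rw [hA i hi, p_lt_add_one, le_iff_lt_or_eq]
        constructor
        · rintro ⟨h, h'⟩; exact ⟨Or.inl h, h'⟩
        · rintro ⟨h | rfl, h'⟩
          · exact ⟨h, h'⟩
          · exact absurd h' hRk
  obtain ⟨A, hA⟩ := this N le_rfl
  refine ⟨pr A (pr b N), fun i => ?_⟩
  rw [El_pr]
  constructor
  · rintro ⟨h, h'⟩; exact (hA i h).1 h'
  · rintro ⟨h, h'⟩; exact ⟨h, (hA i h).2 ⟨h, h'⟩⟩
end ind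

/-- the `Σ_n` uniform predicates -/
def Sg : ℕ → Pred → Prop
  | 0, P => D0 P
  | n + 1, P => ∃ Q : Pred, Sg n (fun M _ v => ¬ Q M v) ∧
      ∀ (M : Type) [PAM M] (v : List M), P M v ↔ ∃ x, Q M (x :: v)

theorem Sg.congr {n : ℕ} {P Q : Pred} (h : Sg n P)
    (hPQ : ∀ (M : Type) [PAM M] (v : List M), P M v ↔ Q M v) : Sg n Q := by
  have : P = Q := by
    funext M i v
    exact propext (hPQ M v)
  rw [← this]; exact h
theorem Sg.sub {n : ℕ} {P : Pred} {g : EFam} (h : Sg n P) (hg : ED g) : Sg n (fun M _ v => P M (g M v)) := by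
  induction n generalizing P g with
  | zero => exact D0.sub h hg
  | succ n ih =>
    obtain ⟨Q, hQ, hP⟩ := h
    refine ⟨fun M _ v => Q M (v.headD 0 :: g M v.tail), ?_, ?_⟩
    · refine ih (P := fun M _ v => ¬ Q M v) hQ (g := fun M _ v => (v.headD 0 :: g M v.tail)) ?_
      refine ED.cons (TD.head ED.id) ?_
      intro m ts
      exact hg m ts.tail |>.imp fun us h M _ v => by rw [h, List.map_tail]
    · intro M _ v
      exact hP M (g M v)
theorem Sg.ofPi {n : ℕ} {P : Pred} (h : Sg n (fun M _ v => ¬ P M v)) : Sg (n + 1) P :=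
  ⟨fun M _ v => P M v.tail, h.sub ED.id.tail, fun M _ v => ⟨fun h => ⟨0, h⟩, fun ⟨_, h⟩ => h⟩⟩
theorem Sg.ofD0 {n : ℕ} {P : Pred} (h : D0 P) : Sg n P := by
  induction n generalizing P with
  | zero => exact h
  | succ n ih => exact Sg.ofPi (ih h.not)
theorem Sg.succ {n : ℕ} {P : Pred} (h : Sg n P) : Sg (n + 1) P := by
  induction n generalizing P with
  | zero => exact Sg.ofD0 h
  | succ n ih =>
    obtain ⟨Q, hQ, hP⟩ := h
    exact ⟨Q, ih hQ, hP⟩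
theorem Sg.fml {n : ℕ} {P : Pred} (h : Sg n P) (m : ℕ) (ts : List (Tm m)) :
    (∃ φ : BF m, IsSigmaFml n φ ∧ ∀ (M : Type) [PAM M] (v : Fin m → M), fv v φ ↔ P M (ts.map (tv v))) ∧
    (∃ φ : BF m, IsPiFml n φ ∧ ∀ (M : Type) [PAM M] (v : Fin m → M), fv v φ ↔ ¬ P M (ts.map (tv v))) := by
  induction n generalizing P m with
  | zero =>
    obtain ⟨φ, h0, h1⟩ := h m ts
    obtain ⟨ψ, h0', h1'⟩ := h.not m ts
    exact ⟨⟨φ, .ofDelta0 h0, h1⟩, ⟨ψ, .ofDelta0 h0', h1'⟩⟩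
  | succ n ih =>
    obtain ⟨Q, hQ, hP⟩ := h
    obtain ⟨⟨φ, h0, h1⟩, ⟨ψ, h0', h1'⟩⟩ := ih hQ (m + 1) (vT (Fin.last m) :: ts.map liftT)
    refine ⟨⟨∃' ψ, .ex (.ofPi h0'), fun M _ v => ?_⟩, ⟨∀' φ, .all (.ofSigma h0), fun M _ v => ?_⟩⟩
    · simp only [fv_ex, h1', hP, List.map_cons, map_lift, tv_var, Fin.snoc_last, not_not]
    · simp only [fv_all, h1, hP, List.map_cons, map_lift, tv_var, Fin.snoc_last, not_exists]
theorem Sg.fd {n : ℕ} {P : Pred} (h : Sg n P) : FD P := fun m ts => by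
  obtain ⟨φ, -, h⟩ := (h.fml m ts).1
  exact ⟨φ, h⟩

theorem p_coll {M : Type} [PAM M] (R : ∀ (M : Type) [PAM M], List M → M → M → Prop)
    [hR : CFD (fun M _ w => R M w.tail.tail (w.tail.headD 0) (w.headD 0))] (l : List M) (a : M)
    (h : ∀ y, y ≤ a → ∃ w, R M l y w) : ∃ N, ∀ y, y ≤ a → ∃ w, w ≤ N ∧ R M l y w := by
  have i2 : CFD (fun M _ w => R M w.tail.tail.tail.tail.tail (w.tail.headD 0) (w.headD 0)) :=
      ⟨FD.sub hR.out (inferInstance : CE (fun M _ w => w.headD 0 :: w.tail.headD 0 :: w.tail.tail.tail.tail.tail)).out⟩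
  refine p_ind (fun M _ l k => k ≤ l.headD 0 → ∃ N, ∀ y, y ≤ k → ∃ w, w ≤ N ∧ R M l.tail y w) (a :: l) ?_ ?_ a le_rfl
  · intro _
    obtain ⟨w, hw⟩ := h 0 (p_zero_le _)
    refine ⟨w, fun y hy => ?_⟩
    rw [le_antisymm hy (p_zero_le _)]
    exact ⟨w, le_rfl, hw⟩
  · intro k ih hk
    simp only [List.headD_cons, List.tail_cons] at *
    obtain ⟨N, hN⟩ := ih (le_trans le_self_add hk)
    obtain ⟨w, hw⟩ := h _ hk
    refine ⟨N + w, fun y hy => ?_⟩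
    rcases lt_or_eq_of_le hy with h1 | rfl
    · obtain ⟨u, hu, hu'⟩ := hN y ((p_lt_add_one _ _).1 h1)
      exact ⟨u, le_trans hu le_self_add, hu'⟩
    · exact ⟨w, le_add_self, hw⟩

class CS (n : ℕ) (P : Pred) : Prop where out : Sg n P
instance (priority := 50) {n : ℕ} {P : Pred} [h : CD0 P] : CS n P := ⟨.ofD0 h.out⟩
/-- closure of the `n`-th level -/
class Cl (n : ℕ) : Prop where
  cand : ∀ P Q : Pred, Sg n P → Sg n Q → Sg n (fun M _ v => P M v ∧ Q M v)
  cor : ∀ P Q : Pred, Sg n P → Sg n Q → Sg n (fun M _ v => P M v ∨ Q M v)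
  cex : ∀ (f : TFam) (R : Rel1), TD f → Sg n (fun M _ w => R M w.tail (w.headD 0)) →
      Sg n (fun M _ v => ∃ x, x ≤ f M v ∧ R M v x)
section
variable {n : ℕ} [hc : Cl n] {P Q : Pred} {R : Rel1} {f : TFam}
instance [hP : CS n P] [hQ : CS n Q] : CS n (fun M _ v => P M v ∧ Q M v) := ⟨hc.cand _ _ hP.out hQ.out⟩
instance [hP : CS n P] [hQ : CS n Q] : CS n (fun M _ v => P M v ∨ Q M v) := ⟨hc.cor _ _ hP.out hQ.out⟩
instance [hf : CT f] [hR : CS n (fun M _ w => R M w.tail (w.headD 0))] :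
    CS n (fun M _ v => ∃ x, x ≤ f M v ∧ R M v x) := ⟨hc.cex _ _ hf.out hR.out⟩
theorem Sg.ex (hR : Sg (n + 1) (fun M _ w => R M w.tail (w.headD 0))) :
    Sg (n + 1) (fun M _ v => ∃ x, R M v x) := by
  obtain ⟨Q, hQ, hP⟩ := hR
  have i2 : CS n (fun M _ w => ¬ Q M (w.tail.headD 0 :: w.headD 0 :: w.tail.tail.tail)) :=
    ⟨hQ.sub (inferInstance : CE (fun M _ w => (w.tail.headD 0 :: w.headD 0 :: w.tail.tail.tail))).out⟩
  refine ⟨fun M _ w => (∃ y, y ≤ w.headD 0 ∧ ∃ x, x ≤ w.headD 0 ∧ w.headD 0 = pr y x) ∧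
    ∀ y, y ≤ w.headD 0 → ∀ x, x ≤ w.headD 0 → w.headD 0 = pr y x → Q M (y :: x :: w.tail), ?_, ?_⟩
  · refine (inferInstance : CS n (fun M _ w => (¬ ∃ y, y ≤ w.headD 0 ∧ ∃ x, x ≤ w.headD 0 ∧ w.headD 0 = pr y x) ∨
      ∃ y, y ≤ w.headD 0 ∧ ∃ x, x ≤ w.headD 0 ∧ w.headD 0 = pr y x ∧ ¬ Q M (y :: x :: w.tail))).out.congr ?_
    intro M _ v
    rw [not_and_or]
    push Not
    rfl
  · intro M _ v
    simp only [List.headD_cons, List.tail_cons]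
    constructor
    · rintro ⟨x, hx⟩
      obtain ⟨y, hy⟩ := (hP M (x :: v)).1 hx
      refine ⟨pr y x, ⟨y, le_pr_left _ _, x, le_pr_right _ _, rfl⟩, fun y' _ x' _ h => ?_⟩
      obtain ⟨rfl, rfl⟩ := pr_inj h
      exact hy
    · rintro ⟨z, ⟨y, h1, x, h2, h3⟩, h⟩
      exact ⟨x, (hP M (x :: v)).2 ⟨y, h y h1 x h2 h3⟩⟩
theorem Sg.ex' {P : Pred} (hR : Sg (n + 1) P) :
    Sg (n + 1) (fun M _ v => ∃ x, P M (x :: v)) := by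
  refine Sg.ex (R := fun M _ v x => P M (x :: v)) ?_
  exact hR.sub (inferInstance : CE (fun M _ w => w.headD 0 :: w.tail)).out
theorem Cl.succ : Cl (n + 1) := by
  have hand : ∀ P Q : Pred, Sg (n+1) P → Sg (n+1) Q → Sg (n+1) (fun M _ v => P M v ∧ Q M v) := by
    rintro P Q ⟨A, hA, hP⟩ ⟨B, hB, hQ⟩
    have i1 : CS n (fun M _ w => ¬ A M w.tail) := ⟨hA.sub ED.id.tail⟩
    have i2 : CS n (fun M _ w => ¬ B M (w.headD 0 :: w.tail.tail)) :=
      ⟨hB.sub (inferInstance : CE (fun M _ w => w.headD 0 :: w.tail.tail)).out⟩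
    have h1 : Sg n (fun M _ w => ¬ (A M w.tail ∧ B M (w.headD 0 :: w.tail.tail))) :=
      (inferInstance : CS n (fun M _ w => ¬ A M w.tail ∨ ¬ B M (w.headD 0 :: w.tail.tail))).out.congr
        fun M _ v => by rw [not_and_or]
    refine (Sg.ex' (n := n) (P := fun M _ v => ∃ y, A M v ∧ B M (y :: v.tail)) ⟨_, h1, fun M _ v => Iff.rfl⟩).congr ?_
    intro M _ v
    rw [hP, hQ]
    simp only [List.tail_cons]
    constructor
    · rintro ⟨x, y, h1, h2⟩; exact ⟨⟨x, h1⟩, ⟨y, h2⟩⟩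
    · rintro ⟨⟨x, h1⟩, ⟨y, h2⟩⟩; exact ⟨x, y, h1, h2⟩
  refine ⟨hand, ?_, ?_⟩
  · rintro P Q ⟨A, hA, hP⟩ ⟨B, hB, hQ⟩
    refine ⟨fun M _ v => A M v ∨ B M v, (hc.cand _ _ hA hB).congr fun M _ v => by tauto, fun M _ v => ?_⟩
    show (P M v ∨ Q M v) ↔ ∃ x, (A M (x :: v) ∨ B M (x :: v))
    rw [hP, hQ, exists_or]
  · intro f R hf hR
    refine Sg.ex (R := fun M _ v x => x ≤ f M v ∧ R M v x) (hand _ _ (.ofD0 ?_) hR)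
    exact D0.leM (TD.head ED.id) (hf.sub ED.id.tail)
end
theorem cl_all (n : ℕ) : Cl n := by
  induction n with
  | zero => exact ⟨fun P Q hP hQ => hP.and hQ, fun P Q hP hQ => hP.or hQ, fun f R hf hR =>
      have : CT f := ⟨hf⟩
      have : CD0 (fun M _ w => R M w.tail (w.headD 0)) := ⟨hR⟩
      (inferInstance : CD0 (fun M _ v => ∃ x, x ≤ f M v ∧ R M v x)).out⟩
  | succ n ih => exact Cl.succ
instance {n : ℕ} : Cl n := cl_all n
instance {n : ℕ} {R : Rel1} [hR : CS (n + 1) (fun M _ w => R M w.tail (w.headD 0))] :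
    CS (n + 1) (fun M _ v => ∃ x, R M v x) := ⟨Sg.ex hR.out⟩
theorem Sg.ball {n : ℕ} {f : TFam} {R : Rel1} (hf : TD f) (hR : Sg n (fun M _ w => R M w.tail (w.headD 0))) :
    Sg n (fun M _ v => ∀ x, x ≤ f M v → R M v x) := by
  cases n with
  | zero => exact D0.ballM hf hR
  | succ n =>
    obtain ⟨Q, hQ, hP⟩ := hR
    have i0 : CT (fun M _ w => f M w.tail.tail) := ⟨hf.sub ED.id.tail.tail⟩
    have i2 : CS n (fun M _ w => ¬ Q M (w.headD 0 :: w.tail.headD 0 :: w.tail.tail.tail.tail)) :=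
      ⟨hQ.sub (inferInstance : CE (fun M _ w => (w.headD 0 :: w.tail.headD 0 :: w.tail.tail.tail.tail))).out⟩
    have h1 := (inferInstance : CS n (fun M _ w => (¬ ∀ y, y ≤ f M w.tail.tail → ∃ x, x ≤ w.tail.headD 0 ∧ El (pr y x) (w.headD 0)) ∨
       ∃ y, y ≤ f M w.tail.tail ∧ ∃ x, x ≤ w.tail.headD 0 ∧ El (pr y x) (w.headD 0) ∧ ¬ Q M (x :: y :: w.tail.tail))).out
    have h2 : Sg (n+1) (fun M _ w => ∃ V, (∀ y, y ≤ f M w.tail → ∃ x, x ≤ w.headD 0 ∧ El (pr y x) V) ∧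
       ∀ y, y ≤ f M w.tail → ∀ x, x ≤ w.headD 0 → El (pr y x) V → Q M (x :: y :: w.tail)) := by
      refine ⟨fun M _ w => (∀ y, y ≤ f M w.tail.tail → ∃ x, x ≤ w.tail.headD 0 ∧ El (pr y x) (w.headD 0)) ∧
       ∀ y, y ≤ f M w.tail.tail → ∀ x, x ≤ w.tail.headD 0 → El (pr y x) (w.headD 0) → Q M (x :: y :: w.tail.tail),
       h1.congr fun M _ v => ?_, fun M _ v => Iff.rfl⟩
      rw [not_and_or]
      push Not
      rfl
    refine (Sg.ex' h2).congr fun M _ v => ?_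
    simp only [List.headD_cons, List.tail_cons]
    constructor
    · rintro ⟨N, V, h3, h4⟩ x hx
      obtain ⟨y, h5, h6⟩ := h3 x hx
      exact (hP M (x :: v)).2 ⟨y, h4 x hx y h5 h6⟩
    · intro h
      have hQf := hQ.fd.not
      have iQ : CFD (fun M _ w => Q M w) := ⟨hQf.congr fun M _ v => by rw [not_not]⟩
      have i5 : CFD (fun M _ w => Q M (w.headD 0 :: w.tail.headD 0 :: w.tail.tail)) :=
        ⟨iQ.out.sub (inferInstance : CE (fun M _ w => (w.headD 0 :: w.tail.headD 0 :: w.tail.tail))).out⟩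
      have i6 : CFD (fun M _ w => Q M (w.headD 0 :: w.tail.headD 0 :: w.tail.tail.tail)) :=
        ⟨iQ.out.sub (inferInstance : CE (fun M _ w => (w.headD 0 :: w.tail.headD 0 :: w.tail.tail.tail))).out⟩
      obtain ⟨N, hN⟩ := p_coll (fun M _ l y w => Q M (w :: y :: l)) v (f M v)
        (fun y hy => (hP M (y :: v)).1 (h y hy))
      obtain ⟨V, hV⟩ := p_compr (fun M _ l z => ∃ y, ∃ x, z = pr y x ∧ Q M (x :: y :: l)) v (pr (f M v) N + 1)
      refine ⟨N, V, fun y hy => ?_, fun y hy x hx hel => ?_⟩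
      · obtain ⟨x, hx, hq⟩ := hN y hy
        refine ⟨x, hx, (hV _).2 ⟨(p_lt_add_one _ _).2 (pr_mono hy hx), y, x, rfl, hq⟩⟩
      · obtain ⟨-, y', x', he, hq⟩ := (hV _).1 hel
        obtain ⟨rfl, rfl⟩ := pr_inj he
        exact hq
instance {n : ℕ} {f : TFam} {R : Rel1} [hf : CT f] [hR : CS n (fun M _ w => R M w.tail (w.headD 0))] :
    CS n (fun M _ v => ∀ x, x ≤ f M v → R M v x) := ⟨Sg.ball hf.out hR.out⟩
theorem Sg.imp {n : ℕ} {P Q : Pred} (hP : D0 P) (hQ : Sg n Q) : Sg n (fun M _ v => P M v → Q M v) :=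
  have : CD0 P := ⟨hP⟩
  have : CS n Q := ⟨hQ⟩
  (inferInstance : CS n (fun M _ v => ¬ P M v ∨ Q M v)).out.congr fun M _ v => by tauto
instance {n : ℕ} {P Q : Pred} [hP : CD0 P] [hQ : CS n Q] : CS n (fun M _ v => P M v → Q M v) :=
  ⟨Sg.imp hP.out hQ.out⟩

section eval
variable {M : Type} [PAM M]
/-- triples -/
def tr (a r b : M) : M := pr a (pr r b)
instance {f g h : TFam} [CT f] [CT g] [CT h] : CT (fun M _ v => tr (f M v) (g M v) (h M v)) := by
  unfold tr; infer_instance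
theorem tr_inj {a r b a' r' b' : M} (h : tr a r b = tr a' r' b') : a = a' ∧ r = r' ∧ b = b' := by
  simpa only [tr, pr_eq] using h
theorem le_tr (a r b : M) : a ≤ tr a r b ∧ r ≤ tr a r b ∧ b ≤ tr a r b :=
  ⟨le_pr_left _ _, le_trans (le_pr_left _ _) (le_pr_right _ _),
   le_trans (le_pr_right _ _) (le_pr_right _ _)⟩
/-- binary operations on values -/
def Op (o c d b : M) : Prop :=
  (o = 0 ∧ b = c + d) ∨ (o = 1 ∧ b = c * d) ∨ (o = ((2 : ℕ) : M) ∧ ((c = d ∧ b = 1) ∨ (c ≠ d ∧ b = 0))) ∨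
  (o = ((3 : ℕ) : M) ∧ ((c ≤ d ∧ b = 1) ∨ (¬ c ≤ d ∧ b = 0))) ∨
  (o = ((4 : ℕ) : M) ∧ (((c = 1 → d = 1) ∧ b = 1) ∨ (¬ (c = 1 → d = 1) ∧ b = 0)))
theorem Op_unique {o c d b b' : M} (h : Op o c d b) (h' : Op o c d b') : b = b' := by
  unfold Op at h h'
  rcases h with ⟨rfl, rfl⟩ | ⟨rfl, rfl⟩ | ⟨rfl, h⟩ | ⟨rfl, h⟩ | ⟨rfl, h⟩ <;>
    simp at h' <;> grind
/-- one evaluation step -/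
def Stp (E : M → M → M → Prop) (a r b : M) : Prop :=
  (a = pr 0 b) ∨ (a = pr 1 0 ∧ b = r) ∨
  (∃ k, ∃ y, a = pr ((2 : ℕ) : M) k ∧ E k r (pr b y)) ∨
  (∃ k, ∃ x, a = pr ((3 : ℕ) : M) k ∧ E k r (pr x b)) ∨
  (∃ o, ∃ k, ∃ l, ∃ c, ∃ d, a = pr ((4 : ℕ) : M) (pr o (pr k l)) ∧ E k r c ∧ E l r d ∧ Op o c d b) ∨
  (∃ k, ∃ l, ∃ c, a = pr ((5 : ℕ) : M) (pr k l) ∧ E k r c ∧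
    ((b = 1 ∧ ∀ x, x ≤ c → E l (pr x r) 1) ∨ (b = 0 ∧ ∃ x, x ≤ c ∧ E l (pr x r) 0)))
def Good (V : M) : Prop := ∀ z, El z V → ∃ a r b, z = tr a r b ∧ Stp (fun a r b => El (tr a r b) V) a r b
def GoodB (V : M) : Prop := ∀ z, z ≤ V → El z V → ∃ a, a ≤ V ∧ ∃ r, r ≤ V ∧ ∃ b, b ≤ V ∧ z = tr a r b ∧
  ((a = pr 0 b) ∨ (a = pr 1 0 ∧ b = r) ∨
  (∃ k, k ≤ V ∧ ∃ y, y ≤ V ∧ a = pr ((2 : ℕ) : M) k ∧ El (tr k r (pr b y)) V) ∨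
  (∃ k, k ≤ V ∧ ∃ x, x ≤ V ∧ a = pr ((3 : ℕ) : M) k ∧ El (tr k r (pr x b)) V) ∨
  (∃ o, o ≤ V ∧ ∃ k, k ≤ V ∧ ∃ l, l ≤ V ∧ ∃ c, c ≤ V ∧ ∃ d, d ≤ V ∧ a = pr ((4 : ℕ) : M) (pr o (pr k l)) ∧
    El (tr k r c) V ∧ El (tr l r d) V ∧ Op o c d b) ∨
  (∃ k, k ≤ V ∧ ∃ l, l ≤ V ∧ ∃ c, c ≤ V ∧ a = pr ((5 : ℕ) : M) (pr k l) ∧ El (tr k r c) V ∧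
    ((b = 1 ∧ ∀ x, x ≤ c → El (tr l (pr x r) 1) V) ∨ (b = 0 ∧ ∃ x, x ≤ c ∧ El (tr l (pr x r) 0) V))))
theorem GoodB_iff (V : M) : GoodB V ↔ Good V := by
  constructor
  · intro h z hz
    obtain ⟨a, -, r, -, b, -, rfl, h⟩ := h z (El_lt hz).le hz
    refine ⟨a, r, b, rfl, ?_⟩
    rcases h with h | h | ⟨k, -, y, -, h⟩ | ⟨k, -, y, -, h⟩ | ⟨o, -, k, -, l, -, c, -, d, -, h⟩ | ⟨k, -, l, -, c, -, h⟩
    · exact Or.inl h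
    · exact Or.inr (Or.inl h)
    · exact Or.inr (Or.inr (Or.inl ⟨k, y, h⟩))
    · exact Or.inr (Or.inr (Or.inr (Or.inl ⟨k, y, h⟩)))
    · exact Or.inr (Or.inr (Or.inr (Or.inr (Or.inl ⟨o, k, l, c, d, h⟩))))
    · exact Or.inr (Or.inr (Or.inr (Or.inr (Or.inr ⟨k, l, c, h⟩))))
  · intro h z hzV hz
    obtain ⟨a, r, b, rfl, h⟩ := h z hz
    have ha := (le_tr a r b).1.trans hzV
    have key : ∀ {a r b : M}, El (tr a r b) V → a ≤ V ∧ b ≤ V := fun h =>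
      ⟨(le_tr _ _ _).1.trans (El_lt h).le, (le_tr _ _ _).2.2.trans (El_lt h).le⟩
    refine ⟨a, ha, r, (le_tr a r b).2.1.trans hzV, b, (le_tr a r b).2.2.trans hzV, rfl, ?_⟩
    rcases h with h | h | ⟨k, y, h⟩ | ⟨k, y, h⟩ | ⟨o, k, l, c, d, h⟩ | ⟨k, l, c, h⟩
    · exact Or.inl h
    · exact Or.inr (Or.inl h)
    · exact Or.inr (Or.inr (Or.inl ⟨k, (key h.2).1, y, (le_pr_right _ _).trans (key h.2).2, h⟩))
    · exact Or.inr (Or.inr (Or.inr (Or.inl ⟨k, (key h.2).1, y, (le_pr_left _ _).trans (key h.2).2, h⟩)))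
    · refine Or.inr (Or.inr (Or.inr (Or.inr (Or.inl ⟨o, ?_, k, (key h.2.1).1, l, (key h.2.2.1).1, c, (key h.2.1).2, d, (key h.2.2.1).2, h⟩))))
      refine le_trans ?_ ha
      rw [h.1]
      exact (le_pr_left _ _).trans (le_pr_right _ _)
    · refine Or.inr (Or.inr (Or.inr (Or.inr (Or.inr ⟨k, (key h.2.1).1, l, ?_, c, (key h.2.1).2, h⟩))))
      refine le_trans ?_ ha
      rw [h.1]
      exact (le_pr_right _ _).trans (le_pr_right _ _)
instance {f g h k : TFam} [CT f] [CT g] [CT h] [CT k] : CD0 (fun M _ v => Op (f M v) (g M v) (h M v) (k M v)) := by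
  unfold Op; infer_instance
set_option synthInstance.maxHeartbeats 400000 in
set_option synthInstance.maxSize 1000 in
theorem GoodD0 : CD0 (fun M _ v => GoodB (v.headD 0)) := by
  unfold GoodB; infer_instance
instance {f : TFam} [hf : CT f] : CD0 (fun M _ v => Good (f M v)) :=
  ⟨(GoodD0.out.sub (inferInstance : CE (fun M _ v => [f M v])).out).congr fun M _ v => GoodB_iff _⟩
/-- evaluation -/
def Val (a r b : M) : Prop := ∃ V, Good V ∧ El (tr a r b) V
theorem ValS : CS 1 (fun M _ v => Val (v.headD 0) (v.tail.headD 0) (v.tail.tail.headD 0)) := by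
  unfold Val; infer_instance
instance {n : ℕ} {f g h : TFam} [hf : CT f] [hg : CT g] [hh : CT h] :
    CS (n + 1) (fun M _ v => Val (f M v) (g M v) (h M v)) := by
  have h1 := (ValS.out.sub (inferInstance : CE (fun M _ v => [f M v, g M v, h M v])).out)
  induction n with
  | zero => exact ⟨h1⟩
  | succ n ih => exact ⟨ih.out.succ⟩
theorem Stp_mono {E E' : M → M → M → Prop} (hE : ∀ a r b, E a r b → E' a r b) {a r b : M}
    (h : Stp E a r b) : Stp E' a r b := by
  rcases h with h | h | ⟨k, y, h, h'⟩ | ⟨k, y, h, h'⟩ | ⟨o, k, l, c, d, h, h1, h2, h3⟩ | ⟨k, l, c, h, h1, h2⟩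
  · exact Or.inl h
  · exact Or.inr (Or.inl h)
  · exact Or.inr (Or.inr (Or.inl ⟨k, y, h, hE _ _ _ h'⟩))
  · exact Or.inr (Or.inr (Or.inr (Or.inl ⟨k, y, h, hE _ _ _ h'⟩)))
  · exact Or.inr (Or.inr (Or.inr (Or.inr (Or.inl ⟨o, k, l, c, d, h, hE _ _ _ h1, hE _ _ _ h2, h3⟩))))
  · refine Or.inr (Or.inr (Or.inr (Or.inr (Or.inr ⟨k, l, c, h, hE _ _ _ h1, ?_⟩))))
    rcases h2 with ⟨h2, h3⟩ | ⟨h2, x, h3, h4⟩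
    · exact Or.inl ⟨h2, fun x hx => hE _ _ _ (h3 x hx)⟩
    · exact Or.inr ⟨h2, x, h3, hE _ _ _ h4⟩
theorem Val_inv {a r b : M} (h : Val a r b) : Stp Val a r b := by
  obtain ⟨V, hV, h⟩ := h
  obtain ⟨a', r', b', he, h1⟩ := hV _ h
  obtain ⟨rfl, rfl, rfl⟩ := tr_inj he
  exact Stp_mono (fun a r b h => ⟨V, hV, h⟩) h1
theorem Val_intro {a r b : M} (N : M)
    (h : Stp (fun a r b => ∃ V, V ≤ N ∧ Good V ∧ El (tr a r b) V) a r b) : Val a r b := by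
  obtain ⟨W, hW⟩ := p_compr (fun M _ l z => z = l.tail.headD 0 ∨ ∃ V, V ≤ l.headD 0 ∧ Good V ∧ El z V) [N, tr a r b] (N + tr a r b + 1)
  simp only [List.headD_cons, List.tail_cons] at hW
  have hsub : ∀ V, V ≤ N → Good V → ∀ z, El z V → El z W := fun V hV hg z hz =>
    (hW z).2 ⟨lt_of_lt_of_le (El_lt hz) (le_trans hV (by rw [add_assoc]; exact le_self_add)), Or.inr ⟨V, hV, hg, hz⟩⟩
  have hel : El (tr a r b) W := (hW _).2 ⟨(p_lt_add_one _ _).2 le_add_self, Or.inl rfl⟩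
  refine ⟨W, fun z hz => ?_, hel⟩
  rcases ((hW z).1 hz).2 with rfl | ⟨V, h1, h2, h3⟩
  · exact ⟨a, r, b, rfl, Stp_mono (fun a r b ⟨V, h1, h2, h3⟩ => hsub V h1 h2 _ h3) h⟩
  · obtain ⟨a', r', b', rfl, h4⟩ := h2 z h3
    exact ⟨a', r', b', rfl, Stp_mono (fun a r b h => hsub V h1 h2 _ h) h4⟩
theorem Val_intro' {a r b : M} (h : Stp Val a r b) : Val a r b := by
  have key : ∀ {a r b : M}, Val a r b → ∃ N0, ∀ N, N0 ≤ N → ∃ V, V ≤ N ∧ Good V ∧ El (tr a r b) V :=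
    fun ⟨V, h1, h2⟩ => ⟨V, fun N hN => ⟨V, hN, h1, h2⟩⟩
  rcases h with h | h | ⟨k, y, h, h'⟩ | ⟨k, y, h, h'⟩ | ⟨o, k, l, c, d, h, h1, h2, h3⟩ | ⟨k, l, c, h, h1, h2⟩
  · exact Val_intro 0 (Or.inl h)
  · exact Val_intro 0 (Or.inr (Or.inl h))
  · obtain ⟨N, hN⟩ := key h'
    exact Val_intro N (Or.inr (Or.inr (Or.inl ⟨k, y, h, hN _ le_rfl⟩)))
  · obtain ⟨N, hN⟩ := key h'
    exact Val_intro N (Or.inr (Or.inr (Or.inr (Or.inl ⟨k, y, h, hN _ le_rfl⟩))))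
  · obtain ⟨N, hN⟩ := key h1
    obtain ⟨N', hN'⟩ := key h2
    exact Val_intro (N + N') (Or.inr (Or.inr (Or.inr (Or.inr (Or.inl ⟨o, k, l, c, d, h, hN _ le_self_add, hN' _ le_add_self, h3⟩)))))
  · obtain ⟨N, hN⟩ := key h1
    rcases h2 with ⟨h2, h3⟩ | ⟨h2, x, h3, h4⟩
    · obtain ⟨N', hN'⟩ := p_coll (fun M _ l' y w => Good w ∧ El (tr (l'.headD 0) (pr y (l'.tail.headD 0)) 1) w) [l, r] c h3
      exact Val_intro (N + N') (Or.inr (Or.inr (Or.inr (Or.inr (Or.inr ⟨k, l, c, h, hN _ le_self_add, Or.inl ⟨h2, fun x hx => by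
        obtain ⟨V, h5, h6⟩ := hN' x hx
        exact ⟨V, h5.trans le_add_self, h6⟩⟩⟩)))))
    · obtain ⟨N', hN'⟩ := key h4
      exact Val_intro (N + N') (Or.inr (Or.inr (Or.inr (Or.inr (Or.inr ⟨k, l, c, h, hN _ le_self_add, Or.inr ⟨h2, x, h3, hN' _ le_add_self⟩⟩)))))
/-- unique evaluation -/
def Ev (a r b : M) : Prop := Val a r b ∧ ∀ b', Val a r b' → b' = b
theorem Ev_const (k r : M) : Ev (pr 0 k) r k := by
  refine ⟨Val_intro' (Or.inl rfl), fun b' h => ?_⟩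
  have := Val_inv h
  unfold Stp at this
  simp [pr_eq] at this
  exact this.symm
theorem Ev_env (r : M) : Ev (pr 1 0) r r := by
  refine ⟨Val_intro' (Or.inr (Or.inl ⟨rfl, rfl⟩)), fun b' h => ?_⟩
  have := Val_inv h
  unfold Stp at this
  simp [pr_eq] at this
  exact this
theorem Ev_fst {k r x y : M} (h : Ev k r (pr x y)) : Ev (pr ((2 : ℕ) : M) k) r x := by
  refine ⟨Val_intro' (Or.inr (Or.inr (Or.inl ⟨k, y, rfl, h.1⟩))), fun b' h' => ?_⟩
  have := Val_inv h'
  unfold Stp at this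
  simp [pr_eq] at this
  obtain ⟨y', this⟩ := this
  exact (pr_inj (h.2 _ this)).1
theorem Val_snd {k r b : M} : Val (pr ((3 : ℕ) : M) k) r b ↔ ∃ x, Val k r (pr x b) := by
  refine ⟨fun h' => ?_, fun ⟨x, h⟩ => Val_intro' (Or.inr (Or.inr (Or.inr (Or.inl ⟨k, x, rfl, h⟩))))⟩
  have := Val_inv h'
  unfold Stp at this
  simp [pr_eq] at this
  exact this
theorem Ev_snd {k r x y : M} (h : Ev k r (pr x y)) : Ev (pr ((3 : ℕ) : M) k) r y := by
  refine ⟨Val_snd.2 ⟨x, h.1⟩, fun b' h' => ?_⟩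
  obtain ⟨y', this⟩ := Val_snd.1 h'
  exact (pr_inj (h.2 _ this)).2
theorem Ev_op {o k l r c d b : M} (hk : Ev k r c) (hl : Ev l r d) (ho : Op o c d b) :
    Ev (pr ((4 : ℕ) : M) (pr o (pr k l))) r b := by
  refine ⟨Val_intro' (Or.inr (Or.inr (Or.inr (Or.inr (Or.inl ⟨o, k, l, c, d, rfl, hk.1, hl.1, ho⟩))))), fun b' h' => ?_⟩
  have := Val_inv h'
  unfold Stp at this
  simp [pr_eq] at this
  obtain ⟨c', h1, d', h2, h3⟩ := this
  obtain rfl := hk.2 _ h1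
  obtain rfl := hl.2 _ h2
  exact Op_unique h3 ho
theorem Ev_ball1 {k l r c : M} (hk : Ev k r c) (hl : ∀ x, x ≤ c → Ev l (pr x r) 1) :
    Ev (pr ((5 : ℕ) : M) (pr k l)) r 1 := by
  refine ⟨Val_intro' (Or.inr (Or.inr (Or.inr (Or.inr (Or.inr ⟨k, l, c, rfl, hk.1, Or.inl ⟨rfl, fun x hx => (hl x hx).1⟩⟩))))), fun b' h' => ?_⟩
  have := Val_inv h'
  unfold Stp at this
  simp [pr_eq] at this
  obtain ⟨c', h1, h2⟩ := this
  obtain rfl := hk.2 _ h1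
  rcases h2 with ⟨h2, h3⟩ | ⟨h2, x, h3, h4⟩
  · exact h2
  · exact absurd ((hl x h3).2 _ h4) zero_ne_one
theorem Ev_ball0 {k l r c x : M} (hk : Ev k r c) (hx : x ≤ c) (hl : Ev l (pr x r) 0) :
    Ev (pr ((5 : ℕ) : M) (pr k l)) r 0 := by
  refine ⟨Val_intro' (Or.inr (Or.inr (Or.inr (Or.inr (Or.inr ⟨k, l, c, rfl, hk.1, Or.inr ⟨rfl, x, hx, hl.1⟩⟩))))), fun b' h' => ?_⟩
  have := Val_inv h'
  unfold Stp at this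
  simp [pr_eq] at this
  obtain ⟨c', h1, h2⟩ := this
  obtain rfl := hk.2 _ h1
  rcases h2 with ⟨h2, h3⟩ | ⟨h2, _⟩
  · exact absurd (hl.2 _ (h3 x hx)) one_ne_zero
  · exact h2
end eval

theorem tm_ind {m : ℕ} {C : Tm m → Prop} (hv : ∀ i, C (vT i)) (h0 : C zeroT)
    (hs : ∀ t, C t → C (succT t)) (ha : ∀ t u, C t → C u → C (addT t u))
    (hm : ∀ t u, C t → C u → C (mulT t u)) (t : Tm m) : C t := by
  induction t with
  | var x =>
    rcases x with x | i
    · exact x.elim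
    · exact hv i
  | @func l f ts ih =>
    match l, f, ts, ih with
    | 0, (), ts, ih =>
      have : ts = default := funext fun i => i.elim0
      rw [this]; exact h0
    | 1, (), ts, ih =>
      have : ts = ![ts 0] := by funext i; fin_cases i; rfl
      rw [this]; exact hs _ (ih 0)
    | 2, false, ts, ih =>
      have : ts = ![ts 0, ts 1] := by funext i; fin_cases i <;> rfl
      rw [this]; exact ha _ _ (ih 0) (ih 1)
    | 2, true, ts, ih =>
      have : ts = ![ts 0, ts 1] := by funext i; fin_cases i <;> rfl
      rw [this]; exact hm _ _ (ih 0) (ih 1)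

def prN (x y : ℕ) : ℕ := (x + y) * (x + y) + x
@[simp] theorem cast_prN {M : Type} [PAM M] (x y : ℕ) : ((prN x y : ℕ) : M) = pr (x : M) (y : M) := by
  simp [prN, pr]

section
variable {M : Type} [PAM M]
/-- code of an environment -/
def ecb (r : M) (l : List M) : M := l.foldr pr r
def rl {m : ℕ} (v : Fin m → M) : List M := (List.ofFn v).reverse
/-- code of the environment given by a vector -/
def ev {m : ℕ} (v : Fin m → M) : M := ecb 0 (rl v)
theorem rl_snoc {m : ℕ} (v : Fin m → M) (x : M) : rl (Fin.snoc v x : Fin (m+1) → M) = x :: rl v := by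
  unfold rl
  rw [List.ofFn_succ']
  simp
theorem ev_snoc {m : ℕ} (v : Fin m → M) (x : M) : ev (Fin.snoc v x : Fin (m+1) → M) = pr x (ev v) := by
  unfold ev; rw [rl_snoc]; rfl
end
/-- code for iterated second projection -/
def dc : ℕ → ℕ
  | 0 => prN 1 0
  | j + 1 => prN 3 (dc j)
section
variable {M : Type} [PAM M]
theorem Ev_dc (r : M) (l : List M) : Ev ((dc l.length : ℕ) : M) (ecb r l) r := by
  induction l using List.reverseRecOn generalizing r with
  | nil => simpa [dc, ecb] using Ev_env r
  | append_singleton l x ih =>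
    have := ih (pr x r)
    simp only [List.length_append, List.length_singleton, dc, cast_prN]
    have e : ecb r (l ++ [x]) = ecb (pr x r) l := by simp [ecb]
    rw [e]
    exact Ev_snd this
theorem Val_dc (j : ℕ) (s r : M) : Val ((dc j : ℕ) : M) s r ↔ ∃ l : List M, l.length = j ∧ s = ecb r l := by
  constructor
  · intro h
    induction j generalizing r with
    | zero =>
      simp only [dc, cast_prN, Nat.cast_one, Nat.cast_zero] at h
      exact ⟨[], rfl, ((Ev_env s).2 _ h).symm⟩
    | succ j ih =>
      simp only [dc, cast_prN] at h
      obtain ⟨x, hx⟩ := Val_snd.1 h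
      obtain ⟨l, h1, h2⟩ := ih _ hx
      exact ⟨l ++ [x], by simp [h1], by rw [h2]; simp [ecb]⟩
  · rintro ⟨l, rfl, rfl⟩
    exact (Ev_dc r l).1
theorem Ev_var {m : ℕ} (v : Fin m → M) (i : Fin m) :
    Ev ((prN 2 (dc (m - 1 - i)) : ℕ) : M) (ev v) (v i) := by
  rw [cast_prN]
  have hl : (rl v).length = m := by simp [rl]
  have hi := i.2
  have hlt : m - 1 - i < (rl v).length := by omega
  have h1 : (rl v)[m - 1 - i] = v i := by
    simp only [rl, List.getElem_reverse, List.getElem_ofFn]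
    congr 1
    ext
    simp
    omega
  have h2 : rl v = (rl v).take (m - 1 - i) ++ (v i :: (rl v).drop (m - 1 - i + 1)) := by
    rw [← h1, List.getElem_cons_drop, List.take_append_drop]
  have h3 := Ev_dc (pr (v i) (ecb 0 ((rl v).drop (m - 1 - i + 1)))) ((rl v).take (m - 1 - i))
  rw [List.length_take, min_eq_left (by omega)] at h3
  have h4 : ecb (pr (v i) (ecb 0 ((rl v).drop (m - 1 - i + 1)))) ((rl v).take (m - 1 - i)) = ev v := by
    unfold ev
    conv_rhs => rw [h2]
    simp [ecb]
  rw [h4] at h3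
  exact Ev_fst h3
end
theorem tm_code {m : ℕ} (t : Tm m) : ∃ e : ℕ, ∀ (M : Type) [PAM M] (v : Fin m → M), Ev (e : M) (ev v) (tv v t) := by
  induction t using tm_ind with
  | hv i => exact ⟨_, fun M _ v => by rw [tv_var]; exact Ev_var v i⟩
  | h0 => exact ⟨prN 0 0, fun M _ v => by
      rw [tv_zero, zeroM_eq, cast_prN, Nat.cast_zero]; exact Ev_const _ _⟩
  | hs t ih =>
    obtain ⟨e, he⟩ := ih
    refine ⟨prN 4 (prN 0 (prN e (prN 0 1))), fun M _ v => ?_⟩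
    simp only [cast_prN, Nat.cast_zero, Nat.cast_one, tv_succ, p_suc_eq]
    exact Ev_op (he M v) (Ev_const _ _) (Or.inl ⟨rfl, rfl⟩)
  | ha t u ht hu =>
    obtain ⟨e, he⟩ := ht
    obtain ⟨e', he'⟩ := hu
    refine ⟨prN 4 (prN 0 (prN e e')), fun M _ v => ?_⟩
    simp only [cast_prN, Nat.cast_zero, Nat.cast_one, tv_add]
    exact Ev_op (he M v) (he' M v) (Or.inl ⟨rfl, rfl⟩)
  | hm t u ht hu =>
    obtain ⟨e, he⟩ := ht
    obtain ⟨e', he'⟩ := hu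
    refine ⟨prN 4 (prN 1 (prN e e')), fun M _ v => ?_⟩
    simp only [cast_prN, Nat.cast_zero, Nat.cast_one, tv_mul]
    exact Ev_op (he M v) (he' M v) (Or.inr (Or.inl ⟨rfl, rfl⟩))

/-- truth value -/
noncomputable def bv {M : Type} [PAM M] (p : Prop) : M := open Classical in if p then 1 else 0
theorem bv_eq_one {M : Type} [PAM M] (p : Prop) : (bv p : M) = 1 ↔ p := by
  unfold bv; split_ifs with h <;> simp [h]
theorem bv_true {M : Type} [PAM M] {p : Prop} (h : p) : (bv p : M) = 1 := by simp [bv, h]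
theorem bv_false {M : Type} [PAM M] {p : Prop} (h : ¬ p) : (bv p : M) = 0 := by simp [bv, h]

theorem imp_code {m : ℕ} {P Q : ∀ (M : Type) [PAM M], (Fin m → M) → Prop}
    (hP : ∃ e : ℕ, ∀ (M : Type) [PAM M] (v : Fin m → M), Ev (e : M) (ev v) (bv (P M v)))
    (hQ : ∃ e : ℕ, ∀ (M : Type) [PAM M] (v : Fin m → M), Ev (e : M) (ev v) (bv (Q M v))) :
    ∃ e : ℕ, ∀ (M : Type) [PAM M] (v : Fin m → M), Ev (e : M) (ev v) (bv (P M v → Q M v)) := by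
  obtain ⟨e, he⟩ := hP
  obtain ⟨e', he'⟩ := hQ
  refine ⟨prN 4 (prN 4 (prN e e')), fun M _ v => ?_⟩
  simp only [cast_prN]
  refine Ev_op (he M v) (he' M v) (Or.inr (Or.inr (Or.inr (Or.inr ⟨rfl, ?_⟩))))
  rw [bv_eq_one, bv_eq_one]
  by_cases h : P M v → Q M v
  · exact Or.inl ⟨h, bv_true h⟩
  · exact Or.inr ⟨h, bv_false h⟩
theorem fls_code {m : ℕ} :
    ∃ e : ℕ, ∀ (M : Type) [PAM M] (v : Fin m → M), Ev (e : M) (ev v) (bv False) := by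
  refine ⟨prN 0 0, fun M _ v => ?_⟩
  rw [bv_false id, cast_prN, Nat.cast_zero]
  exact Ev_const _ _
theorem ball_code {m : ℕ} (t : Tm m) {P : ∀ (M : Type) [PAM M], (Fin (m + 1) → M) → Prop}
    (hP : ∃ e : ℕ, ∀ (M : Type) [PAM M] (v : Fin (m + 1) → M), Ev (e : M) (ev v) (bv (P M v))) :
    ∃ e : ℕ, ∀ (M : Type) [PAM M] (v : Fin m → M), Ev (e : M) (ev v)
      (bv (∀ x, x ≤ tv v t → P M (Fin.snoc v x))) := by
  obtain ⟨e, he⟩ := hP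
  obtain ⟨k, hk⟩ := tm_code t
  refine ⟨prN 5 (prN k e), fun M _ v => ?_⟩
  simp only [cast_prN]
  by_cases h : ∀ x, x ≤ tv v t → P M (Fin.snoc v x)
  · rw [bv_true h]
    refine Ev_ball1 (hk M v) fun x hx => ?_
    have := he M (Fin.snoc v x)
    rw [bv_true (h x hx), ev_snoc] at this
    exact this
  · rw [bv_false h]
    push Not at h
    obtain ⟨x, hx, hn⟩ := h
    refine Ev_ball0 (hk M v) hx ?_
    have := he M (Fin.snoc v x)
    rw [bv_false hn, ev_snoc] at this
    exact this

theorem d0_code {m : ℕ} {φ : BF m} (h : IsDelta0 φ) :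
    ∃ e : ℕ, ∀ (M : Type) [PAM M] (v : Fin m → M), Ev (e : M) (ev v) (bv (fv v φ)) := by
  induction h with
  | falsum => exact fls_code
  | equal t u =>
    obtain ⟨e, he⟩ := tm_code t
    obtain ⟨e', he'⟩ := tm_code u
    refine ⟨prN 4 (prN 2 (prN e e')), fun M _ v => ?_⟩
    simp only [cast_prN]
    refine Ev_op (he M v) (he' M v) (Or.inr (Or.inr (Or.inl ⟨rfl, ?_⟩)))
    by_cases h : tv v t = tv v u
    · exact Or.inl ⟨h, bv_true ((fv_eq _ _ _).2 h)⟩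
    · exact Or.inr ⟨h, bv_false (fun h' => h ((fv_eq _ _ _).1 h'))⟩
  | le t u =>
    obtain ⟨e, he⟩ := tm_code t
    obtain ⟨e', he'⟩ := tm_code u
    refine ⟨prN 4 (prN 3 (prN e e')), fun M _ v => ?_⟩
    simp only [cast_prN]
    refine Ev_op (he M v) (he' M v) (Or.inr (Or.inr (Or.inr (Or.inl ⟨rfl, ?_⟩))))
    by_cases h : tv v t ≤ tv v u
    · exact Or.inl ⟨h, bv_true ((fv_le _ _ _).2 h)⟩
    · exact Or.inr ⟨h, bv_false (fun h' => h ((fv_le _ _ _).1 h'))⟩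
  | imp _ _ h1 h2 => exact imp_code h1 h2
  | @ball m t φ _ ih =>
    obtain ⟨e, he⟩ := ball_code t ih
    refine ⟨e, fun M _ v => ?_⟩
    have h1 : t.relabel (Sum.map id Fin.castSucc) = liftT t := rfl
    have := he M v
    simp only [h1, fv_all, fv_imp, fv_le, tv_var, tv_lift, Fin.snoc_last]
    exact this
  | @bex m t φ _ ih =>
    obtain ⟨e, he⟩ := imp_code (ball_code t (imp_code ih fls_code)) fls_code
    refine ⟨e, fun M _ v => ?_⟩
    have h1 : t.relabel (Sum.map id Fin.castSucc) = liftT t := rfl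
    have := he M v
    simp only [h1, fv_ex, fv_and, fv_le, tv_var, tv_lift, Fin.snoc_last]
    have e2 : (∃ x, leM x (tv v t) ∧ fv (Fin.snoc v x : Fin (m+1) → M) φ) ↔
      ((∀ x, x ≤ tv v t → fv (Fin.snoc v x : Fin (m+1) → M) φ → False) → False) := by
      show (∃ x, x ≤ (tv v t) ∧ fv (Fin.snoc v x : Fin (m+1) → M) φ) ↔ _
      exact ⟨fun ⟨x, h1, h2⟩ h => h x h1 h2, fun h => by
        by_contra hc; exact h fun x h1 h2 => hc ⟨x, h1, h2⟩⟩
    rw [e2]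
    exact this

/-- uniform binary predicates -/
abbrev Rel2 := ∀ (M : Type) [PAM M], M → M → Prop
/-- `W` represents `Π_k` formulas positively and `Σ_k` formulas negatively -/
structure Unv (k : ℕ) (W : Rel2) : Prop where
  pi : ∀ {m : ℕ} {φ : BF m}, IsPiFml k φ → ∃ e : ℕ, ∀ (M : Type) [PAM M] (v : Fin m → M),
    fv v φ ↔ W M (e : M) (ev v)
  sg : ∀ {m : ℕ} {φ : BF m}, IsSigmaFml k φ → ∃ e : ℕ, ∀ (M : Type) [PAM M] (v : Fin m → M),
    fv v φ ↔ ¬ W M (e : M) (ev v)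
  def1 : Sg (k + 1) (fun M _ v => W M (v.headD 0) (v.tail.headD 0))
  def0 : k ≠ 0 → Sg k (fun M _ v => ¬ W M (v.headD 0) (v.tail.headD 0))

theorem d0_code' {m : ℕ} {φ : BF m} (h : IsDelta0 φ) :
    ∃ e : ℕ, ∀ (M : Type) [PAM M] (v : Fin m → M), fv v φ ↔ Val (e : M) (ev v) 1 := by
  obtain ⟨e, he⟩ := d0_code h
  refine ⟨e, fun M _ v => ?_⟩
  have := he M v
  constructor
  · intro h; rw [bv_true h] at this; exact this.1
  · intro h; exact (bv_eq_one _).1 (this.2 _ h).symm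
theorem unv_zero : Unv 0 (fun M _ e s => Val e s 1) where
  pi := by
    intro m φ h
    cases h with
    | ofDelta0 h => exact d0_code' h
  sg := by
    intro m φ h
    cases h with
    | ofDelta0 h =>
      obtain ⟨e, he⟩ := d0_code' (h.imp .falsum)
      refine ⟨e, fun M _ v => ?_⟩
      rw [← he M v, fv_imp, fv_bot, imp_false, not_not]
  def1 := (inferInstance : CS 1 (fun M _ v => Val (v.headD 0) (v.tail.headD 0) 1)).out
  def0 := fun h => absurd rfl h

/-- next universal predicate -/
def nextU (W : Rel2) : Rel2 := fun M _ e r => ∃ s, ∃ a, ∃ b, e = pr a b ∧ Val a s r ∧ W M b s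

theorem nextU_iff {W : Rel2} (M : Type) [PAM M] (j e : ℕ) (r : M) :
    nextU W M ((prN (dc j) e : ℕ) : M) r ↔ ∃ l : List M, l.length = j ∧ W M (e : M) (ecb r l) := by
  rw [cast_prN]
  constructor
  · rintro ⟨s, a, b, h, h1, h2⟩
    obtain ⟨rfl, rfl⟩ := pr_inj h
    obtain ⟨l, h3, rfl⟩ := (Val_dc _ _ _).1 h1
    exact ⟨l, h3, h2⟩
  · rintro ⟨l, h1, h2⟩
    exact ⟨_, _, _, rfl, (Val_dc _ _ _).2 ⟨l, h1, rfl⟩, h2⟩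
theorem ex_list_succ {M : Type} [PAM M] (j : ℕ) (r : M) (C : M → Prop) :
    (∃ l : List M, l.length = j + 1 ∧ C (ecb r l)) ↔ ∃ x, ∃ l : List M, l.length = j ∧ C (ecb (pr x r) l) := by
  constructor
  · rintro ⟨l, h1, h2⟩
    induction l using List.reverseRecOn with
    | nil => simp at h1
    | append_singleton l x _ =>
      refine ⟨x, l, by simpa using h1, ?_⟩
      simpa [ecb] using h2
  · rintro ⟨x, l, h1, h2⟩
    exact ⟨l ++ [x], by simp [h1], by simpa [ecb] using h2⟩
theorem unv_succ {k : ℕ} {W : Rel2} (hW : Unv k W) : Unv (k + 1) (fun M _ e r => ¬ nextU W M e r) := by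
  have hd : Sg (k + 1) (fun M _ v => nextU W M (v.headD 0) (v.tail.headD 0)) := by
    have : CS (k + 1) (fun M _ w => W M (w.headD 0) (w.tail.tail.headD 0)) :=
      ⟨hW.def1.sub (inferInstance : CE (fun M _ w => [w.headD 0, w.tail.tail.headD 0])).out⟩
    exact (inferInstance : CS (k + 1) (fun M _ v => ∃ s, ∃ a, ∃ b, v.headD 0 = pr a b ∧ Val a s (v.tail.headD 0) ∧ W M b s)).out
  refine ⟨?_, ?_, ?_, ?_⟩
  · intro m φ h
    have : ∃ j e : ℕ, ∀ (M : Type) [PAM M] (v : Fin m → M), fv v φ ↔ ¬ ∃ l : List M, l.length = j ∧ W M (e : M) (ecb (ev v) l) := by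
      refine @IsPiFml.rec (fun _ _ _ _ => True) (fun k' m φ _ => k' = k + 1 →
        ∃ j e : ℕ, ∀ (M : Type) [PAM M] (v : Fin m → M), fv v φ ↔ ¬ ∃ l : List M, l.length = j ∧ W M (e : M) (ecb (ev v) l))
        ?_ ?_ ?_ ?_ ?_ ?_ _ m φ h rfl
      · intros; trivial
      · intros; trivial
      · intros; trivial
      · intro m φ h hk
        omega
      · intro k' m φ hin _ hk
        obtain rfl : k' = k := by omega
        obtain ⟨e, he⟩ := hW.sg hin
        refine ⟨0, e, fun M _ v => ?_⟩
        rw [he]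
        simp [ecb]
      · intro k' m φ h ih hk
        obtain ⟨j, e, he⟩ := ih hk
        refine ⟨j + 1, e, fun M _ v => ?_⟩
        rw [fv_all, ex_list_succ, not_exists]
        refine forall_congr' fun x => ?_
        rw [he, ev_snoc]
    obtain ⟨j, e, he⟩ := this
    exact ⟨prN (dc j) e, fun M _ v => by rw [he, nextU_iff]⟩
  · intro m φ h
    have : ∃ j e : ℕ, ∀ (M : Type) [PAM M] (v : Fin m → M), fv v φ ↔ ∃ l : List M, l.length = j ∧ W M (e : M) (ecb (ev v) l) := by
      refine @IsSigmaFml.rec (fun k' m φ _ => k' = k + 1 →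
        ∃ j e : ℕ, ∀ (M : Type) [PAM M] (v : Fin m → M), fv v φ ↔ ∃ l : List M, l.length = j ∧ W M (e : M) (ecb (ev v) l)) (fun _ _ _ _ => True)
        ?_ ?_ ?_ ?_ ?_ ?_ _ m φ h rfl
      · intro m φ h hk
        omega
      · intro k' m φ hin _ hk
        obtain rfl : k' = k := by omega
        obtain ⟨e, he⟩ := hW.pi hin
        refine ⟨0, e, fun M _ v => ?_⟩
        rw [he]
        simp [ecb]
      · intro k' m φ h ih hk
        obtain ⟨j, e, he⟩ := ih hk
        refine ⟨j + 1, e, fun M _ v => ?_⟩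
        rw [fv_ex, ex_list_succ]
        refine exists_congr fun x => ?_
        rw [he, ev_snoc]
      · intros; trivial
      · intros; trivial
      · intros; trivial
    obtain ⟨j, e, he⟩ := this
    exact ⟨prN (dc j) e, fun M _ v => by rw [he, nextU_iff, not_not]⟩
  · exact Sg.ofPi (hd.congr fun M _ v => by rw [not_not])
  · exact fun _ => hd.congr fun M _ v => by rw [not_not]
theorem unv_ex (k : ℕ) : ∃ W, Unv k W := by
  induction k with
  | zero => exact ⟨_, unv_zero⟩
  | succ k ih => obtain ⟨W, h⟩ := ih; exact ⟨_, unv_succ h⟩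

/-- universal `Σ_n` predicate for sentences -/
theorem univ_ex (n : ℕ) (hn : 1 ≤ n) : ∃ U : (∀ (M : Type) [PAM M], M → Prop), Sg n (fun M _ v => U M (v.headD 0)) ∧
    (∀ σ ∈ SigmaS n, ∃ z : ℕ, ∀ (M : Type) [PAM M], M ⊨ σ ↔ U M (z : M)) ∧
    (∀ π ∈ PiS n, ∃ z : ℕ, ∀ (M : Type) [PAM M], M ⊨ π ↔ ¬ U M (z : M)) := by
  obtain ⟨W, h⟩ := unv_ex n
  have e0 : ∀ (M : Type) [PAM M], ev (default : Fin 0 → M) = 0 := fun M _ => rfl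
  refine ⟨fun M _ z => ¬ W M z 0, ?_, ?_, ?_⟩
  · exact (h.def0 (by omega)).sub (inferInstance : CE (fun M _ v => [v.headD 0, 0])).out
  · intro σ hσ
    obtain ⟨e, he⟩ := h.sg hσ
    refine ⟨e, fun M _ => ?_⟩
    rw [← fv_snt default, he, e0]
  · intro σ hσ
    obtain ⟨e, he⟩ := h.pi hσ
    refine ⟨e, fun M _ => ?_⟩
    rw [← fv_snt default, he, e0, not_not]

/-- the standard model -/
structure NN : Type where
  val : ℕ
instance nnStr : LA.Structure NN where
  funMap {n} := match n with
    | 0 => fun _ _ => ⟨0⟩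
    | 1 => fun _ v => ⟨(v 0).val + 1⟩
    | 2 => fun f v => match f with
      | false => ⟨(v 0).val + (v 1).val⟩
      | true => ⟨(v 0).val * (v 1).val⟩
    | (_ + 3) => fun f _ => f.elim
  RelMap {n} := match n with
    | 0 => fun r _ => r.elim
    | 1 => fun r _ => r.elim
    | 2 => fun _ v => (v 0).val ≤ (v 1).val
    | (_ + 3) => fun r _ => r.elim
theorem nn_ax : ∀ φ ∈ PAAx, NN ⊨ φ := by
  rintro φ (h | ⟨k, ψ, rfl⟩)
  · rcases h with h | h | h | h | h | h | h <;> subst h <;> rw [← fv_snt default] <;>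
      simp only [fv_all, fv_not, fv_imp, fv_eq, tv_succ, tv_var, tv_zero, tv_add, tv_mul, fv_iff, fv_le, fv_ex]
    · exact fun x h => Nat.succ_ne_zero x.val (congrArg NN.val h)
    · exact fun x y h => congrArg NN.mk (Nat.succ_injective (congrArg NN.val h))
    · exact fun x => rfl
    · exact fun x y => rfl
    · exact fun x => rfl
    · exact fun x y => rfl
    · intro x y
      exact ⟨fun (h : x.val ≤ y.val) => ⟨⟨y.val - x.val⟩, congrArg NN.mk (Nat.sub_add_cancel h)⟩, fun ⟨z, h⟩ => by
        have h' : z.val + x.val = y.val := congrArg NN.val h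
        show x.val ≤ y.val
        omega⟩
  · rw [ind_iff]
    intro v h0 hs x
    obtain ⟨x⟩ := x
    induction x with
    | zero => exact h0
    | succ k ih => exact hs _ ih
instance nnPAM : PAM NN := { nnStr with ax := nn_ax }

theorem nn_cast (k : ℕ) : ((k : ℕ) : NN) = ⟨k⟩ := by
  induction k with
  | zero => simp; rfl
  | succ k ih => rw [Nat.cast_succ, ih]; rfl
theorem nn_surj (x : NN) : ∃ k : ℕ, x = (k : NN) := ⟨x.val, (nn_cast x.val).symm⟩
theorem nn_forall {p : NN → Prop} : (∀ x, p x) ↔ ∀ k : ℕ, p (k : NN) :=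
  ⟨fun h k => h _, fun h x => by obtain ⟨k, rfl⟩ := nn_surj x; exact h k⟩
theorem nn_exists {p : NN → Prop} : (∃ x, p x) ↔ ∃ k : ℕ, p (k : NN) :=
  ⟨fun ⟨x, h⟩ => by obtain ⟨k, rfl⟩ := nn_surj x; exact ⟨k, h⟩, fun ⟨k, h⟩ => ⟨_, h⟩⟩

theorem std_le {M : Type} [PAM M] (k : ℕ) (y : M) (h : y ≤ (k : M)) : ∃ j : ℕ, y = (j : M) ∧ j ≤ k := by
  induction k with
  | zero => exact ⟨0, le_antisymm h (p_zero_le _), le_rfl⟩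
  | succ k ih =>
    rcases lt_or_eq_of_le h with h | h
    · rw [Nat.cast_succ, p_lt_add_one] at h
      obtain ⟨j, hj, hk⟩ := ih h
      exact ⟨j, hj, by omega⟩
    · exact ⟨k + 1, h, le_rfl⟩

theorem tv_std {m : ℕ} (v : Fin m → ℕ) (t : Tm m) : ∃ k : ℕ, ∀ (M : Type) [PAM M], tv (fun i => (v i : M)) t = (k : M) := by
  induction t using tm_ind with
  | hv i => exact ⟨v i, fun M _ => by simp⟩
  | h0 => exact ⟨0, fun M _ => by simp; rfl⟩
  | hs t ih =>
    obtain ⟨k, h⟩ := ih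
    exact ⟨k + 1, fun M _ => by rw [tv_succ, h, p_suc_eq, Nat.cast_succ]⟩
  | ha t u ih1 ih2 =>
    obtain ⟨k, h⟩ := ih1
    obtain ⟨l, h'⟩ := ih2
    exact ⟨k + l, fun M _ => by rw [tv_add, h, h', addM_eq, Nat.cast_add]⟩
  | hm t u ih1 ih2 =>
    obtain ⟨k, h⟩ := ih1
    obtain ⟨l, h'⟩ := ih2
    exact ⟨k * l, fun M _ => by rw [tv_mul, h, h', mulM_eq, Nat.cast_mul]⟩
theorem snoc_cast {M : Type} [PAM M] {m : ℕ} (v : Fin m → ℕ) (x : ℕ) :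
    (Fin.snoc (fun i => (v i : M)) (x : M) : Fin (m + 1) → M) = fun i => (((Fin.snoc v x : Fin (m + 1) → ℕ) i : ℕ) : M) := by
  funext i
  refine Fin.lastCases ?_ (fun i => ?_) i <;> simp
theorem fv_std {m : ℕ} {φ : BF m} (h : IsDelta0 φ) (v : Fin m → ℕ) (M M' : Type) [PAM M] [PAM M'] :
    fv (fun i => (v i : M)) φ ↔ fv (fun i => (v i : M')) φ := by
  induction h with
  | falsum => simp
  | equal t u =>
    obtain ⟨k, h⟩ := tv_std v t
    obtain ⟨l, h'⟩ := tv_std v u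
    simp only [fv_eq, h, h', Nat.cast_inj]
  | le t u =>
    obtain ⟨k, h⟩ := tv_std v t
    obtain ⟨l, h'⟩ := tv_std v u
    simp only [fv_le, h, h']
    exact (Nat.cast_le (α := M)).trans (Nat.cast_le (α := M')).symm
  | imp _ _ ih1 ih2 => simp only [fv_imp, ih1, ih2]
  | @ball m t φ _ ih =>
    obtain ⟨k, h⟩ := tv_std v t
    have h1 : t.relabel (Sum.map id Fin.castSucc) = liftT t := rfl
    have key : ∀ (M : Type) [PAM M], fv (fun i => (v i : M)) (∀' (leF (vT (Fin.last m)) (liftT t) ⟹ φ)) ↔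
        ∀ j, j ≤ k → fv (fun i => (((Fin.snoc v j : Fin (m + 1) → ℕ) i : ℕ) : M)) φ := by
      intro M _
      simp only [fv_all, fv_imp, fv_le, tv_var, tv_lift, Fin.snoc_last, h]
      constructor
      · intro h j hj
        rw [← snoc_cast]
        exact h _ (Nat.cast_le (α := M).2 hj)
      · intro h x hx
        obtain ⟨j, rfl, hj⟩ := std_le k x hx
        rw [snoc_cast]
        exact h j hj
    rw [h1, key, key]
    exact forall_congr' fun j => imp_congr_right fun _ => ih _
  | @bex m t φ _ ih =>
    obtain ⟨k, h⟩ := tv_std v t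
    have h1 : t.relabel (Sum.map id Fin.castSucc) = liftT t := rfl
    have key : ∀ (M : Type) [PAM M], fv (fun i => (v i : M)) (∃' (leF (vT (Fin.last m)) (liftT t) ⊓ φ)) ↔
        ∃ j, j ≤ k ∧ fv (fun i => (((Fin.snoc v j : Fin (m + 1) → ℕ) i : ℕ) : M)) φ := by
      intro M _
      simp only [fv_ex, fv_and, fv_le, tv_var, tv_lift, Fin.snoc_last, h]
      constructor
      · rintro ⟨x, hx, h⟩
        obtain ⟨j, rfl, hj⟩ := std_le k x hx
        rw [snoc_cast] at h
        exact ⟨j, hj, h⟩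
      · rintro ⟨j, hj, h⟩
        rw [← snoc_cast] at h
        exact ⟨_, Nat.cast_le (α := M).2 hj, h⟩
    rw [h1, key, key]
    exact exists_congr fun j => and_congr_right fun _ => ih _
theorem D0.abs {P : Pred} (h : D0 P) (l : List ℕ) (M M' : Type) [PAM M] [PAM M'] :
    P M (l.map fun (k : ℕ) => (k : M)) ↔ P M' (l.map fun (k : ℕ) => (k : M')) := by
  obtain ⟨φ, hφ, h⟩ := h l.length (List.ofFn fun i => vT i)
  have e : ∀ (M : Type) [PAM M], (l.map fun (k : ℕ) => (k : M)) = (List.ofFn fun i => (vT i : Tm l.length)).map (tv (fun i => ((l.get i : ℕ) : M))) := by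
    intro M _
    rw [List.map_ofFn]
    apply List.ext_getElem <;> simp
  rw [e M, e M', ← h, ← h]
  exact fv_std hφ l.get M M'

theorem D0.mem : D0 (fun M _ w => w.headD 0 ∈ w.tail) := by
  intro m ts
  rcases ts with _ | ⟨t, ts⟩
  · exact ⟨⊥, .falsum, fun M _ v => by simp⟩
  · induction ts with
    | nil => exact ⟨⊥, .falsum, fun M _ v => by simp⟩
    | cons u ts ih =>
      obtain ⟨φ, hφ, h⟩ := ih
      refine ⟨∼(t =' u) ⟹ φ, .imp (.imp (.equal _ _) .falsum) hφ, fun M _ v => ?_⟩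
      have := h M v
      simp only [List.map_cons, List.headD_cons, List.tail_cons] at this
      simp only [fv_imp, fv_not, fv_eq, this, List.map_cons, List.headD_cons, List.tail_cons, List.mem_cons]
      tauto
instance : CD0 (fun M _ w => w.headD 0 ∈ w.tail) := ⟨D0.mem⟩

/-- clause system given by a predicate -/
def Mdl (CL : Pred) (f z : ℕ) (v : ℕ → Prop) : Prop :=
  ∀ w a b c d e : ℕ, CL NN [(w : NN), (a : NN), (b : NN), (c : NN), (d : NN), (e : NN), (f : NN), (z : NN)] →
    (a = 0 ∨ v a) → (b = 0 ∨ v b) → (c = 0 ∨ v c) → (d ≠ 0 ∧ v d) ∨ (e ≠ 0 ∧ v e)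
def Vio (CL : Pred) (M : Type) [PAM M] (N V f z : M) : Prop :=
  ∃ w, w < N ∧ ∃ a, a < N ∧ ∃ b, b < N ∧ ∃ c, c < N ∧ ∃ d, d < N ∧ ∃ e, e < N ∧
    CL M [w, a, b, c, d, e, f, z] ∧ (a = 0 ∨ El a V) ∧ (b = 0 ∨ El b V) ∧ (c = 0 ∨ El c V) ∧ ¬ (¬ d = 0 ∧ El d V) ∧ ¬ (¬ e = 0 ∧ El e V)
def Sub1 (M : Type) [PAM M] (N B : M) : Prop :=
  (∀ V, V ≤ B → ∀ i, i < N → ∃ V', V' ≤ B ∧ ∀ j, j < N → (El j V' ↔ El j V ∨ j = i)) ∧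
  ∃ V, V ≤ B ∧ ∀ j, j < N → ¬ El j V
def Ref (CL : Pred) (M : Type) [PAM M] (x f z : M) : Prop :=
  ∃ N, N ≤ x ∧ ∃ B, B ≤ x ∧ x = pr N B ∧ Sub1 M N B ∧ ∀ V, V ≤ B → Vio CL M N V f z
set_option synthInstance.maxHeartbeats 400000 in
set_option synthInstance.maxSize 1000 in
theorem Ref_D0 (CL : Pred) (h : D0 CL) : D0 (fun M _ v => Ref CL M (v.headD 0) (v.tail.headD 0) (v.tail.tail.headD 0)) := by
  have i1 : CD0 (fun M _ v => Vio CL M (v.headD 0) (v.tail.headD 0) (v.tail.tail.headD 0) (v.tail.tail.tail.headD 0)) := by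
    have : CD0 (fun M _ (w : List M) => CL M [w.tail.tail.tail.tail.tail.headD 0, w.tail.tail.tail.tail.headD 0, w.tail.tail.tail.headD 0,
      w.tail.tail.headD 0, w.tail.headD 0, w.headD 0, w.tail.tail.tail.tail.tail.tail.tail.tail.headD 0, w.tail.tail.tail.tail.tail.tail.tail.tail.tail.headD 0]) :=
      ⟨h.sub (inferInstance : CE (fun M _ (w : List M) => [w.tail.tail.tail.tail.tail.headD 0, w.tail.tail.tail.tail.headD 0, w.tail.tail.tail.headD 0,
      w.tail.tail.headD 0, w.tail.headD 0, w.headD 0, w.tail.tail.tail.tail.tail.tail.tail.tail.headD 0, w.tail.tail.tail.tail.tail.tail.tail.tail.tail.headD 0])).out⟩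
    unfold Vio
    infer_instance
  have i2 : CD0 (fun M _ v => Sub1 M (v.headD 0) (v.tail.headD 0)) := by
    unfold Sub1
    infer_instance
  have i3 : CD0 (fun M _ v => Vio CL M (v.tail.tail.headD 0) (v.headD 0) (v.tail.tail.tail.tail.headD 0) (v.tail.tail.tail.tail.tail.headD 0)) :=
    ⟨i1.out.sub (inferInstance : CE (fun M _ v => [v.tail.tail.headD 0, v.headD 0, v.tail.tail.tail.tail.headD 0, v.tail.tail.tail.tail.tail.headD 0])).out⟩
  have i4 : CD0 (fun M _ v => Sub1 M (v.tail.headD 0) (v.headD 0)) :=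
    ⟨i2.out.sub (inferInstance : CE (fun M _ v => [v.tail.headD 0, v.headD 0])).out⟩
  unfold Ref
  exact (inferInstance : CD0 _).out

theorem nn_set (s : Finset ℕ) : ∃ V : ℕ, ∀ j : ℕ, El (j : NN) (V : NN) ↔ j ∈ s := by
  obtain ⟨N, hN⟩ : ∃ N : ℕ, ∀ j ∈ s, j < N := ⟨s.sup id + 1, fun j hj => Nat.lt_succ_of_le (Finset.le_sup (f := id) hj)⟩
  obtain ⟨V, hV⟩ := p_compr (M := NN) (fun M _ l x => x ∈ l) (s.toList.map fun (k : ℕ) => (k : NN)) (N : NN)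
  obtain ⟨V, rfl⟩ := nn_surj V
  refine ⟨V, fun j => ?_⟩
  rw [hV, Nat.cast_lt]
  simp only [List.mem_map, Finset.mem_toList, Nat.cast_inj, exists_eq_right]
  exact ⟨fun h => h.2, fun h => ⟨hN j h, h⟩⟩

theorem Ref_iff (CL : Pred) (f z : ℕ) : (∃ x : ℕ, Ref CL NN (x : NN) (f : NN) (z : NN)) ↔ ¬ ∃ v, Mdl CL f z v := by
  classical
  constructor
  · rintro ⟨x, N, -, B, -, -, ⟨hs, V0, hV0, hV0'⟩, hV⟩ ⟨v, hv⟩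
    obtain ⟨N, rfl⟩ := nn_surj N
    have : ∀ k : ℕ, k ≤ N → ∃ V, V ≤ B ∧ ∀ j : ℕ, j < N → (El (j : NN) V ↔ j < k ∧ v j) := by
      intro k
      induction k with
      | zero => exact fun _ => ⟨V0, hV0, fun j hj => by simpa using hV0' _ (Nat.cast_lt (α := NN).2 hj)⟩
      | succ k ih =>
        intro hk
        obtain ⟨V, h1, h2⟩ := ih (by omega)
        by_cases hvk : v k
        · obtain ⟨V', h3, h4⟩ := hs V h1 (k : NN) (Nat.cast_lt (α := NN).2 (by omega))
          refine ⟨V', h3, fun j hj => ?_⟩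
          rw [h4 _ (Nat.cast_lt (α := NN).2 hj), h2 j hj, Nat.cast_inj]
          constructor
          · rintro (h | rfl)
            · exact ⟨by omega, h.2⟩
            · exact ⟨by omega, hvk⟩
          · rintro ⟨h, h'⟩
            rcases Nat.lt_succ_iff_lt_or_eq.1 h with h | h
            · exact Or.inl ⟨h, h'⟩
            · exact Or.inr h
        · refine ⟨V, h1, fun j hj => ?_⟩
          rw [h2 j hj]
          constructor
          · exact fun h => ⟨by omega, h.2⟩
          · rintro ⟨h, h'⟩
            rcases Nat.lt_succ_iff_lt_or_eq.1 h with h | h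
            · exact ⟨h, h'⟩
            · exact absurd (h ▸ h') hvk
    obtain ⟨V, h1, h2⟩ := this N le_rfl
    obtain ⟨w, hw, a, ha, b, hb, c, hc, d, hd, e, he, hcl, h⟩ := hV V h1
    obtain ⟨w, rfl⟩ := nn_surj w
    obtain ⟨a, rfl⟩ := nn_surj a
    obtain ⟨b, rfl⟩ := nn_surj b
    obtain ⟨c, rfl⟩ := nn_surj c
    obtain ⟨d, rfl⟩ := nn_surj d
    obtain ⟨e, rfl⟩ := nn_surj e
    rw [Nat.cast_lt] at ha hb hc hd he
    rw [h2 a ha, h2 b hb, h2 c hc, h2 d hd, h2 e he] at h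
    simp only [Nat.cast_eq_zero] at h
    obtain ⟨q1, q2, q3, q4, q5⟩ := h
    rcases hv w a b c d e hcl (q1.imp_right And.right) (q2.imp_right And.right) (q3.imp_right And.right) with h | h
    · exact q4 ⟨h.1, hd, h.2⟩
    · exact q5 ⟨h.1, he, h.2⟩
  · intro hno
    by_contra hx
    push Not at hx
    have hV : ∀ N : ℕ, ∃ V : NN, ¬ Vio CL NN (N : NN) V (f : NN) (z : NN) := by
      intro N
      by_contra hc
      push Not at hc
      choose cd hcd using nn_set
      let B : ℕ := (Finset.range N).powerset.sup cd
      have hB : ∀ s : Finset ℕ, s ⊆ Finset.range N → ((cd s : ℕ) : NN) ≤ (B : NN) := fun s hs =>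
        Nat.cast_le (α := NN).2 (Finset.le_sup (f := cd) (Finset.mem_powerset.2 hs))
      refine hx (prN N B) ⟨N, by rw [cast_prN]; exact le_pr_left _ _, B, by rw [cast_prN]; exact le_pr_right _ _, cast_prN _ _, ⟨?_, ?_⟩, fun V _ => hc V⟩
      · intro V _ i hi
        obtain ⟨i, rfl⟩ := nn_surj i
        refine ⟨_, hB ((Finset.range N).filter fun j => El (j : NN) V ∨ j = i) (Finset.filter_subset _ _), ?_⟩
        intro j hj
        obtain ⟨j, rfl⟩ := nn_surj j
        rw [Nat.cast_lt] at hj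
        rw [hcd]
        simp [hj]
      · refine ⟨_, hB ∅ (by simp), fun j _ => ?_⟩
        obtain ⟨j, rfl⟩ := nn_surj j
        rw [hcd]
        simp
    choose V hV using hV
    apply hno
    let U : Ultrafilter ℕ := Filter.hyperfilter ℕ
    refine ⟨fun a => ∀ᶠ N in (U : Filter ℕ), El (a : NN) (V N), ?_⟩
    intro w a b c d e hcl ha hb hc
    by_contra hde
    have pos : ∀ a : ℕ, (a = 0 ∨ ∀ᶠ N in (U : Filter ℕ), El (a : NN) (V N)) → ∀ᶠ N in (U : Filter ℕ), ((a : NN) = 0 ∨ El (a : NN) (V N)) := by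
      rintro a (rfl | h)
      · simp
      · exact h.mono fun _ h => Or.inr h
    have neg : ∀ a : ℕ, ¬ (a ≠ 0 ∧ ∀ᶠ N in (U : Filter ℕ), El (a : NN) (V N)) → ∀ᶠ N in (U : Filter ℕ), ¬ (¬ (a : NN) = 0 ∧ El (a : NN) (V N)) := by
      intro a h
      by_cases ha : a = 0
      · subst ha; simp
      · have : ¬ ∀ᶠ N in (U : Filter ℕ), El (a : NN) (V N) := fun h' => h ⟨ha, h'⟩
        rw [← Ultrafilter.eventually_not] at this
        exact this.mono fun _ h h' => h h'.2
    rw [not_or] at hde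
    replace hde := And.intro (neg _ hde.1) (neg _ hde.2)
    replace ha := pos _ ha
    replace hb := pos _ hb
    replace hc := pos _ hc
    have hge : ∀ k : ℕ, ∀ᶠ N in (U : Filter ℕ), k < N := fun k =>
      (Filter.eventually_gt_atTop k).filter_mono (Nat.cofinite_eq_atTop ▸ Filter.hyperfilter_le_cofinite)
    obtain ⟨N, h⟩ := ((((ha.and (hb.and (hc.and (hde.1.and hde.2)))).and (hge (w + a + b + c + d + e))))).exists
    obtain ⟨⟨h1, h2, h3, h4, h5⟩, h6⟩ := h
    have q : ∀ k : ℕ, k < N → (k : NN) < (N : NN) := fun k hk => Nat.cast_lt (α := NN).2 hk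
    exact hV N ⟨w, q _ (by omega), a, q _ (by omega), b, q _ (by omega), c, q _ (by omega), d, q _ (by omega), e, q _ (by omega), hcl, h1, h2, h3, h4, h5⟩

set_option linter.unreachableTactic false
set_option linter.unusedTactic false

/-- tagged pairs -/
def cd (t x y : ℕ) : ℕ := prN t (prN x y) + 1
section
variable {M : Type} [PAM M]
def cM (t : ℕ) (x y : M) : M := pr (t : M) (pr x y) + 1
@[simp, norm_cast] theorem cast_cd (t x y : ℕ) : ((cd t x y : ℕ) : M) = cM t (x : M) (y : M) := by
  simp [cd, cM]
/-- graph of the pairing function of the library -/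
def NP (x y z : M) : Prop := (x < y ∧ z = y * y + x) ∨ (y ≤ x ∧ z = x * x + x + y)
end
instance {t : ℕ} {f g : TFam} [CT f] [CT g] : CT (fun M _ v => cM t (f M v) (g M v)) := by
  unfold cM; infer_instance
instance {f g h : TFam} [CT f] [CT g] [CT h] : CD0 (fun M _ v => NP (f M v) (g M v) (h M v)) := by
  unfold NP; infer_instance
@[norm_cast] theorem NP_cast (x y z : ℕ) : NP (x : NN) (y : NN) (z : NN) ↔ Nat.pair x y = z := by
  unfold NP Nat.pair
  rw [Nat.cast_lt, Nat.cast_le]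
  norm_cast
  split_ifs <;> omega

/-- all clauses, standard version -/
inductive KN (κ uu β f z : ℕ) : ℕ → ℕ → ℕ → ℕ → ℕ → Prop
  | fls (r : ℕ) : KN κ uu β f z (cd 2 (cd 0 0 0) r) 0 0 0 0
  | imp1 (p q r : ℕ) : KN κ uu β f z (cd 2 (cd 3 p q) r) (cd 2 p r) 0 (cd 2 q r) 0
  | imp2 (p q r : ℕ) : KN κ uu β f z (cd 2 q r) 0 0 (cd 2 (cd 3 p q) r) 0
  | imp3 (p q r : ℕ) : KN κ uu β f z 0 0 0 (cd 2 (cd 3 p q) r) (cd 2 p r)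
  | all1 (p r s : ℕ) : KN κ uu β f z (cd 2 (cd 4 p 0) r) 0 0 (cd 2 p (cd 0 s r)) 0
  | all2 (p r : ℕ) : KN κ uu β f z (cd 2 p (cd 0 (cd 1 p r) r)) 0 0 (cd 2 (cd 4 p 0) r) 0
  | eq1 (t u r : ℕ) : KN κ uu β f z (cd 2 (cd 1 t u) r) 0 0 (cd 3 (cd 0 t r) (cd 0 u r)) 0
  | eq2 (t u r : ℕ) : KN κ uu β f z (cd 3 (cd 0 t r) (cd 0 u r)) 0 0 (cd 2 (cd 1 t u) r) 0
  | le1 (t u r : ℕ) : KN κ uu β f z (cd 2 (cd 2 t u) r) 0 0 (cd 4 (cd 0 t r) (cd 0 u r)) 0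
  | le2 (t u r : ℕ) : KN κ uu β f z (cd 4 (cd 0 t r) (cd 0 u r)) 0 0 (cd 2 (cd 2 t u) r) 0
  | refl (s : ℕ) : KN κ uu β f z 0 0 0 (cd 3 s s) 0
  | eucl (s t u : ℕ) : KN κ uu β f z (cd 3 s t) (cd 3 s u) 0 (cd 3 t u) 0
  | congL (s t s1 t1 : ℕ) : KN κ uu β f z (cd 3 s s1) (cd 3 t t1) (cd 4 s t) (cd 4 s1 t1) 0
  | congS (s s1 : ℕ) : KN κ uu β f z (cd 3 s s1) 0 0 (cd 3 (cd 3 s 0) (cd 3 s1 0)) 0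
  | congA (s t s1 t1 : ℕ) : KN κ uu β f z (cd 3 s s1) (cd 3 t t1) 0 (cd 3 (cd 4 s t) (cd 4 s1 t1)) 0
  | congM (s t s1 t1 : ℕ) : KN κ uu β f z (cd 3 s s1) (cd 3 t t1) 0 (cd 3 (cd 5 s t) (cd 5 s1 t1)) 0
  | var0 (s r : ℕ) : KN κ uu β f z 0 0 0 (cd 3 (cd 0 (cd 0 0 0) (cd 0 s r)) s) 0
  | varS (j s r : ℕ) : KN κ uu β f z 0 0 0 (cd 3 (cd 0 (cd 0 (j+1) 0) (cd 0 s r)) (cd 0 (cd 0 j 0) r)) 0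
  | tz (r : ℕ) : KN κ uu β f z 0 0 0 (cd 3 (cd 0 (cd 1 0 0) r) (cd 2 0 0)) 0
  | ts (t r : ℕ) : KN κ uu β f z 0 0 0 (cd 3 (cd 0 (cd 2 t 0) r) (cd 3 (cd 0 t r) 0)) 0
  | ta (t u r : ℕ) : KN κ uu β f z 0 0 0 (cd 3 (cd 0 (cd 3 t u) r) (cd 4 (cd 0 t r) (cd 0 u r))) 0
  | tm (t u r : ℕ) : KN κ uu β f z 0 0 0 (cd 3 (cd 0 (cd 4 t u) r) (cd 5 (cd 0 t r) (cd 0 u r))) 0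
  | num0 : KN κ uu β f z 0 0 0 (cd 3 (cd 6 0 0) (cd 2 0 0)) 0
  | numS (j : ℕ) : KN κ uu β f z 0 0 0 (cd 3 (cd 6 (j+1) 0) (cd 3 (cd 6 j 0) 0)) 0
  | gv (i j l x : ℕ) (h0 : Nat.pair ((i+i+1)+(i+i+1)) l = x) : KN κ uu β f z 0 0 0 (cd 5 (cd 0 (i+j+1) (cd 0 j 0)) (cd 0 l (x+1))) 0
  | gz (m l x : ℕ) (h0 : Nat.pair 1 l = x) : KN κ uu β f z 0 0 0 (cd 5 (cd 0 m (cd 1 0 0)) (cd 0 l (x+1))) 0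
  | gs (m t l y x : ℕ) (h0 : Nat.pair 5 y = x) : KN κ uu β f z (cd 5 (cd 0 m t) (cd 0 l y)) 0 0 (cd 5 (cd 0 m (cd 2 t 0)) (cd 0 l (x+1))) 0
  | ga (m t u l y y1 x : ℕ) (h0 : Nat.pair 13 y1 = x) : KN κ uu β f z (cd 5 (cd 0 m u) (cd 0 l y)) (cd 5 (cd 0 m t) (cd 0 y y1)) 0 (cd 5 (cd 0 m (cd 3 t u)) (cd 0 l (x+1))) 0
  | gm (m t u l y y1 x : ℕ) (h0 : Nat.pair 15 y1 = x) : KN κ uu β f z (cd 5 (cd 0 m u) (cd 0 l y)) (cd 5 (cd 0 m t) (cd 0 y y1)) 0 (cd 5 (cd 0 m (cd 4 t u)) (cd 0 l (x+1))) 0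
  | gfls (m l x : ℕ) (h0 : Nat.pair (4*m+11) l = x) : KN κ uu β f z 0 0 0 (cd 6 (cd 0 m (cd 0 0 0)) (cd 0 l (x+1))) 0
  | geq (m t u l y y1 n n1 x1 x : ℕ) (h0 : Nat.pair m y = n) (h1 : Nat.pair m y1 = n1) (h2 : Nat.pair (n1+n1) l = x1) (h3 : Nat.pair (n+n) (x1+1) = x) : KN κ uu β f z (cd 5 (cd 0 m t) (cd 0 0 y)) (cd 5 (cd 0 m u) (cd 0 0 y1)) 0 (cd 6 (cd 0 m (cd 1 t u)) (cd 0 l (x+1))) 0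
  | gle (m t u l y y1 n n1 x1 x2 x3 x : ℕ) (h0 : Nat.pair m y = n) (h1 : Nat.pair m y1 = n1) (h2 : Nat.pair (n1+n1) l = x1) (h3 : Nat.pair (n+n) (x1+1) = x2) (h4 : Nat.pair (4*m+3) (x2+1) = x3) (h5 : Nat.pair 25 (x3+1) = x) : KN κ uu β f z (cd 5 (cd 0 m t) (cd 0 0 y)) (cd 5 (cd 0 m u) (cd 0 0 y1)) 0 (cd 6 (cd 0 m (cd 2 t u)) (cd 0 l (x+1))) 0
  | gimp (m p q l y y1 x : ℕ) (h0 : Nat.pair 3 y1 = x) : KN κ uu β f z (cd 6 (cd 0 m q) (cd 0 l y)) (cd 6 (cd 0 m p) (cd 0 y y1)) 0 (cd 6 (cd 0 m (cd 3 p q)) (cd 0 l (x+1))) 0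
  | gall (m p l y x : ℕ) (h0 : Nat.pair 7 y = x) : KN κ uu β f z (cd 6 (cd 0 (m+1) p) (cd 0 l y)) 0 0 (cd 6 (cd 0 m (cd 4 p 0)) (cd 0 l (x+1))) 0
  | cz (x : ℕ) : KN κ uu β f z 0 0 0 (cd 7 (cd 0 0 0) (cd 0 x 0)) 0
  | cs (x : ℕ) : KN κ uu β f z 0 0 0 (cd 7 (cd 1 0 0) (cd 0 x (x+1))) 0
  | cl (y y1 x : ℕ) (h0 : Nat.pair y y1 = x) : KN κ uu β f z 0 0 0 (cd 7 (cd 2 0 0) (cd 0 x y)) 0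
  | cr (y y1 x : ℕ) (h0 : Nat.pair y y1 = x) : KN κ uu β f z 0 0 0 (cd 7 (cd 3 0 0) (cd 0 x y1)) 0
  | cp (g g1 x y y1 n : ℕ) (h0 : Nat.pair y y1 = n) : KN κ uu β f z (cd 7 g (cd 0 x y)) (cd 7 g1 (cd 0 x y1)) 0 (cd 7 (cd 4 g g1) (cd 0 x n)) 0
  | cc (g g1 x y y1 : ℕ) : KN κ uu β f z (cd 7 g1 (cd 0 x y)) (cd 7 g (cd 0 y y1)) 0 (cd 7 (cd 5 g g1) (cd 0 x y1)) 0
  | cq0 (g g1 i x y : ℕ) (h0 : Nat.pair i 0 = x) : KN κ uu β f z (cd 7 g (cd 0 i y)) 0 0 (cd 7 (cd 6 g g1) (cd 0 x y)) 0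
  | cqS (g g1 i j x x1 y y1 n n1 : ℕ) (h0 : Nat.pair i j = x) (h1 : Nat.pair i (j+1) = x1) (h2 : Nat.pair j y = n) (h3 : Nat.pair i n = n1) : KN κ uu β f z (cd 7 (cd 6 g g1) (cd 0 x y)) (cd 7 g1 (cd 0 n1 y1)) 0 (cd 7 (cd 6 g g1) (cd 0 x1 y1)) 0
  | cf0 (g i j x : ℕ) (h0 : Nat.pair i j = x) : KN κ uu β f z (cd 7 g (cd 0 x 0)) 0 0 (cd 7 (cd 7 g 0) (cd 0 x j)) 0
  | cfS (g i j x x1 y y1 : ℕ) (h0 : Nat.pair i j = x) (h1 : Nat.pair i (j+1) = x1) : KN κ uu β f z (cd 7 g (cd 0 x (y+1))) (cd 7 (cd 7 g 0) (cd 0 x1 y1)) 0 (cd 7 (cd 7 g 0) (cd 0 x y1)) 0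
  | ax (p x : ℕ) : KN κ uu β f z (cd 6 (cd 0 0 p) (cd 0 0 x)) (cd 7 κ (cd 0 x 1)) 0 (cd 2 p 0) 0
  | af1 (h0 : β = 1) : KN κ uu β f z 0 0 0 (cd 2 f (cd 0 (cd 6 f 0) 0)) 0
  | af0 (h0 : β = 0) : KN κ uu β f z (cd 2 f (cd 0 (cd 6 f 0) 0)) 0 0 0 0
  | az1 (h0 : β = 1) : KN κ uu β f z 0 0 0 (cd 2 uu (cd 0 (cd 6 z 0) 0)) 0
  | az0 (h0 : β = 0) : KN κ uu β f z (cd 2 uu (cd 0 (cd 6 z 0) 0)) 0 0 0 0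

def k_fls (κ uu β : ℕ) (M : Type) [PAM M] (w a1 a2 a3 a4 a5 f z : M) : Prop :=
  ∃ r, r ≤ w ∧ a1 = (cM 2 (cM 0 0 0) r) ∧ a2 = 0 ∧ a3 = 0 ∧ a4 = 0 ∧ a5 = 0
def k_imp1 (κ uu β : ℕ) (M : Type) [PAM M] (w a1 a2 a3 a4 a5 f z : M) : Prop :=
  ∃ p, p ≤ w ∧ ∃ q, q ≤ w ∧ ∃ r, r ≤ w ∧ a1 = (cM 2 (cM 3 p q) r) ∧ a2 = (cM 2 p r) ∧ a3 = 0 ∧ a4 = (cM 2 q r) ∧ a5 = 0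
def k_imp2 (κ uu β : ℕ) (M : Type) [PAM M] (w a1 a2 a3 a4 a5 f z : M) : Prop :=
  ∃ p, p ≤ w ∧ ∃ q, q ≤ w ∧ ∃ r, r ≤ w ∧ a1 = (cM 2 q r) ∧ a2 = 0 ∧ a3 = 0 ∧ a4 = (cM 2 (cM 3 p q) r) ∧ a5 = 0
def k_imp3 (κ uu β : ℕ) (M : Type) [PAM M] (w a1 a2 a3 a4 a5 f z : M) : Prop :=
  ∃ p, p ≤ w ∧ ∃ q, q ≤ w ∧ ∃ r, r ≤ w ∧ a1 = 0 ∧ a2 = 0 ∧ a3 = 0 ∧ a4 = (cM 2 (cM 3 p q) r) ∧ a5 = (cM 2 p r)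
def k_all1 (κ uu β : ℕ) (M : Type) [PAM M] (w a1 a2 a3 a4 a5 f z : M) : Prop :=
  ∃ p, p ≤ w ∧ ∃ r, r ≤ w ∧ ∃ s, s ≤ w ∧ a1 = (cM 2 (cM 4 p 0) r) ∧ a2 = 0 ∧ a3 = 0 ∧ a4 = (cM 2 p (cM 0 s r)) ∧ a5 = 0
def k_all2 (κ uu β : ℕ) (M : Type) [PAM M] (w a1 a2 a3 a4 a5 f z : M) : Prop :=
  ∃ p, p ≤ w ∧ ∃ r, r ≤ w ∧ a1 = (cM 2 p (cM 0 (cM 1 p r) r)) ∧ a2 = 0 ∧ a3 = 0 ∧ a4 = (cM 2 (cM 4 p 0) r) ∧ a5 = 0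
def k_eq1 (κ uu β : ℕ) (M : Type) [PAM M] (w a1 a2 a3 a4 a5 f z : M) : Prop :=
  ∃ t, t ≤ w ∧ ∃ u, u ≤ w ∧ ∃ r, r ≤ w ∧ a1 = (cM 2 (cM 1 t u) r) ∧ a2 = 0 ∧ a3 = 0 ∧ a4 = (cM 3 (cM 0 t r) (cM 0 u r)) ∧ a5 = 0
def k_eq2 (κ uu β : ℕ) (M : Type) [PAM M] (w a1 a2 a3 a4 a5 f z : M) : Prop :=
  ∃ t, t ≤ w ∧ ∃ u, u ≤ w ∧ ∃ r, r ≤ w ∧ a1 = (cM 3 (cM 0 t r) (cM 0 u r)) ∧ a2 = 0 ∧ a3 = 0 ∧ a4 = (cM 2 (cM 1 t u) r) ∧ a5 = 0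
def k_le1 (κ uu β : ℕ) (M : Type) [PAM M] (w a1 a2 a3 a4 a5 f z : M) : Prop :=
  ∃ t, t ≤ w ∧ ∃ u, u ≤ w ∧ ∃ r, r ≤ w ∧ a1 = (cM 2 (cM 2 t u) r) ∧ a2 = 0 ∧ a3 = 0 ∧ a4 = (cM 4 (cM 0 t r) (cM 0 u r)) ∧ a5 = 0
def k_le2 (κ uu β : ℕ) (M : Type) [PAM M] (w a1 a2 a3 a4 a5 f z : M) : Prop :=
  ∃ t, t ≤ w ∧ ∃ u, u ≤ w ∧ ∃ r, r ≤ w ∧ a1 = (cM 4 (cM 0 t r) (cM 0 u r)) ∧ a2 = 0 ∧ a3 = 0 ∧ a4 = (cM 2 (cM 2 t u) r) ∧ a5 = 0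
def k_refl (κ uu β : ℕ) (M : Type) [PAM M] (w a1 a2 a3 a4 a5 f z : M) : Prop :=
  ∃ s, s ≤ w ∧ a1 = 0 ∧ a2 = 0 ∧ a3 = 0 ∧ a4 = (cM 3 s s) ∧ a5 = 0
def k_eucl (κ uu β : ℕ) (M : Type) [PAM M] (w a1 a2 a3 a4 a5 f z : M) : Prop :=
  ∃ s, s ≤ w ∧ ∃ t, t ≤ w ∧ ∃ u, u ≤ w ∧ a1 = (cM 3 s t) ∧ a2 = (cM 3 s u) ∧ a3 = 0 ∧ a4 = (cM 3 t u) ∧ a5 = 0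
def k_congL (κ uu β : ℕ) (M : Type) [PAM M] (w a1 a2 a3 a4 a5 f z : M) : Prop :=
  ∃ s, s ≤ w ∧ ∃ t, t ≤ w ∧ ∃ s1, s1 ≤ w ∧ ∃ t1, t1 ≤ w ∧ a1 = (cM 3 s s1) ∧ a2 = (cM 3 t t1) ∧ a3 = (cM 4 s t) ∧ a4 = (cM 4 s1 t1) ∧ a5 = 0
def k_congS (κ uu β : ℕ) (M : Type) [PAM M] (w a1 a2 a3 a4 a5 f z : M) : Prop :=
  ∃ s, s ≤ w ∧ ∃ s1, s1 ≤ w ∧ a1 = (cM 3 s s1) ∧ a2 = 0 ∧ a3 = 0 ∧ a4 = (cM 3 (cM 3 s 0) (cM 3 s1 0)) ∧ a5 = 0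
def k_congA (κ uu β : ℕ) (M : Type) [PAM M] (w a1 a2 a3 a4 a5 f z : M) : Prop :=
  ∃ s, s ≤ w ∧ ∃ t, t ≤ w ∧ ∃ s1, s1 ≤ w ∧ ∃ t1, t1 ≤ w ∧ a1 = (cM 3 s s1) ∧ a2 = (cM 3 t t1) ∧ a3 = 0 ∧ a4 = (cM 3 (cM 4 s t) (cM 4 s1 t1)) ∧ a5 = 0
def k_congM (κ uu β : ℕ) (M : Type) [PAM M] (w a1 a2 a3 a4 a5 f z : M) : Prop :=
  ∃ s, s ≤ w ∧ ∃ t, t ≤ w ∧ ∃ s1, s1 ≤ w ∧ ∃ t1, t1 ≤ w ∧ a1 = (cM 3 s s1) ∧ a2 = (cM 3 t t1) ∧ a3 = 0 ∧ a4 = (cM 3 (cM 5 s t) (cM 5 s1 t1)) ∧ a5 = 0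
def k_var0 (κ uu β : ℕ) (M : Type) [PAM M] (w a1 a2 a3 a4 a5 f z : M) : Prop :=
  ∃ s, s ≤ w ∧ ∃ r, r ≤ w ∧ a1 = 0 ∧ a2 = 0 ∧ a3 = 0 ∧ a4 = (cM 3 (cM 0 (cM 0 0 0) (cM 0 s r)) s) ∧ a5 = 0
def k_varS (κ uu β : ℕ) (M : Type) [PAM M] (w a1 a2 a3 a4 a5 f z : M) : Prop :=
  ∃ j, j ≤ w ∧ ∃ s, s ≤ w ∧ ∃ r, r ≤ w ∧ a1 = 0 ∧ a2 = 0 ∧ a3 = 0 ∧ a4 = (cM 3 (cM 0 (cM 0 (j+1) 0) (cM 0 s r)) (cM 0 (cM 0 j 0) r)) ∧ a5 = 0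
def k_tz (κ uu β : ℕ) (M : Type) [PAM M] (w a1 a2 a3 a4 a5 f z : M) : Prop :=
  ∃ r, r ≤ w ∧ a1 = 0 ∧ a2 = 0 ∧ a3 = 0 ∧ a4 = (cM 3 (cM 0 (cM 1 0 0) r) (cM 2 0 0)) ∧ a5 = 0
def k_ts (κ uu β : ℕ) (M : Type) [PAM M] (w a1 a2 a3 a4 a5 f z : M) : Prop :=
  ∃ t, t ≤ w ∧ ∃ r, r ≤ w ∧ a1 = 0 ∧ a2 = 0 ∧ a3 = 0 ∧ a4 = (cM 3 (cM 0 (cM 2 t 0) r) (cM 3 (cM 0 t r) 0)) ∧ a5 = 0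
def k_ta (κ uu β : ℕ) (M : Type) [PAM M] (w a1 a2 a3 a4 a5 f z : M) : Prop :=
  ∃ t, t ≤ w ∧ ∃ u, u ≤ w ∧ ∃ r, r ≤ w ∧ a1 = 0 ∧ a2 = 0 ∧ a3 = 0 ∧ a4 = (cM 3 (cM 0 (cM 3 t u) r) (cM 4 (cM 0 t r) (cM 0 u r))) ∧ a5 = 0
def k_tm (κ uu β : ℕ) (M : Type) [PAM M] (w a1 a2 a3 a4 a5 f z : M) : Prop :=
  ∃ t, t ≤ w ∧ ∃ u, u ≤ w ∧ ∃ r, r ≤ w ∧ a1 = 0 ∧ a2 = 0 ∧ a3 = 0 ∧ a4 = (cM 3 (cM 0 (cM 4 t u) r) (cM 5 (cM 0 t r) (cM 0 u r))) ∧ a5 = 0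
def k_num0 (κ uu β : ℕ) (M : Type) [PAM M] (w a1 a2 a3 a4 a5 f z : M) : Prop :=
  a1 = 0 ∧ a2 = 0 ∧ a3 = 0 ∧ a4 = (cM 3 (cM 6 0 0) (cM 2 0 0)) ∧ a5 = 0
def k_numS (κ uu β : ℕ) (M : Type) [PAM M] (w a1 a2 a3 a4 a5 f z : M) : Prop :=
  ∃ j, j ≤ w ∧ a1 = 0 ∧ a2 = 0 ∧ a3 = 0 ∧ a4 = (cM 3 (cM 6 (j+1) 0) (cM 3 (cM 6 j 0) 0)) ∧ a5 = 0
def k_gv (κ uu β : ℕ) (M : Type) [PAM M] (w a1 a2 a3 a4 a5 f z : M) : Prop :=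
  ∃ i, i ≤ w ∧ ∃ j, j ≤ w ∧ ∃ l, l ≤ w ∧ ∃ x, x ≤ w ∧ NP ((i+i+1)+(i+i+1)) l x ∧ a1 = 0 ∧ a2 = 0 ∧ a3 = 0 ∧ a4 = (cM 5 (cM 0 (i+j+1) (cM 0 j 0)) (cM 0 l (x+1))) ∧ a5 = 0
def k_gz (κ uu β : ℕ) (M : Type) [PAM M] (w a1 a2 a3 a4 a5 f z : M) : Prop :=
  ∃ m, m ≤ w ∧ ∃ l, l ≤ w ∧ ∃ x, x ≤ w ∧ NP ((1 : ℕ) : M) l x ∧ a1 = 0 ∧ a2 = 0 ∧ a3 = 0 ∧ a4 = (cM 5 (cM 0 m (cM 1 0 0)) (cM 0 l (x+1))) ∧ a5 = 0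
def k_gs (κ uu β : ℕ) (M : Type) [PAM M] (w a1 a2 a3 a4 a5 f z : M) : Prop :=
  ∃ m, m ≤ w ∧ ∃ t, t ≤ w ∧ ∃ l, l ≤ w ∧ ∃ y, y ≤ w ∧ ∃ x, x ≤ w ∧ NP ((5 : ℕ) : M) y x ∧ a1 = (cM 5 (cM 0 m t) (cM 0 l y)) ∧ a2 = 0 ∧ a3 = 0 ∧ a4 = (cM 5 (cM 0 m (cM 2 t 0)) (cM 0 l (x+1))) ∧ a5 = 0
def k_ga (κ uu β : ℕ) (M : Type) [PAM M] (w a1 a2 a3 a4 a5 f z : M) : Prop :=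
  ∃ m, m ≤ w ∧ ∃ t, t ≤ w ∧ ∃ u, u ≤ w ∧ ∃ l, l ≤ w ∧ ∃ y, y ≤ w ∧ ∃ y1, y1 ≤ w ∧ ∃ x, x ≤ w ∧ NP ((13 : ℕ) : M) y1 x ∧ a1 = (cM 5 (cM 0 m u) (cM 0 l y)) ∧ a2 = (cM 5 (cM 0 m t) (cM 0 y y1)) ∧ a3 = 0 ∧ a4 = (cM 5 (cM 0 m (cM 3 t u)) (cM 0 l (x+1))) ∧ a5 = 0
def k_gm (κ uu β : ℕ) (M : Type) [PAM M] (w a1 a2 a3 a4 a5 f z : M) : Prop :=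
  ∃ m, m ≤ w ∧ ∃ t, t ≤ w ∧ ∃ u, u ≤ w ∧ ∃ l, l ≤ w ∧ ∃ y, y ≤ w ∧ ∃ y1, y1 ≤ w ∧ ∃ x, x ≤ w ∧ NP ((15 : ℕ) : M) y1 x ∧ a1 = (cM 5 (cM 0 m u) (cM 0 l y)) ∧ a2 = (cM 5 (cM 0 m t) (cM 0 y y1)) ∧ a3 = 0 ∧ a4 = (cM 5 (cM 0 m (cM 4 t u)) (cM 0 l (x+1))) ∧ a5 = 0
def k_gfls (κ uu β : ℕ) (M : Type) [PAM M] (w a1 a2 a3 a4 a5 f z : M) : Prop :=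
  ∃ m, m ≤ w ∧ ∃ l, l ≤ w ∧ ∃ x, x ≤ w ∧ NP (((4 : ℕ) : M)*m+((11 : ℕ) : M)) l x ∧ a1 = 0 ∧ a2 = 0 ∧ a3 = 0 ∧ a4 = (cM 6 (cM 0 m (cM 0 0 0)) (cM 0 l (x+1))) ∧ a5 = 0
def k_geq (κ uu β : ℕ) (M : Type) [PAM M] (w a1 a2 a3 a4 a5 f z : M) : Prop :=
  ∃ m, m ≤ w ∧ ∃ t, t ≤ w ∧ ∃ u, u ≤ w ∧ ∃ l, l ≤ w ∧ ∃ y, y ≤ w ∧ ∃ y1, y1 ≤ w ∧ ∃ n, n ≤ w ∧ ∃ n1, n1 ≤ w ∧ ∃ x1, x1 ≤ w ∧ ∃ x, x ≤ w ∧ NP m y n ∧ NP m y1 n1 ∧ NP (n1+n1) l x1 ∧ NP (n+n) (x1+1) x ∧ a1 = (cM 5 (cM 0 m t) (cM 0 0 y)) ∧ a2 = (cM 5 (cM 0 m u) (cM 0 0 y1)) ∧ a3 = 0 ∧ a4 = (cM 6 (cM 0 m (cM 1 t u)) (cM 0 l (x+1))) ∧ a5 = 0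
def k_gle (κ uu β : ℕ) (M : Type) [PAM M] (w a1 a2 a3 a4 a5 f z : M) : Prop :=
  ∃ m, m ≤ w ∧ ∃ t, t ≤ w ∧ ∃ u, u ≤ w ∧ ∃ l, l ≤ w ∧ ∃ y, y ≤ w ∧ ∃ y1, y1 ≤ w ∧ ∃ n, n ≤ w ∧ ∃ n1, n1 ≤ w ∧ ∃ x1, x1 ≤ w ∧ ∃ x2, x2 ≤ w ∧ ∃ x3, x3 ≤ w ∧ ∃ x, x ≤ w ∧ NP m y n ∧ NP m y1 n1 ∧ NP (n1+n1) l x1 ∧ NP (n+n) (x1+1) x2 ∧ NP (((4 : ℕ) : M)*m+((3 : ℕ) : M)) (x2+1) x3 ∧ NP ((25 : ℕ) : M) (x3+1) x ∧ a1 = (cM 5 (cM 0 m t) (cM 0 0 y)) ∧ a2 = (cM 5 (cM 0 m u) (cM 0 0 y1)) ∧ a3 = 0 ∧ a4 = (cM 6 (cM 0 m (cM 2 t u)) (cM 0 l (x+1))) ∧ a5 = 0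
def k_gimp (κ uu β : ℕ) (M : Type) [PAM M] (w a1 a2 a3 a4 a5 f z : M) : Prop :=
  ∃ m, m ≤ w ∧ ∃ p, p ≤ w ∧ ∃ q, q ≤ w ∧ ∃ l, l ≤ w ∧ ∃ y, y ≤ w ∧ ∃ y1, y1 ≤ w ∧ ∃ x, x ≤ w ∧ NP ((3 : ℕ) : M) y1 x ∧ a1 = (cM 6 (cM 0 m q) (cM 0 l y)) ∧ a2 = (cM 6 (cM 0 m p) (cM 0 y y1)) ∧ a3 = 0 ∧ a4 = (cM 6 (cM 0 m (cM 3 p q)) (cM 0 l (x+1))) ∧ a5 = 0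
def k_gall (κ uu β : ℕ) (M : Type) [PAM M] (w a1 a2 a3 a4 a5 f z : M) : Prop :=
  ∃ m, m ≤ w ∧ ∃ p, p ≤ w ∧ ∃ l, l ≤ w ∧ ∃ y, y ≤ w ∧ ∃ x, x ≤ w ∧ NP ((7 : ℕ) : M) y x ∧ a1 = (cM 6 (cM 0 (m+1) p) (cM 0 l y)) ∧ a2 = 0 ∧ a3 = 0 ∧ a4 = (cM 6 (cM 0 m (cM 4 p 0)) (cM 0 l (x+1))) ∧ a5 = 0
def k_cz (κ uu β : ℕ) (M : Type) [PAM M] (w a1 a2 a3 a4 a5 f z : M) : Prop :=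
  ∃ x, x ≤ w ∧ a1 = 0 ∧ a2 = 0 ∧ a3 = 0 ∧ a4 = (cM 7 (cM 0 0 0) (cM 0 x 0)) ∧ a5 = 0
def k_cs (κ uu β : ℕ) (M : Type) [PAM M] (w a1 a2 a3 a4 a5 f z : M) : Prop :=
  ∃ x, x ≤ w ∧ a1 = 0 ∧ a2 = 0 ∧ a3 = 0 ∧ a4 = (cM 7 (cM 1 0 0) (cM 0 x (x+1))) ∧ a5 = 0
def k_cl (κ uu β : ℕ) (M : Type) [PAM M] (w a1 a2 a3 a4 a5 f z : M) : Prop :=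
  ∃ y, y ≤ w ∧ ∃ y1, y1 ≤ w ∧ ∃ x, x ≤ w ∧ NP y y1 x ∧ a1 = 0 ∧ a2 = 0 ∧ a3 = 0 ∧ a4 = (cM 7 (cM 2 0 0) (cM 0 x y)) ∧ a5 = 0
def k_cr (κ uu β : ℕ) (M : Type) [PAM M] (w a1 a2 a3 a4 a5 f z : M) : Prop :=
  ∃ y, y ≤ w ∧ ∃ y1, y1 ≤ w ∧ ∃ x, x ≤ w ∧ NP y y1 x ∧ a1 = 0 ∧ a2 = 0 ∧ a3 = 0 ∧ a4 = (cM 7 (cM 3 0 0) (cM 0 x y1)) ∧ a5 = 0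
def k_cp (κ uu β : ℕ) (M : Type) [PAM M] (w a1 a2 a3 a4 a5 f z : M) : Prop :=
  ∃ g, g ≤ w ∧ ∃ g1, g1 ≤ w ∧ ∃ x, x ≤ w ∧ ∃ y, y ≤ w ∧ ∃ y1, y1 ≤ w ∧ ∃ n, n ≤ w ∧ NP y y1 n ∧ a1 = (cM 7 g (cM 0 x y)) ∧ a2 = (cM 7 g1 (cM 0 x y1)) ∧ a3 = 0 ∧ a4 = (cM 7 (cM 4 g g1) (cM 0 x n)) ∧ a5 = 0
def k_cc (κ uu β : ℕ) (M : Type) [PAM M] (w a1 a2 a3 a4 a5 f z : M) : Prop :=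
  ∃ g, g ≤ w ∧ ∃ g1, g1 ≤ w ∧ ∃ x, x ≤ w ∧ ∃ y, y ≤ w ∧ ∃ y1, y1 ≤ w ∧ a1 = (cM 7 g1 (cM 0 x y)) ∧ a2 = (cM 7 g (cM 0 y y1)) ∧ a3 = 0 ∧ a4 = (cM 7 (cM 5 g g1) (cM 0 x y1)) ∧ a5 = 0
def k_cq0 (κ uu β : ℕ) (M : Type) [PAM M] (w a1 a2 a3 a4 a5 f z : M) : Prop :=
  ∃ g, g ≤ w ∧ ∃ g1, g1 ≤ w ∧ ∃ i, i ≤ w ∧ ∃ x, x ≤ w ∧ ∃ y, y ≤ w ∧ NP i 0 x ∧ a1 = (cM 7 g (cM 0 i y)) ∧ a2 = 0 ∧ a3 = 0 ∧ a4 = (cM 7 (cM 6 g g1) (cM 0 x y)) ∧ a5 = 0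
def k_cqS (κ uu β : ℕ) (M : Type) [PAM M] (w a1 a2 a3 a4 a5 f z : M) : Prop :=
  ∃ g, g ≤ w ∧ ∃ g1, g1 ≤ w ∧ ∃ i, i ≤ w ∧ ∃ j, j ≤ w ∧ ∃ x, x ≤ w ∧ ∃ x1, x1 ≤ w ∧ ∃ y, y ≤ w ∧ ∃ y1, y1 ≤ w ∧ ∃ n, n ≤ w ∧ ∃ n1, n1 ≤ w ∧ NP i j x ∧ NP i (j+1) x1 ∧ NP j y n ∧ NP i n n1 ∧ a1 = (cM 7 (cM 6 g g1) (cM 0 x y)) ∧ a2 = (cM 7 g1 (cM 0 n1 y1)) ∧ a3 = 0 ∧ a4 = (cM 7 (cM 6 g g1) (cM 0 x1 y1)) ∧ a5 = 0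
def k_cf0 (κ uu β : ℕ) (M : Type) [PAM M] (w a1 a2 a3 a4 a5 f z : M) : Prop :=
  ∃ g, g ≤ w ∧ ∃ i, i ≤ w ∧ ∃ j, j ≤ w ∧ ∃ x, x ≤ w ∧ NP i j x ∧ a1 = (cM 7 g (cM 0 x 0)) ∧ a2 = 0 ∧ a3 = 0 ∧ a4 = (cM 7 (cM 7 g 0) (cM 0 x j)) ∧ a5 = 0
def k_cfS (κ uu β : ℕ) (M : Type) [PAM M] (w a1 a2 a3 a4 a5 f z : M) : Prop :=
  ∃ g, g ≤ w ∧ ∃ i, i ≤ w ∧ ∃ j, j ≤ w ∧ ∃ x, x ≤ w ∧ ∃ x1, x1 ≤ w ∧ ∃ y, y ≤ w ∧ ∃ y1, y1 ≤ w ∧ NP i j x ∧ NP i (j+1) x1 ∧ a1 = (cM 7 g (cM 0 x (y+1))) ∧ a2 = (cM 7 (cM 7 g 0) (cM 0 x1 y1)) ∧ a3 = 0 ∧ a4 = (cM 7 (cM 7 g 0) (cM 0 x y1)) ∧ a5 = 0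
def k_ax (κ uu β : ℕ) (M : Type) [PAM M] (w a1 a2 a3 a4 a5 f z : M) : Prop :=
  ∃ p, p ≤ w ∧ ∃ x, x ≤ w ∧ a1 = (cM 6 (cM 0 0 p) (cM 0 0 x)) ∧ a2 = (cM 7 ((κ : ℕ) : M) (cM 0 x 1)) ∧ a3 = 0 ∧ a4 = (cM 2 p 0) ∧ a5 = 0
def k_af1 (κ uu β : ℕ) (M : Type) [PAM M] (w a1 a2 a3 a4 a5 f z : M) : Prop :=
  ((β : ℕ) : M) = 1 ∧ a1 = 0 ∧ a2 = 0 ∧ a3 = 0 ∧ a4 = (cM 2 f (cM 0 (cM 6 f 0) 0)) ∧ a5 = 0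
def k_af0 (κ uu β : ℕ) (M : Type) [PAM M] (w a1 a2 a3 a4 a5 f z : M) : Prop :=
  ((β : ℕ) : M) = 0 ∧ a1 = (cM 2 f (cM 0 (cM 6 f 0) 0)) ∧ a2 = 0 ∧ a3 = 0 ∧ a4 = 0 ∧ a5 = 0
def k_az1 (κ uu β : ℕ) (M : Type) [PAM M] (w a1 a2 a3 a4 a5 f z : M) : Prop :=
  ((β : ℕ) : M) = 1 ∧ a1 = 0 ∧ a2 = 0 ∧ a3 = 0 ∧ a4 = (cM 2 ((uu : ℕ) : M) (cM 0 (cM 6 z 0) 0)) ∧ a5 = 0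
def k_az0 (κ uu β : ℕ) (M : Type) [PAM M] (w a1 a2 a3 a4 a5 f z : M) : Prop :=
  ((β : ℕ) : M) = 0 ∧ a1 = (cM 2 ((uu : ℕ) : M) (cM 0 (cM 6 z 0) 0)) ∧ a2 = 0 ∧ a3 = 0 ∧ a4 = 0 ∧ a5 = 0
/-- read the arguments off a list -/
def lf (k : ∀ (M : Type) [PAM M], M → M → M → M → M → M → M → M → Prop) : Pred :=
  fun M _ v => k M (v.headD 0) (v.tail.headD 0) (v.tail.tail.headD 0) (v.tail.tail.tail.headD 0) (v.tail.tail.tail.tail.headD 0) (v.tail.tail.tail.tail.tail.headD 0) (v.tail.tail.tail.tail.tail.tail.headD 0) (v.tail.tail.tail.tail.tail.tail.tail.headD 0)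
set_option synthInstance.maxHeartbeats 400000
set_option synthInstance.maxSize 1000
section
variable (κ uu β : ℕ)
theorem d_fls : D0 (lf (k_fls κ uu β)) := by
  unfold lf k_fls; exact (inferInstance : CD0 _).out
theorem d_imp1 : D0 (lf (k_imp1 κ uu β)) := by
  unfold lf k_imp1; exact (inferInstance : CD0 _).out
theorem d_imp2 : D0 (lf (k_imp2 κ uu β)) := by
  unfold lf k_imp2; exact (inferInstance : CD0 _).out
theorem d_imp3 : D0 (lf (k_imp3 κ uu β)) := by
  unfold lf k_imp3; exact (inferInstance : CD0 _).out
theorem d_all1 : D0 (lf (k_all1 κ uu β)) := by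
  unfold lf k_all1; exact (inferInstance : CD0 _).out
theorem d_all2 : D0 (lf (k_all2 κ uu β)) := by
  unfold lf k_all2; exact (inferInstance : CD0 _).out
theorem d_eq1 : D0 (lf (k_eq1 κ uu β)) := by
  unfold lf k_eq1; exact (inferInstance : CD0 _).out
theorem d_eq2 : D0 (lf (k_eq2 κ uu β)) := by
  unfold lf k_eq2; exact (inferInstance : CD0 _).out
theorem d_le1 : D0 (lf (k_le1 κ uu β)) := by
  unfold lf k_le1; exact (inferInstance : CD0 _).out
theorem d_le2 : D0 (lf (k_le2 κ uu β)) := by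
  unfold lf k_le2; exact (inferInstance : CD0 _).out
theorem d_refl : D0 (lf (k_refl κ uu β)) := by
  unfold lf k_refl; exact (inferInstance : CD0 _).out
theorem d_eucl : D0 (lf (k_eucl κ uu β)) := by
  unfold lf k_eucl; exact (inferInstance : CD0 _).out
theorem d_congL : D0 (lf (k_congL κ uu β)) := by
  unfold lf k_congL; exact (inferInstance : CD0 _).out
theorem d_congS : D0 (lf (k_congS κ uu β)) := by
  unfold lf k_congS; exact (inferInstance : CD0 _).out
theorem d_congA : D0 (lf (k_congA κ uu β)) := by
  unfold lf k_congA; exact (inferInstance : CD0 _).out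
theorem d_congM : D0 (lf (k_congM κ uu β)) := by
  unfold lf k_congM; exact (inferInstance : CD0 _).out
theorem d_var0 : D0 (lf (k_var0 κ uu β)) := by
  unfold lf k_var0; exact (inferInstance : CD0 _).out
theorem d_varS : D0 (lf (k_varS κ uu β)) := by
  unfold lf k_varS; exact (inferInstance : CD0 _).out
theorem d_tz : D0 (lf (k_tz κ uu β)) := by
  unfold lf k_tz; exact (inferInstance : CD0 _).out
theorem d_ts : D0 (lf (k_ts κ uu β)) := by
  unfold lf k_ts; exact (inferInstance : CD0 _).out
theorem d_ta : D0 (lf (k_ta κ uu β)) := by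
  unfold lf k_ta; exact (inferInstance : CD0 _).out
theorem d_tm : D0 (lf (k_tm κ uu β)) := by
  unfold lf k_tm; exact (inferInstance : CD0 _).out
theorem d_num0 : D0 (lf (k_num0 κ uu β)) := by
  unfold lf k_num0; exact (inferInstance : CD0 _).out
theorem d_numS : D0 (lf (k_numS κ uu β)) := by
  unfold lf k_numS; exact (inferInstance : CD0 _).out
theorem d_gv : D0 (lf (k_gv κ uu β)) := by
  unfold lf k_gv; exact (inferInstance : CD0 _).out
theorem d_gz : D0 (lf (k_gz κ uu β)) := by
  unfold lf k_gz; exact (inferInstance : CD0 _).out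
theorem d_gs : D0 (lf (k_gs κ uu β)) := by
  unfold lf k_gs; exact (inferInstance : CD0 _).out
theorem d_ga : D0 (lf (k_ga κ uu β)) := by
  unfold lf k_ga; exact (inferInstance : CD0 _).out
theorem d_gm : D0 (lf (k_gm κ uu β)) := by
  unfold lf k_gm; exact (inferInstance : CD0 _).out
theorem d_gfls : D0 (lf (k_gfls κ uu β)) := by
  unfold lf k_gfls; exact (inferInstance : CD0 _).out
theorem d_geq : D0 (lf (k_geq κ uu β)) := by
  unfold lf k_geq; exact (inferInstance : CD0 _).out
theorem d_gle : D0 (lf (k_gle κ uu β)) := by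
  unfold lf k_gle; exact (inferInstance : CD0 _).out
theorem d_gimp : D0 (lf (k_gimp κ uu β)) := by
  unfold lf k_gimp; exact (inferInstance : CD0 _).out
theorem d_gall : D0 (lf (k_gall κ uu β)) := by
  unfold lf k_gall; exact (inferInstance : CD0 _).out
theorem d_cz : D0 (lf (k_cz κ uu β)) := by
  unfold lf k_cz; exact (inferInstance : CD0 _).out
theorem d_cs : D0 (lf (k_cs κ uu β)) := by
  unfold lf k_cs; exact (inferInstance : CD0 _).out
theorem d_cl : D0 (lf (k_cl κ uu β)) := by
  unfold lf k_cl; exact (inferInstance : CD0 _).out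
theorem d_cr : D0 (lf (k_cr κ uu β)) := by
  unfold lf k_cr; exact (inferInstance : CD0 _).out
theorem d_cp : D0 (lf (k_cp κ uu β)) := by
  unfold lf k_cp; exact (inferInstance : CD0 _).out
theorem d_cc : D0 (lf (k_cc κ uu β)) := by
  unfold lf k_cc; exact (inferInstance : CD0 _).out
theorem d_cq0 : D0 (lf (k_cq0 κ uu β)) := by
  unfold lf k_cq0; exact (inferInstance : CD0 _).out
theorem d_cqS : D0 (lf (k_cqS κ uu β)) := by
  unfold lf k_cqS; exact (inferInstance : CD0 _).out
theorem d_cf0 : D0 (lf (k_cf0 κ uu β)) := by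
  unfold lf k_cf0; exact (inferInstance : CD0 _).out
theorem d_cfS : D0 (lf (k_cfS κ uu β)) := by
  unfold lf k_cfS; exact (inferInstance : CD0 _).out
theorem d_ax : D0 (lf (k_ax κ uu β)) := by
  unfold lf k_ax; exact (inferInstance : CD0 _).out
theorem d_af1 : D0 (lf (k_af1 κ uu β)) := by
  unfold lf k_af1; exact (inferInstance : CD0 _).out
theorem d_af0 : D0 (lf (k_af0 κ uu β)) := by
  unfold lf k_af0; exact (inferInstance : CD0 _).out
theorem d_az1 : D0 (lf (k_az1 κ uu β)) := by
  unfold lf k_az1; exact (inferInstance : CD0 _).out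
theorem d_az0 : D0 (lf (k_az0 κ uu β)) := by
  unfold lf k_az0; exact (inferInstance : CD0 _).out
def KG0 (M : Type) [PAM M] (w a1 a2 a3 a4 a5 f z : M) : Prop :=
  k_fls κ uu β M w a1 a2 a3 a4 a5 f z ∨ k_imp1 κ uu β M w a1 a2 a3 a4 a5 f z ∨ k_imp2 κ uu β M w a1 a2 a3 a4 a5 f z ∨ k_imp3 κ uu β M w a1 a2 a3 a4 a5 f z ∨ k_all1 κ uu β M w a1 a2 a3 a4 a5 f z ∨ k_all2 κ uu β M w a1 a2 a3 a4 a5 f z ∨ k_eq1 κ uu β M w a1 a2 a3 a4 a5 f z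
theorem KG0_D0 : D0 (lf (KG0 κ uu β)) :=
  (d_fls κ uu β).or <| (d_imp1 κ uu β).or <| (d_imp2 κ uu β).or <| (d_imp3 κ uu β).or <| (d_all1 κ uu β).or <| (d_all2 κ uu β).or <| d_eq1 κ uu β
def KG1 (M : Type) [PAM M] (w a1 a2 a3 a4 a5 f z : M) : Prop :=
  k_eq2 κ uu β M w a1 a2 a3 a4 a5 f z ∨ k_le1 κ uu β M w a1 a2 a3 a4 a5 f z ∨ k_le2 κ uu β M w a1 a2 a3 a4 a5 f z ∨ k_refl κ uu β M w a1 a2 a3 a4 a5 f z ∨ k_eucl κ uu β M w a1 a2 a3 a4 a5 f z ∨ k_congL κ uu β M w a1 a2 a3 a4 a5 f z ∨ k_congS κ uu β M w a1 a2 a3 a4 a5 f z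
theorem KG1_D0 : D0 (lf (KG1 κ uu β)) :=
  (d_eq2 κ uu β).or <| (d_le1 κ uu β).or <| (d_le2 κ uu β).or <| (d_refl κ uu β).or <| (d_eucl κ uu β).or <| (d_congL κ uu β).or <| d_congS κ uu β
def KG2 (M : Type) [PAM M] (w a1 a2 a3 a4 a5 f z : M) : Prop :=
  k_congA κ uu β M w a1 a2 a3 a4 a5 f z ∨ k_congM κ uu β M w a1 a2 a3 a4 a5 f z ∨ k_var0 κ uu β M w a1 a2 a3 a4 a5 f z ∨ k_varS κ uu β M w a1 a2 a3 a4 a5 f z ∨ k_tz κ uu β M w a1 a2 a3 a4 a5 f z ∨ k_ts κ uu β M w a1 a2 a3 a4 a5 f z ∨ k_ta κ uu β M w a1 a2 a3 a4 a5 f z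
theorem KG2_D0 : D0 (lf (KG2 κ uu β)) :=
  (d_congA κ uu β).or <| (d_congM κ uu β).or <| (d_var0 κ uu β).or <| (d_varS κ uu β).or <| (d_tz κ uu β).or <| (d_ts κ uu β).or <| d_ta κ uu β
def KG3 (M : Type) [PAM M] (w a1 a2 a3 a4 a5 f z : M) : Prop :=
  k_tm κ uu β M w a1 a2 a3 a4 a5 f z ∨ k_num0 κ uu β M w a1 a2 a3 a4 a5 f z ∨ k_numS κ uu β M w a1 a2 a3 a4 a5 f z ∨ k_gv κ uu β M w a1 a2 a3 a4 a5 f z ∨ k_gz κ uu β M w a1 a2 a3 a4 a5 f z ∨ k_gs κ uu β M w a1 a2 a3 a4 a5 f z ∨ k_ga κ uu β M w a1 a2 a3 a4 a5 f z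
theorem KG3_D0 : D0 (lf (KG3 κ uu β)) :=
  (d_tm κ uu β).or <| (d_num0 κ uu β).or <| (d_numS κ uu β).or <| (d_gv κ uu β).or <| (d_gz κ uu β).or <| (d_gs κ uu β).or <| d_ga κ uu β
def KG4 (M : Type) [PAM M] (w a1 a2 a3 a4 a5 f z : M) : Prop :=
  k_gm κ uu β M w a1 a2 a3 a4 a5 f z ∨ k_gfls κ uu β M w a1 a2 a3 a4 a5 f z ∨ k_geq κ uu β M w a1 a2 a3 a4 a5 f z ∨ k_gle κ uu β M w a1 a2 a3 a4 a5 f z ∨ k_gimp κ uu β M w a1 a2 a3 a4 a5 f z ∨ k_gall κ uu β M w a1 a2 a3 a4 a5 f z ∨ k_cz κ uu β M w a1 a2 a3 a4 a5 f z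
theorem KG4_D0 : D0 (lf (KG4 κ uu β)) :=
  (d_gm κ uu β).or <| (d_gfls κ uu β).or <| (d_geq κ uu β).or <| (d_gle κ uu β).or <| (d_gimp κ uu β).or <| (d_gall κ uu β).or <| d_cz κ uu β
def KG5 (M : Type) [PAM M] (w a1 a2 a3 a4 a5 f z : M) : Prop :=
  k_cs κ uu β M w a1 a2 a3 a4 a5 f z ∨ k_cl κ uu β M w a1 a2 a3 a4 a5 f z ∨ k_cr κ uu β M w a1 a2 a3 a4 a5 f z ∨ k_cp κ uu β M w a1 a2 a3 a4 a5 f z ∨ k_cc κ uu β M w a1 a2 a3 a4 a5 f z ∨ k_cq0 κ uu β M w a1 a2 a3 a4 a5 f z ∨ k_cqS κ uu β M w a1 a2 a3 a4 a5 f z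
theorem KG5_D0 : D0 (lf (KG5 κ uu β)) :=
  (d_cs κ uu β).or <| (d_cl κ uu β).or <| (d_cr κ uu β).or <| (d_cp κ uu β).or <| (d_cc κ uu β).or <| (d_cq0 κ uu β).or <| d_cqS κ uu β
def KG6 (M : Type) [PAM M] (w a1 a2 a3 a4 a5 f z : M) : Prop :=
  k_cf0 κ uu β M w a1 a2 a3 a4 a5 f z ∨ k_cfS κ uu β M w a1 a2 a3 a4 a5 f z ∨ k_ax κ uu β M w a1 a2 a3 a4 a5 f z ∨ k_af1 κ uu β M w a1 a2 a3 a4 a5 f z ∨ k_af0 κ uu β M w a1 a2 a3 a4 a5 f z ∨ k_az1 κ uu β M w a1 a2 a3 a4 a5 f z ∨ k_az0 κ uu β M w a1 a2 a3 a4 a5 f z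
theorem KG6_D0 : D0 (lf (KG6 κ uu β)) :=
  (d_cf0 κ uu β).or <| (d_cfS κ uu β).or <| (d_ax κ uu β).or <| (d_af1 κ uu β).or <| (d_af0 κ uu β).or <| (d_az1 κ uu β).or <| d_az0 κ uu β
/-- all clauses -/
def KK (M : Type) [PAM M] (w a1 a2 a3 a4 a5 f z : M) : Prop :=
  KG0 κ uu β M w a1 a2 a3 a4 a5 f z ∨ KG1 κ uu β M w a1 a2 a3 a4 a5 f z ∨ KG2 κ uu β M w a1 a2 a3 a4 a5 f z ∨ KG3 κ uu β M w a1 a2 a3 a4 a5 f z ∨ KG4 κ uu β M w a1 a2 a3 a4 a5 f z ∨ KG5 κ uu β M w a1 a2 a3 a4 a5 f z ∨ KG6 κ uu β M w a1 a2 a3 a4 a5 f z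
def KP : Pred := lf (KK κ uu β)
theorem KP_D0 : D0 (KP κ uu β) :=
  (KG0_D0 κ uu β).or <| (KG1_D0 κ uu β).or <| (KG2_D0 κ uu β).or <| (KG3_D0 κ uu β).or <| (KG4_D0 κ uu β).or <| (KG5_D0 κ uu β).or <| KG6_D0 κ uu β
end
theorem KG0_to (κ uu β w a1 a2 a3 a4 a5 f z : ℕ) (h : KG0 κ uu β NN w a1 a2 a3 a4 a5 f z) :
    KN κ uu β f z a1 a2 a3 a4 a5 := by
  rcases h with h | h | h | h | h | h | h
  · simp only [k_fls, nn_exists] at h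
    norm_cast at h
    obtain ⟨r, -, rfl, rfl, rfl, rfl, rfl⟩ := h
    exact .fls r
  · simp only [k_imp1, nn_exists] at h
    norm_cast at h
    obtain ⟨p, -, q, -, r, -, rfl, rfl, rfl, rfl, rfl⟩ := h
    exact .imp1 p q r
  · simp only [k_imp2, nn_exists] at h
    norm_cast at h
    obtain ⟨p, -, q, -, r, -, rfl, rfl, rfl, rfl, rfl⟩ := h
    exact .imp2 p q r
  · simp only [k_imp3, nn_exists] at h
    norm_cast at h
    obtain ⟨p, -, q, -, r, -, rfl, rfl, rfl, rfl, rfl⟩ := h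
    exact .imp3 p q r
  · simp only [k_all1, nn_exists] at h
    norm_cast at h
    obtain ⟨p, -, r, -, s, -, rfl, rfl, rfl, rfl, rfl⟩ := h
    exact .all1 p r s
  · simp only [k_all2, nn_exists] at h
    norm_cast at h
    obtain ⟨p, -, r, -, rfl, rfl, rfl, rfl, rfl⟩ := h
    exact .all2 p r
  · simp only [k_eq1, nn_exists] at h
    norm_cast at h
    obtain ⟨t, -, u, -, r, -, rfl, rfl, rfl, rfl, rfl⟩ := h
    exact .eq1 t u r
theorem KG1_to (κ uu β w a1 a2 a3 a4 a5 f z : ℕ) (h : KG1 κ uu β NN w a1 a2 a3 a4 a5 f z) :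
    KN κ uu β f z a1 a2 a3 a4 a5 := by
  rcases h with h | h | h | h | h | h | h
  · simp only [k_eq2, nn_exists] at h
    norm_cast at h
    obtain ⟨t, -, u, -, r, -, rfl, rfl, rfl, rfl, rfl⟩ := h
    exact .eq2 t u r
  · simp only [k_le1, nn_exists] at h
    norm_cast at h
    obtain ⟨t, -, u, -, r, -, rfl, rfl, rfl, rfl, rfl⟩ := h
    exact .le1 t u r
  · simp only [k_le2, nn_exists] at h
    norm_cast at h
    obtain ⟨t, -, u, -, r, -, rfl, rfl, rfl, rfl, rfl⟩ := h
    exact .le2 t u r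
  · simp only [k_refl, nn_exists] at h
    norm_cast at h
    obtain ⟨s, -, rfl, rfl, rfl, rfl, rfl⟩ := h
    exact .refl s
  · simp only [k_eucl, nn_exists] at h
    norm_cast at h
    obtain ⟨s, -, t, -, u, -, rfl, rfl, rfl, rfl, rfl⟩ := h
    exact .eucl s t u
  · simp only [k_congL, nn_exists] at h
    norm_cast at h
    obtain ⟨s, -, t, -, s1, -, t1, -, rfl, rfl, rfl, rfl, rfl⟩ := h
    exact .congL s t s1 t1
  · simp only [k_congS, nn_exists] at h
    norm_cast at h
    obtain ⟨s, -, s1, -, rfl, rfl, rfl, rfl, rfl⟩ := h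
    exact .congS s s1
theorem KG2_to (κ uu β w a1 a2 a3 a4 a5 f z : ℕ) (h : KG2 κ uu β NN w a1 a2 a3 a4 a5 f z) :
    KN κ uu β f z a1 a2 a3 a4 a5 := by
  rcases h with h | h | h | h | h | h | h
  · simp only [k_congA, nn_exists] at h
    norm_cast at h
    obtain ⟨s, -, t, -, s1, -, t1, -, rfl, rfl, rfl, rfl, rfl⟩ := h
    exact .congA s t s1 t1
  · simp only [k_congM, nn_exists] at h
    norm_cast at h
    obtain ⟨s, -, t, -, s1, -, t1, -, rfl, rfl, rfl, rfl, rfl⟩ := h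
    exact .congM s t s1 t1
  · simp only [k_var0, nn_exists] at h
    norm_cast at h
    obtain ⟨s, -, r, -, rfl, rfl, rfl, rfl, rfl⟩ := h
    exact .var0 s r
  · simp only [k_varS, nn_exists] at h
    norm_cast at h
    obtain ⟨j, -, s, -, r, -, rfl, rfl, rfl, rfl, rfl⟩ := h
    exact .varS j s r
  · simp only [k_tz, nn_exists] at h
    norm_cast at h
    obtain ⟨r, -, rfl, rfl, rfl, rfl, rfl⟩ := h
    exact .tz r
  · simp only [k_ts, nn_exists] at h
    norm_cast at h
    obtain ⟨t, -, r, -, rfl, rfl, rfl, rfl, rfl⟩ := h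
    exact .ts t r
  · simp only [k_ta, nn_exists] at h
    norm_cast at h
    obtain ⟨t, -, u, -, r, -, rfl, rfl, rfl, rfl, rfl⟩ := h
    exact .ta t u r
theorem KG3_to (κ uu β w a1 a2 a3 a4 a5 f z : ℕ) (h : KG3 κ uu β NN w a1 a2 a3 a4 a5 f z) :
    KN κ uu β f z a1 a2 a3 a4 a5 := by
  rcases h with h | h | h | h | h | h | h
  · simp only [k_tm, nn_exists] at h
    norm_cast at h
    obtain ⟨t, -, u, -, r, -, rfl, rfl, rfl, rfl, rfl⟩ := h
    exact .tm t u r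
  · simp only [k_num0, nn_exists] at h
    norm_cast at h
    obtain ⟨rfl, rfl, rfl, rfl, rfl⟩ := h
    exact .num0
  · simp only [k_numS, nn_exists] at h
    norm_cast at h
    obtain ⟨j, -, rfl, rfl, rfl, rfl, rfl⟩ := h
    exact .numS j
  · simp only [k_gv, nn_exists] at h
    norm_cast at h
    obtain ⟨i, -, j, -, l, -, x, -, h0, rfl, rfl, rfl, rfl, rfl⟩ := h
    exact .gv i j l x h0
  · simp only [k_gz, nn_exists] at h
    norm_cast at h
    obtain ⟨m, -, l, -, x, -, h0, rfl, rfl, rfl, rfl, rfl⟩ := h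
    exact .gz m l x h0
  · simp only [k_gs, nn_exists] at h
    norm_cast at h
    obtain ⟨m, -, t, -, l, -, y, -, x, -, h0, rfl, rfl, rfl, rfl, rfl⟩ := h
    exact .gs m t l y x h0
  · simp only [k_ga, nn_exists] at h
    norm_cast at h
    obtain ⟨m, -, t, -, u, -, l, -, y, -, y1, -, x, -, h0, rfl, rfl, rfl, rfl, rfl⟩ := h
    exact .ga m t u l y y1 x h0
theorem KG4_to (κ uu β w a1 a2 a3 a4 a5 f z : ℕ) (h : KG4 κ uu β NN w a1 a2 a3 a4 a5 f z) :
    KN κ uu β f z a1 a2 a3 a4 a5 := by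
  rcases h with h | h | h | h | h | h | h
  · simp only [k_gm, nn_exists] at h
    norm_cast at h
    obtain ⟨m, -, t, -, u, -, l, -, y, -, y1, -, x, -, h0, rfl, rfl, rfl, rfl, rfl⟩ := h
    exact .gm m t u l y y1 x h0
  · simp only [k_gfls, nn_exists] at h
    norm_cast at h
    obtain ⟨m, -, l, -, x, -, h0, rfl, rfl, rfl, rfl, rfl⟩ := h
    exact .gfls m l x h0
  · simp only [k_geq, nn_exists] at h
    norm_cast at h
    obtain ⟨m, -, t, -, u, -, l, -, y, -, y1, -, n, -, n1, -, x1, -, x, -, h0, h1, h2, h3, rfl, rfl, rfl, rfl, rfl⟩ := h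
    exact .geq m t u l y y1 n n1 x1 x h0 h1 h2 h3
  · simp only [k_gle, nn_exists] at h
    norm_cast at h
    obtain ⟨m, -, t, -, u, -, l, -, y, -, y1, -, n, -, n1, -, x1, -, x2, -, x3, -, x, -, h0, h1, h2, h3, h4, h5, rfl, rfl, rfl, rfl, rfl⟩ := h
    exact .gle m t u l y y1 n n1 x1 x2 x3 x h0 h1 h2 h3 h4 h5
  · simp only [k_gimp, nn_exists] at h
    norm_cast at h
    obtain ⟨m, -, p, -, q, -, l, -, y, -, y1, -, x, -, h0, rfl, rfl, rfl, rfl, rfl⟩ := h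
    exact .gimp m p q l y y1 x h0
  · simp only [k_gall, nn_exists] at h
    norm_cast at h
    obtain ⟨m, -, p, -, l, -, y, -, x, -, h0, rfl, rfl, rfl, rfl, rfl⟩ := h
    exact .gall m p l y x h0
  · simp only [k_cz, nn_exists] at h
    norm_cast at h
    obtain ⟨x, -, rfl, rfl, rfl, rfl, rfl⟩ := h
    exact .cz x
theorem KG5_to (κ uu β w a1 a2 a3 a4 a5 f z : ℕ) (h : KG5 κ uu β NN w a1 a2 a3 a4 a5 f z) :
    KN κ uu β f z a1 a2 a3 a4 a5 := by
  rcases h with h | h | h | h | h | h | h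
  · simp only [k_cs, nn_exists] at h
    norm_cast at h
    obtain ⟨x, -, rfl, rfl, rfl, rfl, rfl⟩ := h
    exact .cs x
  · simp only [k_cl, nn_exists] at h
    norm_cast at h
    obtain ⟨y, -, y1, -, x, -, h0, rfl, rfl, rfl, rfl, rfl⟩ := h
    exact .cl y y1 x h0
  · simp only [k_cr, nn_exists] at h
    norm_cast at h
    obtain ⟨y, -, y1, -, x, -, h0, rfl, rfl, rfl, rfl, rfl⟩ := h
    exact .cr y y1 x h0
  · simp only [k_cp, nn_exists] at h
    norm_cast at h
    obtain ⟨g, -, g1, -, x, -, y, -, y1, -, n, -, h0, rfl, rfl, rfl, rfl, rfl⟩ := h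
    exact .cp g g1 x y y1 n h0
  · simp only [k_cc, nn_exists] at h
    norm_cast at h
    obtain ⟨g, -, g1, -, x, -, y, -, y1, -, rfl, rfl, rfl, rfl, rfl⟩ := h
    exact .cc g g1 x y y1
  · simp only [k_cq0, nn_exists] at h
    norm_cast at h
    obtain ⟨g, -, g1, -, i, -, x, -, y, -, h0, rfl, rfl, rfl, rfl, rfl⟩ := h
    exact .cq0 g g1 i x y h0
  · simp only [k_cqS, nn_exists] at h
    norm_cast at h
    obtain ⟨g, -, g1, -, i, -, j, -, x, -, x1, -, y, -, y1, -, n, -, n1, -, h0, h1, h2, h3, rfl, rfl, rfl, rfl, rfl⟩ := h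
    exact .cqS g g1 i j x x1 y y1 n n1 h0 h1 h2 h3
theorem KG6_to (κ uu β w a1 a2 a3 a4 a5 f z : ℕ) (h : KG6 κ uu β NN w a1 a2 a3 a4 a5 f z) :
    KN κ uu β f z a1 a2 a3 a4 a5 := by
  rcases h with h | h | h | h | h | h | h
  · simp only [k_cf0, nn_exists] at h
    norm_cast at h
    obtain ⟨g, -, i, -, j, -, x, -, h0, rfl, rfl, rfl, rfl, rfl⟩ := h
    exact .cf0 g i j x h0
  · simp only [k_cfS, nn_exists] at h
    norm_cast at h
    obtain ⟨g, -, i, -, j, -, x, -, x1, -, y, -, y1, -, h0, h1, rfl, rfl, rfl, rfl, rfl⟩ := h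
    exact .cfS g i j x x1 y y1 h0 h1
  · simp only [k_ax, nn_exists] at h
    norm_cast at h
    obtain ⟨p, -, x, -, rfl, rfl, rfl, rfl, rfl⟩ := h
    exact .ax p x
  · simp only [k_af1, nn_exists] at h
    norm_cast at h
    obtain ⟨h0, rfl, rfl, rfl, rfl, rfl⟩ := h
    exact .af1 h0
  · simp only [k_af0, nn_exists] at h
    norm_cast at h
    obtain ⟨h0, rfl, rfl, rfl, rfl, rfl⟩ := h
    exact .af0 h0
  · simp only [k_az1, nn_exists] at h
    norm_cast at h
    obtain ⟨h0, rfl, rfl, rfl, rfl, rfl⟩ := h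
    exact .az1 h0
  · simp only [k_az0, nn_exists] at h
    norm_cast at h
    obtain ⟨h0, rfl, rfl, rfl, rfl, rfl⟩ := h
    exact .az0 h0
theorem KN_to (κ uu β w a1 a2 a3 a4 a5 f z : ℕ) (h : KK κ uu β NN w a1 a2 a3 a4 a5 f z) :
    KN κ uu β f z a1 a2 a3 a4 a5 := by
  rcases h with h | h | h | h | h | h | h
  · exact KG0_to κ uu β w a1 a2 a3 a4 a5 f z h
  · exact KG1_to κ uu β w a1 a2 a3 a4 a5 f z h
  · exact KG2_to κ uu β w a1 a2 a3 a4 a5 f z h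
  · exact KG3_to κ uu β w a1 a2 a3 a4 a5 f z h
  · exact KG4_to κ uu β w a1 a2 a3 a4 a5 f z h
  · exact KG5_to κ uu β w a1 a2 a3 a4 a5 f z h
  · exact KG6_to κ uu β w a1 a2 a3 a4 a5 f z h
set_option maxHeartbeats 4000000 in
theorem KN_of (κ uu β a1 a2 a3 a4 a5 f z : ℕ) (h : KN κ uu β f z a1 a2 a3 a4 a5) :
    ∃ w : ℕ, KK κ uu β NN w a1 a2 a3 a4 a5 f z := by
  cases h
  case' fls r =>
    refine ⟨r, .inl <| .inl <| ⟨r, ?_, ?_, ?_, ?_, ?_, ?_⟩⟩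
  case' imp1 p q r =>
    refine ⟨p + q + r, .inl <| .inr <| .inl <| ⟨p, ?_, q, ?_, r, ?_, ?_, ?_, ?_, ?_, ?_⟩⟩
  case' imp2 p q r =>
    refine ⟨p + q + r, .inl <| .inr <| .inr <| .inl <| ⟨p, ?_, q, ?_, r, ?_, ?_, ?_, ?_, ?_, ?_⟩⟩
  case' imp3 p q r =>
    refine ⟨p + q + r, .inl <| .inr <| .inr <| .inr <| .inl <| ⟨p, ?_, q, ?_, r, ?_, ?_, ?_, ?_, ?_, ?_⟩⟩
  case' all1 p r s =>
    refine ⟨p + r + s, .inl <| .inr <| .inr <| .inr <| .inr <| .inl <| ⟨p, ?_, r, ?_, s, ?_, ?_, ?_, ?_, ?_, ?_⟩⟩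
  case' all2 p r =>
    refine ⟨p + r, .inl <| .inr <| .inr <| .inr <| .inr <| .inr <| .inl <| ⟨p, ?_, r, ?_, ?_, ?_, ?_, ?_, ?_⟩⟩
  case' eq1 t u r =>
    refine ⟨t + u + r, .inl <| .inr <| .inr <| .inr <| .inr <| .inr <| .inr <| ⟨t, ?_, u, ?_, r, ?_, ?_, ?_, ?_, ?_, ?_⟩⟩
  case' eq2 t u r =>
    refine ⟨t + u + r, .inr <| .inl <| .inl <| ⟨t, ?_, u, ?_, r, ?_, ?_, ?_, ?_, ?_, ?_⟩⟩
  case' le1 t u r =>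
    refine ⟨t + u + r, .inr <| .inl <| .inr <| .inl <| ⟨t, ?_, u, ?_, r, ?_, ?_, ?_, ?_, ?_, ?_⟩⟩
  case' le2 t u r =>
    refine ⟨t + u + r, .inr <| .inl <| .inr <| .inr <| .inl <| ⟨t, ?_, u, ?_, r, ?_, ?_, ?_, ?_, ?_, ?_⟩⟩
  case' refl s =>
    refine ⟨s, .inr <| .inl <| .inr <| .inr <| .inr <| .inl <| ⟨s, ?_, ?_, ?_, ?_, ?_, ?_⟩⟩
  case' eucl s t u =>
    refine ⟨s + t + u, .inr <| .inl <| .inr <| .inr <| .inr <| .inr <| .inl <| ⟨s, ?_, t, ?_, u, ?_, ?_, ?_, ?_, ?_, ?_⟩⟩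
  case' congL s t s1 t1 =>
    refine ⟨s + t + s1 + t1, .inr <| .inl <| .inr <| .inr <| .inr <| .inr <| .inr <| .inl <| ⟨s, ?_, t, ?_, s1, ?_, t1, ?_, ?_, ?_, ?_, ?_, ?_⟩⟩
  case' congS s s1 =>
    refine ⟨s + s1, .inr <| .inl <| .inr <| .inr <| .inr <| .inr <| .inr <| .inr <| ⟨s, ?_, s1, ?_, ?_, ?_, ?_, ?_, ?_⟩⟩
  case' congA s t s1 t1 =>
    refine ⟨s + t + s1 + t1, .inr <| .inr <| .inl <| .inl <| ⟨s, ?_, t, ?_, s1, ?_, t1, ?_, ?_, ?_, ?_, ?_, ?_⟩⟩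
  case' congM s t s1 t1 =>
    refine ⟨s + t + s1 + t1, .inr <| .inr <| .inl <| .inr <| .inl <| ⟨s, ?_, t, ?_, s1, ?_, t1, ?_, ?_, ?_, ?_, ?_, ?_⟩⟩
  case' var0 s r =>
    refine ⟨s + r, .inr <| .inr <| .inl <| .inr <| .inr <| .inl <| ⟨s, ?_, r, ?_, ?_, ?_, ?_, ?_, ?_⟩⟩
  case' varS j s r =>
    refine ⟨j + s + r, .inr <| .inr <| .inl <| .inr <| .inr <| .inr <| .inl <| ⟨j, ?_, s, ?_, r, ?_, ?_, ?_, ?_, ?_, ?_⟩⟩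
  case' tz r =>
    refine ⟨r, .inr <| .inr <| .inl <| .inr <| .inr <| .inr <| .inr <| .inl <| ⟨r, ?_, ?_, ?_, ?_, ?_, ?_⟩⟩
  case' ts t r =>
    refine ⟨t + r, .inr <| .inr <| .inl <| .inr <| .inr <| .inr <| .inr <| .inr <| .inl <| ⟨t, ?_, r, ?_, ?_, ?_, ?_, ?_, ?_⟩⟩
  case' ta t u r =>
    refine ⟨t + u + r, .inr <| .inr <| .inl <| .inr <| .inr <| .inr <| .inr <| .inr <| .inr <| ⟨t, ?_, u, ?_, r, ?_, ?_, ?_, ?_, ?_, ?_⟩⟩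
  case' tm t u r =>
    refine ⟨t + u + r, .inr <| .inr <| .inr <| .inl <| .inl <| ⟨t, ?_, u, ?_, r, ?_, ?_, ?_, ?_, ?_, ?_⟩⟩
  case' num0 =>
    refine ⟨0, .inr <| .inr <| .inr <| .inl <| .inr <| .inl <| ⟨?_, ?_, ?_, ?_, ?_⟩⟩
  case' numS j =>
    refine ⟨j, .inr <| .inr <| .inr <| .inl <| .inr <| .inr <| .inl <| ⟨j, ?_, ?_, ?_, ?_, ?_, ?_⟩⟩
  case' gv i j l x h0 =>
    refine ⟨i + j + l + x, .inr <| .inr <| .inr <| .inl <| .inr <| .inr <| .inr <| .inl <| ⟨i, ?_, j, ?_, l, ?_, x, ?_, ?_, ?_, ?_, ?_, ?_, ?_⟩⟩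
  case' gz m l x h0 =>
    refine ⟨m + l + x, .inr <| .inr <| .inr <| .inl <| .inr <| .inr <| .inr <| .inr <| .inl <| ⟨m, ?_, l, ?_, x, ?_, ?_, ?_, ?_, ?_, ?_, ?_⟩⟩
  case' gs m t l y x h0 =>
    refine ⟨m + t + l + y + x, .inr <| .inr <| .inr <| .inl <| .inr <| .inr <| .inr <| .inr <| .inr <| .inl <| ⟨m, ?_, t, ?_, l, ?_, y, ?_, x, ?_, ?_, ?_, ?_, ?_, ?_, ?_⟩⟩
  case' ga m t u l y y1 x h0 =>
    refine ⟨m + t + u + l + y + y1 + x, .inr <| .inr <| .inr <| .inl <| .inr <| .inr <| .inr <| .inr <| .inr <| .inr <| ⟨m, ?_, t, ?_, u, ?_, l, ?_, y, ?_, y1, ?_, x, ?_, ?_, ?_, ?_, ?_, ?_, ?_⟩⟩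
  case' gm m t u l y y1 x h0 =>
    refine ⟨m + t + u + l + y + y1 + x, .inr <| .inr <| .inr <| .inr <| .inl <| .inl <| ⟨m, ?_, t, ?_, u, ?_, l, ?_, y, ?_, y1, ?_, x, ?_, ?_, ?_, ?_, ?_, ?_, ?_⟩⟩
  case' gfls m l x h0 =>
    refine ⟨m + l + x, .inr <| .inr <| .inr <| .inr <| .inl <| .inr <| .inl <| ⟨m, ?_, l, ?_, x, ?_, ?_, ?_, ?_, ?_, ?_, ?_⟩⟩
  case' geq m t u l y y1 n n1 x1 x h0 h1 h2 h3 =>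
    refine ⟨m + t + u + l + y + y1 + n + n1 + x1 + x, .inr <| .inr <| .inr <| .inr <| .inl <| .inr <| .inr <| .inl <| ⟨m, ?_, t, ?_, u, ?_, l, ?_, y, ?_, y1, ?_, n, ?_, n1, ?_, x1, ?_, x, ?_, ?_, ?_, ?_, ?_, ?_, ?_, ?_, ?_, ?_⟩⟩
  case' gle m t u l y y1 n n1 x1 x2 x3 x h0 h1 h2 h3 h4 h5 =>
    refine ⟨m + t + u + l + y + y1 + n + n1 + x1 + x2 + x3 + x, .inr <| .inr <| .inr <| .inr <| .inl <| .inr <| .inr <| .inr <| .inl <| ⟨m, ?_, t, ?_, u, ?_, l, ?_, y, ?_, y1, ?_, n, ?_, n1, ?_, x1, ?_, x2, ?_, x3, ?_, x, ?_, ?_, ?_, ?_, ?_, ?_, ?_, ?_, ?_, ?_, ?_, ?_⟩⟩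
  case' gimp m p q l y y1 x h0 =>
    refine ⟨m + p + q + l + y + y1 + x, .inr <| .inr <| .inr <| .inr <| .inl <| .inr <| .inr <| .inr <| .inr <| .inl <| ⟨m, ?_, p, ?_, q, ?_, l, ?_, y, ?_, y1, ?_, x, ?_, ?_, ?_, ?_, ?_, ?_, ?_⟩⟩
  case' gall m p l y x h0 =>
    refine ⟨m + p + l + y + x, .inr <| .inr <| .inr <| .inr <| .inl <| .inr <| .inr <| .inr <| .inr <| .inr <| .inl <| ⟨m, ?_, p, ?_, l, ?_, y, ?_, x, ?_, ?_, ?_, ?_, ?_, ?_, ?_⟩⟩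
  case' cz x =>
    refine ⟨x, .inr <| .inr <| .inr <| .inr <| .inl <| .inr <| .inr <| .inr <| .inr <| .inr <| .inr <| ⟨x, ?_, ?_, ?_, ?_, ?_, ?_⟩⟩
  case' cs x =>
    refine ⟨x, .inr <| .inr <| .inr <| .inr <| .inr <| .inl <| .inl <| ⟨x, ?_, ?_, ?_, ?_, ?_, ?_⟩⟩
  case' cl y y1 x h0 =>
    refine ⟨y + y1 + x, .inr <| .inr <| .inr <| .inr <| .inr <| .inl <| .inr <| .inl <| ⟨y, ?_, y1, ?_, x, ?_, ?_, ?_, ?_, ?_, ?_, ?_⟩⟩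
  case' cr y y1 x h0 =>
    refine ⟨y + y1 + x, .inr <| .inr <| .inr <| .inr <| .inr <| .inl <| .inr <| .inr <| .inl <| ⟨y, ?_, y1, ?_, x, ?_, ?_, ?_, ?_, ?_, ?_, ?_⟩⟩
  case' cp g g1 x y y1 n h0 =>
    refine ⟨g + g1 + x + y + y1 + n, .inr <| .inr <| .inr <| .inr <| .inr <| .inl <| .inr <| .inr <| .inr <| .inl <| ⟨g, ?_, g1, ?_, x, ?_, y, ?_, y1, ?_, n, ?_, ?_, ?_, ?_, ?_, ?_, ?_⟩⟩
  case' cc g g1 x y y1 =>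
    refine ⟨g + g1 + x + y + y1, .inr <| .inr <| .inr <| .inr <| .inr <| .inl <| .inr <| .inr <| .inr <| .inr <| .inl <| ⟨g, ?_, g1, ?_, x, ?_, y, ?_, y1, ?_, ?_, ?_, ?_, ?_, ?_⟩⟩
  case' cq0 g g1 i x y h0 =>
    refine ⟨g + g1 + i + x + y, .inr <| .inr <| .inr <| .inr <| .inr <| .inl <| .inr <| .inr <| .inr <| .inr <| .inr <| .inl <| ⟨g, ?_, g1, ?_, i, ?_, x, ?_, y, ?_, ?_, ?_, ?_, ?_, ?_, ?_⟩⟩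
  case' cqS g g1 i j x x1 y y1 n n1 h0 h1 h2 h3 =>
    refine ⟨g + g1 + i + j + x + x1 + y + y1 + n + n1, .inr <| .inr <| .inr <| .inr <| .inr <| .inl <| .inr <| .inr <| .inr <| .inr <| .inr <| .inr <| ⟨g, ?_, g1, ?_, i, ?_, j, ?_, x, ?_, x1, ?_, y, ?_, y1, ?_, n, ?_, n1, ?_, ?_, ?_, ?_, ?_, ?_, ?_, ?_, ?_, ?_⟩⟩
  case' cf0 g i j x h0 =>
    refine ⟨g + i + j + x, .inr <| .inr <| .inr <| .inr <| .inr <| .inr <| .inl <| ⟨g, ?_, i, ?_, j, ?_, x, ?_, ?_, ?_, ?_, ?_, ?_, ?_⟩⟩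
  case' cfS g i j x x1 y y1 h0 h1 =>
    refine ⟨g + i + j + x + x1 + y + y1, .inr <| .inr <| .inr <| .inr <| .inr <| .inr <| .inr <| .inl <| ⟨g, ?_, i, ?_, j, ?_, x, ?_, x1, ?_, y, ?_, y1, ?_, ?_, ?_, ?_, ?_, ?_, ?_, ?_⟩⟩
  case' ax p x =>
    refine ⟨p + x, .inr <| .inr <| .inr <| .inr <| .inr <| .inr <| .inr <| .inr <| .inl <| ⟨p, ?_, x, ?_, ?_, ?_, ?_, ?_, ?_⟩⟩
  case' af1 h0 =>
    refine ⟨0, .inr <| .inr <| .inr <| .inr <| .inr <| .inr <| .inr <| .inr <| .inr <| .inl <| ⟨?_, ?_, ?_, ?_, ?_, ?_⟩⟩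
  case' af0 h0 =>
    refine ⟨0, .inr <| .inr <| .inr <| .inr <| .inr <| .inr <| .inr <| .inr <| .inr <| .inr <| .inl <| ⟨?_, ?_, ?_, ?_, ?_, ?_⟩⟩
  case' az1 h0 =>
    refine ⟨0, .inr <| .inr <| .inr <| .inr <| .inr <| .inr <| .inr <| .inr <| .inr <| .inr <| .inr <| .inl <| ⟨?_, ?_, ?_, ?_, ?_, ?_⟩⟩
  case' az0 h0 =>
    refine ⟨0, .inr <| .inr <| .inr <| .inr <| .inr <| .inr <| .inr <| .inr <| .inr <| .inr <| .inr <| .inr <| ⟨?_, ?_, ?_, ?_, ?_, ?_⟩⟩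
  all_goals first
    | exact Nat.cast_le.2 (by omega)
    | (norm_cast; done)
    | assumption_mod_cast

theorem Mdl_iff (κ uu β f z : ℕ) (v : ℕ → Prop) : Mdl (KP κ uu β) f z v ↔
    ∀ a b c d e : ℕ, KN κ uu β f z a b c d e →
      (a = 0 ∨ v a) → (b = 0 ∨ v b) → (c = 0 ∨ v c) → (d ≠ 0 ∧ v d) ∨ (e ≠ 0 ∧ v e) := by
  constructor
  · intro h a b c d e hk
    obtain ⟨w, hw⟩ := KN_of _ _ _ _ _ _ _ _ _ _ hk
    exact h w a b c d e hw
  · intro h w a b c d e hk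
    exact h a b c d e (KN_to _ _ _ _ _ _ _ _ _ _ _ hk)

theorem prN_inj {x y x' y' : ℕ} (h : prN x y = prN x' y') : x = x' ∧ y = y' := by
  unfold prN at h
  have : x + y = x' + y' := by
    rcases lt_trichotomy (x + y) (x' + y') with h1 | h1 | h1
    · nlinarith
    · exact h1
    · nlinarith
  rw [this] at h
  omega
@[simp] theorem cd_inj {t x y t' x' y' : ℕ} : cd t x y = cd t' x' y' ↔ t = t' ∧ x = x' ∧ y = y' := by
  constructor
  · intro h
    unfold cd at h
    obtain ⟨h1, h2⟩ := prN_inj (Nat.succ_injective h)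
    exact ⟨h1, prN_inj h2⟩
  · rintro ⟨rfl, rfl, rfl⟩; rfl
@[simp] theorem cd_ne_zero (t x y : ℕ) : cd t x y ≠ 0 := by simp [cd]
theorem cd_pos (t x y : ℕ) : 0 < cd t x y := by simp [cd]
theorem le_prN (x y : ℕ) : x ≤ prN x y ∧ y ≤ prN x y := by
  unfold prN
  constructor <;> nlinarith [Nat.zero_le x, Nat.zero_le y, Nat.le_mul_self (x + y)]
theorem lt_cd (t x y : ℕ) : x < cd t x y ∧ y < cd t x y := by
  have h1 := le_prN t (prN x y)
  have h2 := le_prN x y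
  unfold cd
  omega

/-- induction on formulas -/
theorem bf_ind {C : ∀ {m : ℕ}, BF m → Prop} (h0 : ∀ m, C (⊥ : BF m))
    (he : ∀ m (t u : Tm m), C (t =' u)) (hl : ∀ m (t u : Tm m), C (leF t u))
    (hi : ∀ m (φ ψ : BF m), C φ → C ψ → C (φ ⟹ ψ)) (ha : ∀ m (φ : BF (m + 1)), C φ → C (∀' φ))
    {m : ℕ} (φ : BF m) : C φ := by
  induction φ with
  | falsum => exact h0 _
  | equal t u => exact he _ t u
  | @rel m l R ts =>
    match l, R, ts with
    | 0, R, _ => exact R.elim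
    | 1, R, _ => exact R.elim
    | 2, R, ts =>
      have : (BoundedFormula.rel R ts : BF m) = leF (ts 0) (ts 1) := by
        unfold leF Relations.boundedFormula₂ Relations.boundedFormula
        congr 1
        funext i
        fin_cases i <;> rfl
      rw [this]
      exact hl _ _ _
    | (_ + 3), R, _ => exact R.elim
  | imp φ ψ h1 h2 => exact hi _ φ ψ h1 h2
  | all φ h => exact ha _ φ h

def tc {m : ℕ} : Tm m → ℕ
  | .var (.inl e) => e.elim
  | .var (.inr i) => cd 0 (m - 1 - i) 0
  | .func (l := 0) _ _ => cd 1 0 0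
  | .func (l := 1) _ ts => cd 2 (tc (ts 0)) 0
  | .func (l := 2) false ts => cd 3 (tc (ts 0)) (tc (ts 1))
  | .func (l := 2) true ts => cd 4 (tc (ts 0)) (tc (ts 1))
  | .func (l := _ + 3) f _ => f.elim
def fc : {m : ℕ} → BF m → ℕ
  | _, .falsum => cd 0 0 0
  | _, .equal t u => cd 1 (tc t) (tc u)
  | _, .rel (l := 0) R _ => R.elim
  | _, .rel (l := 1) R _ => R.elim
  | _, .rel (l := 2) _ ts => cd 2 (tc (ts 0)) (tc (ts 1))
  | _, .rel (l := _ + 3) R _ => R.elim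
  | _, .imp φ ψ => cd 3 (fc φ) (fc ψ)
  | _, .all φ => cd 4 (fc φ) 0
section
variable {m : ℕ}
@[simp] theorem tc_var (i : Fin m) : tc (vT i) = cd 0 (m - 1 - i) 0 := rfl
@[simp] theorem tc_zero : tc (zeroT : Tm m) = cd 1 0 0 := rfl
@[simp] theorem tc_succ (t : Tm m) : tc (succT t) = cd 2 (tc t) 0 := rfl
@[simp] theorem tc_add (t u : Tm m) : tc (addT t u) = cd 3 (tc t) (tc u) := rfl
@[simp] theorem tc_mul (t u : Tm m) : tc (mulT t u) = cd 4 (tc t) (tc u) := rfl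
@[simp] theorem fc_fls : fc (⊥ : BF m) = cd 0 0 0 := rfl
@[simp] theorem fc_eq (t u : Tm m) : fc (t =' u) = cd 1 (tc t) (tc u) := rfl
@[simp] theorem fc_le (t u : Tm m) : fc (leF t u) = cd 2 (tc t) (tc u) := rfl
@[simp] theorem fc_imp (φ ψ : BF m) : fc (φ ⟹ ψ) = cd 3 (fc φ) (fc ψ) := rfl
@[simp] theorem fc_all (φ : BF (m + 1)) : fc (∀' φ) = cd 4 (fc φ) 0 := rfl

def app {α : Type} [Encodable α] (l : List α) (y : ℕ) : ℕ := l.foldr (fun a y => Nat.pair (Encodable.encode a) y + 1) y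
theorem app_append {α : Type} [Encodable α] (l l' : List α) (y : ℕ) : app (l ++ l') y = app l (app l' y) := by
  simp [app]
theorem app_cons {α : Type} [Encodable α] (a : α) (l : List α) (y : ℕ) : app (a :: l) y = Nat.pair (Encodable.encode a) (app l y) + 1 := rfl
theorem app_nil {α : Type} [Encodable α] (y : ℕ) : app ([] : List α) y = y := rfl
theorem encode_app {α : Type} [Encodable α] (l : List α) : Encodable.encode l = app l 0 := by
  induction l with
  | nil => rfl
  | cons a l ih => rw [Encodable.encode_list_cons, ih]; rfl
def gT (t : Tm m) (l : ℕ) : ℕ := app t.listEncode l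
def gF (φ : BF m) (l : ℕ) : ℕ := app φ.listEncode l
theorem gT_var (i : Fin m) (l : ℕ) : gT (vT i) l = Nat.pair (((i : ℕ)+i+1)+(i+i+1)) l + 1 := by
  have : Encodable.encode (Sum.inl (Sum.inr i) : (Empty ⊕ Fin m) ⊕ (Σ i, LA.Functions i)) = ((i : ℕ)+i+1)+(i+i+1) := by
    have h : Encodable.encode i = (i : ℕ) := rfl
    simp [h]; omega
  rw [← this]; rfl
theorem gT_zero (l : ℕ) : gT (zeroT : Tm m) l = Nat.pair 1 l + 1 := rfl
theorem fr1 : List.finRange 1 = [0] := rfl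
theorem gT_succ (t : Tm m) (l : ℕ) : gT (succT t) l = Nat.pair 5 (gT t l) + 1 := by
  simp only [gT, succT, Functions.apply₁, Term.listEncode, fr1, List.flatMap_cons, List.flatMap_nil, List.append_nil, app_cons, app_append]; rfl
theorem fr2 : List.finRange 2 = [0, 1] := rfl
theorem gT_add (t u : Tm m) (l : ℕ) : gT (addT t u) l = Nat.pair 13 (gT t (gT u l)) + 1 := by
  simp only [gT, addT, Functions.apply₂, Term.listEncode, fr2, List.flatMap_cons, List.flatMap_nil, List.append_nil, app_cons, app_append]; rfl
theorem gT_mul (t u : Tm m) (l : ℕ) : gT (mulT t u) l = Nat.pair 15 (gT t (gT u l)) + 1 := by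
  simp only [gT, mulT, Functions.apply₂, Term.listEncode, fr2, List.flatMap_cons, List.flatMap_nil, List.append_nil, app_cons, app_append]; rfl
theorem gF_fls (l : ℕ) : gF (⊥ : BF m) l = Nat.pair (4 * m + 11) l + 1 := by
  have : Encodable.encode (Sum.inr (Sum.inr (m + 2)) : (Σ k, LA.Term (Empty ⊕ Fin k)) ⊕ ((Σ n, LA.Relations n) ⊕ ℕ)) = 4 * m + 11 := by
    simp; omega
  rw [← this]; rfl
theorem enc_tm (t : Tm m) : Encodable.encode (Sum.inl ⟨m, t⟩ : (Σ k, LA.Term (Empty ⊕ Fin k)) ⊕ ((Σ n, LA.Relations n) ⊕ ℕ)) =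
    Nat.pair m (gT t 0) + Nat.pair m (gT t 0) := by
  rw [Encodable.encode_inl, two_mul, Encodable.encode_sigma_val]
  have : Encodable.encode t = gT t 0 := encode_app t.listEncode
  rw [this]; rfl
theorem enc_m (m : ℕ) : Encodable.encode (Sum.inr (Sum.inr m) : (Σ k, LA.Term (Empty ⊕ Fin k)) ⊕ ((Σ n, LA.Relations n) ⊕ ℕ)) = 4 * m + 3 := by
  simp; omega
theorem gF_eq (t u : Tm m) (l : ℕ) : gF (t =' u) l =
    Nat.pair (Nat.pair m (gT t 0) + Nat.pair m (gT t 0)) (Nat.pair (Nat.pair m (gT u 0) + Nat.pair m (gT u 0)) l + 1) + 1 := by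
  rw [← enc_tm, ← enc_tm]; rfl
theorem gF_le (t u : Tm m) (l : ℕ) : gF (leF t u) l =
    Nat.pair 25 (Nat.pair (4 * m + 3) (Nat.pair (Nat.pair m (gT t 0) + Nat.pair m (gT t 0))
      (Nat.pair (Nat.pair m (gT u 0) + Nat.pair m (gT u 0)) l + 1) + 1) + 1) + 1 := by
  rw [← enc_tm, ← enc_tm, ← enc_m]; rfl
theorem gF_imp (φ ψ : BF m) (l : ℕ) : gF (φ ⟹ ψ) l = Nat.pair 3 (gF φ (gF ψ l)) + 1 := by
  have : gF (φ ⟹ ψ) l = app ((Sum.inr (Sum.inr 0) :: φ.listEncode) ++ ψ.listEncode) l := rfl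
  rw [this, app_append, app_cons, enc_m]; rfl
theorem gF_all (φ : BF (m + 1)) (l : ℕ) : gF (∀' φ) l = Nat.pair 7 (gF φ l) + 1 := by
  have : gF (∀' φ) l = app (Sum.inr (Sum.inr 1) :: φ.listEncode) l := rfl
  rw [this, app_cons, enc_m]; rfl
theorem gnum_eq (φ : Snt) : gnum φ = gF φ 0 := encode_app (BoundedFormula.listEncode φ)
theorem gnum_inj {φ ψ : Snt} (h : gnum φ = gnum ψ) : φ = ψ := by
  have h1 := BoundedFormula.encoding.encode_injective (Encodable.encode_injective h)
  simpa using h1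
end

open Nat.Partrec (Code) in
def cc : Code → ℕ
  | .zero => cd 0 0 0
  | .succ => cd 1 0 0
  | .left => cd 2 0 0
  | .right => cd 3 0 0
  | .pair f g => cd 4 (cc f) (cc g)
  | .comp f g => cd 5 (cc f) (cc g)
  | .prec f g => cd 6 (cc f) (cc g)
  | .rfind' f => cd 7 (cc f) 0

open Classical in
/-- decoding of tagged pairs -/
noncomputable def dec (n : ℕ) : ℕ × ℕ × ℕ :=
  if h : ∃ p : ℕ × ℕ × ℕ, cd p.1 p.2.1 p.2.2 = n then h.choose else (100, 0, 0)
noncomputable def dt (n : ℕ) : ℕ := (dec n).1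
noncomputable def dx (n : ℕ) : ℕ := (dec n).2.1
noncomputable def dy (n : ℕ) : ℕ := (dec n).2.2
theorem dec_cd (t x y : ℕ) : dec (cd t x y) = (t, x, y) := by
  have h : ∃ p : ℕ × ℕ × ℕ, cd p.1 p.2.1 p.2.2 = cd t x y := ⟨(t, x, y), rfl⟩
  have h2 := h.choose_spec
  rw [dec, dif_pos h]
  rw [cd_inj] at h2
  exact Prod.ext h2.1 (Prod.ext h2.2.1 h2.2.2)
@[simp] theorem dt_cd (t x y : ℕ) : dt (cd t x y) = t := by simp [dt, dec_cd]
@[simp] theorem dx_cd (t x y : ℕ) : dx (cd t x y) = x := by simp [dx, dec_cd]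
@[simp] theorem dy_cd (t x y : ℕ) : dy (cd t x y) = y := by simp [dy, dec_cd]
theorem dxy_lt (n : ℕ) (h : 0 < n) : dx n < n ∧ dy n < n := by
  by_cases h1 : ∃ p : ℕ × ℕ × ℕ, cd p.1 p.2.1 p.2.2 = n
  · obtain ⟨⟨t, x, y⟩, rfl⟩ := h1
    simpa using lt_cd t x y
  · rw [dx, dy, dec, dif_neg h1]
    exact ⟨h, h⟩

/-- decoding of programs -/
noncomputable def dcode (n : ℕ) : Nat.Partrec.Code :=
  if h : 0 < n then
    have h1 := dxy_lt n h
    match dt n with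
    | 0 => .zero
    | 1 => .succ
    | 2 => .left
    | 3 => .right
    | 4 => .pair (dcode (dx n)) (dcode (dy n))
    | 5 => .comp (dcode (dx n)) (dcode (dy n))
    | 6 => .prec (dcode (dx n)) (dcode (dy n))
    | 7 => .rfind' (dcode (dx n))
    | _ => .zero
  else .zero
termination_by n
decreasing_by all_goals omega
@[simp] theorem dcode_zero : dcode (cd 0 0 0) = .zero := by rw [dcode]; simp [cd_pos]
@[simp] theorem dcode_succ : dcode (cd 1 0 0) = .succ := by rw [dcode]; simp [cd_pos]
@[simp] theorem dcode_left : dcode (cd 2 0 0) = .left := by rw [dcode]; simp [cd_pos]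
@[simp] theorem dcode_right : dcode (cd 3 0 0) = .right := by rw [dcode]; simp [cd_pos]
@[simp] theorem dcode_pair (a b : ℕ) : dcode (cd 4 a b) = .pair (dcode a) (dcode b) := by rw [dcode]; simp [cd_pos]
@[simp] theorem dcode_comp (a b : ℕ) : dcode (cd 5 a b) = .comp (dcode a) (dcode b) := by rw [dcode]; simp [cd_pos]
@[simp] theorem dcode_prec (a b : ℕ) : dcode (cd 6 a b) = .prec (dcode a) (dcode b) := by rw [dcode]; simp [cd_pos]
@[simp] theorem dcode_rfind (a : ℕ) : dcode (cd 7 a 0) = .rfind' (dcode a) := by rw [dcode]; simp [cd_pos]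
theorem dcode_cc (c : Nat.Partrec.Code) : dcode (cc c) = c := by
  induction c <;> simp_all [cc]

section
variable {N : Type} [PAM N]
def consE (x : N) (ρ : ℕ → N) : ℕ → N
  | 0 => x
  | j + 1 => ρ j
/-- value of a term code -/
noncomputable def evt (ρ : ℕ → N) (n : ℕ) : N :=
  if h : 0 < n then
    have h1 := dxy_lt n h
    match dt n with
    | 0 => ρ (dx n)
    | 1 => 0
    | 2 => sucM (evt ρ (dx n))
    | 3 => evt ρ (dx n) + evt ρ (dy n)
    | 4 => evt ρ (dx n) * evt ρ (dy n)
    | _ => 0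
  else 0
termination_by n
decreasing_by all_goals omega
theorem evt_var (ρ : ℕ → N) (j : ℕ) : evt ρ (cd 0 j 0) = ρ j := by rw [evt]; simp [cd_pos]
theorem evt_zero (ρ : ℕ → N) : evt ρ (cd 1 0 0) = 0 := by rw [evt]; simp [cd_pos]
theorem evt_suc (ρ : ℕ → N) (t : ℕ) : evt ρ (cd 2 t 0) = sucM (evt ρ t) := by rw [evt]; simp [cd_pos]
theorem evt_add (ρ : ℕ → N) (t u : ℕ) : evt ρ (cd 3 t u) = evt ρ t + evt ρ u := by rw [evt]; simp [cd_pos]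
theorem evt_mul (ρ : ℕ → N) (t u : ℕ) : evt ρ (cd 4 t u) = evt ρ t * evt ρ u := by rw [evt]; simp [cd_pos]
/-- truth value of a formula code -/
noncomputable def sat (ρ : ℕ → N) (n : ℕ) : Prop :=
  if h : 0 < n then
    have h1 := dxy_lt n h
    match dt n with
    | 0 => False
    | 1 => evt ρ (dx n) = evt ρ (dy n)
    | 2 => leM (evt ρ (dx n)) (evt ρ (dy n))
    | 3 => sat ρ (dx n) → sat ρ (dy n)
    | 4 => ∀ x, sat (consE x ρ) (dx n)
    | _ => False
  else False
termination_by n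
decreasing_by all_goals omega
theorem sat_fls (ρ : ℕ → N) : sat ρ (cd 0 0 0) ↔ False := by rw [sat]; simp [cd_pos]
theorem sat_eq (ρ : ℕ → N) (t u : ℕ) : sat ρ (cd 1 t u) ↔ evt ρ t = evt ρ u := by rw [sat]; simp [cd_pos]
theorem sat_le (ρ : ℕ → N) (t u : ℕ) : sat ρ (cd 2 t u) ↔ leM (evt ρ t) (evt ρ u) := by rw [sat]; simp [cd_pos]
theorem sat_imp (ρ : ℕ → N) (p q : ℕ) : sat ρ (cd 3 p q) ↔ (sat ρ p → sat ρ q) := by rw [sat]; simp [cd_pos]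
theorem sat_all (ρ : ℕ → N) (p : ℕ) : sat ρ (cd 4 p 0) ↔ ∀ x, sat (consE x ρ) p := by rw [sat]; simp [cd_pos]

theorem evt_tc {m : ℕ} (ρ : ℕ → N) (v : Fin m → N) (h : ∀ i : Fin m, ρ (m - 1 - i) = v i) (t : Tm m) :
    evt ρ (tc t) = tv v t := by
  induction t using tm_ind with
  | hv i => simp [evt_var, h]
  | h0 => simp [evt_zero, zeroM_eq]
  | hs t ih => simp [evt_suc, ih]
  | ha t u h1 h2 => simp [evt_add, h1, h2, addM_eq]
  | hm t u h1 h2 => simp [evt_mul, h1, h2, mulM_eq]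
theorem sat_fc {m : ℕ} (φ : BF m) : ∀ (ρ : ℕ → N) (v : Fin m → N) (h : ∀ i : Fin m, ρ (m - 1 - i) = v i),
    (sat ρ (fc φ) ↔ fv v φ) := by
  induction φ using bf_ind with
  | h0 => intro ρ v h; simp [sat_fls]
  | he m t u => intro ρ v h; simp [sat_eq, evt_tc ρ v h]
  | hl m t u => intro ρ v h; simp [sat_le, evt_tc ρ v h]
  | hi m φ ψ h1 h2 => intro ρ v h; simp [sat_imp, h1 ρ v h, h2 ρ v h]
  | ha m φ ih =>
    intro ρ v h
    simp only [fc_all, sat_all, fv_all]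
    refine forall_congr' fun x => ih _ _ fun i => ?_
    refine Fin.lastCases ?_ (fun i => ?_) i
    · simp [consE]
    · have e : m + 1 - 1 - ((i.castSucc : Fin (m + 1)) : ℕ) = (m - 1 - i) + 1 := by
        have := i.2
        simp; omega
      rw [e, Fin.snoc_castSucc, ← h i]; rfl

open Classical in
/-- a counterexample -/
noncomputable def wit (a : ℕ) (ρ : ℕ → N) : N := if h : ∃ x, ¬ sat (consE x ρ) a then h.choose else 0
theorem wit_spec (a : ℕ) (ρ : ℕ → N) (h : sat (consE (wit a ρ) ρ) a) (x : N) : sat (consE x ρ) a := by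
  by_contra hx
  have h1 : ∃ x, ¬ sat (consE x ρ) a := ⟨x, hx⟩
  rw [wit, dif_pos h1] at h
  exact h1.choose_spec h
/-- values of names and environments -/
noncomputable def nmE (n : ℕ) : N × (ℕ → N) :=
  if h : 0 < n then
    have h1 := dxy_lt n h
    (match dt n with
    | 0 => evt (nmE (dy n)).2 (dx n)
    | 1 => wit (dx n) (nmE (dy n)).2
    | 2 => 0
    | 3 => sucM (nmE (dx n)).1
    | 4 => (nmE (dx n)).1 + (nmE (dy n)).1
    | 5 => (nmE (dx n)).1 * (nmE (dy n)).1
    | 6 => (dx n : N)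
    | _ => 0, consE (nmE (dx n)).1 (nmE (dy n)).2)
  else (0, fun _ => 0)
termination_by n
decreasing_by all_goals omega
noncomputable def nm (n : ℕ) : N := (nmE n).1
noncomputable def en (n : ℕ) : ℕ → N := (nmE n).2
@[simp] theorem en_cons (t s r : ℕ) : en (N := N) (cd t s r) = consE (nm s) (en r) := by
  rw [en, nmE]; simp [cd_pos, nm, en]
@[simp] theorem nm_T (t r : ℕ) : nm (N := N) (cd 0 t r) = evt (en r) t := by rw [nm, nmE]; simp [cd_pos, nm, en]
@[simp] theorem nm_H (t r : ℕ) : nm (N := N) (cd 1 t r) = wit t (en r) := by rw [nm, nmE]; simp [cd_pos, nm, en]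
@[simp] theorem nm_Z : nm (N := N) (cd 2 0 0) = 0 := by rw [nm, nmE]; simp [cd_pos, nm, en]
@[simp] theorem nm_S (s : ℕ) : nm (N := N) (cd 3 s 0) = sucM (nm s) := by rw [nm, nmE]; simp [cd_pos, nm, en]
@[simp] theorem nm_A (s t : ℕ) : nm (N := N) (cd 4 s t) = nm s + nm t := by rw [nm, nmE]; simp [cd_pos, nm, en]
@[simp] theorem nm_M (s t : ℕ) : nm (N := N) (cd 5 s t) = nm s * nm t := by rw [nm, nmE]; simp [cd_pos, nm, en]
@[simp] theorem nm_Num (k : ℕ) : nm (N := N) (cd 6 k 0) = (k : N) := by rw [nm, nmE]; simp [cd_pos, nm, en]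

/-- the valuation given by a model -/
def vv (N : Type) [PAM N] (n : ℕ) : Prop :=
  match dt n with
  | 2 => sat (en (dy n) : ℕ → N) (dx n)
  | 3 => (nm (dx n) : N) = nm (dy n)
  | 4 => leM (nm (dx n) : N) (nm (dy n))
  | 5 => ∃ t : Tm (dx (dx n)), tc t = dy (dx n) ∧ dy (dy n) = gT t (dx (dy n))
  | 6 => ∃ φ : BF (dx (dx n)), fc φ = dy (dx n) ∧ dy (dy n) = gF φ (dx (dy n))
  | 7 => dy (dy n) ∈ (dcode (dx n)).eval (dx (dy n))
  | _ => False
@[simp] theorem vv_F (a r : ℕ) : vv N (cd 2 a r) ↔ sat (en r : ℕ → N) a := by simp [vv]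
@[simp] theorem vv_E (s t : ℕ) : vv N (cd 3 s t) ↔ (nm s : N) = nm t := by simp [vv]
@[simp] theorem vv_L (s t : ℕ) : vv N (cd 4 s t) ↔ leM (nm s : N) (nm t) := by simp [vv]
@[simp] theorem vv_GT (k m c l x : ℕ) : vv N (cd 5 (cd k m c) (cd k l x)) ↔ ∃ t : Tm m, tc t = c ∧ x = gT t l := by
  simp only [vv, dt_cd]
  rw [dx_cd, dx_cd, dy_cd, dy_cd, dy_cd, dx_cd]
@[simp] theorem vv_GF (k m c l x : ℕ) : vv N (cd 6 (cd k m c) (cd k l x)) ↔ ∃ φ : BF m, fc φ = c ∧ x = gF φ l := by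
  simp only [vv, dt_cd]
  rw [dx_cd, dx_cd, dy_cd, dy_cd, dy_cd, dx_cd]
@[simp] theorem vv_C (k x y c : ℕ) : vv N (cd 7 c (cd k x y)) ↔ y ∈ (dcode c).eval x := by
  simp [vv]
end

theorem mem_ev_pair (f g : Nat.Partrec.Code) (x n : ℕ) :
    n ∈ (Nat.Partrec.Code.pair f g).eval x ↔ ∃ a ∈ f.eval x, ∃ b ∈ g.eval x, Nat.pair a b = n := by
  have e : (Nat.Partrec.Code.pair f g).eval x = (Nat.pair <$> f.eval x <*> g.eval x) := rfl
  rw [e]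
  simp only [Seq.seq, Part.map_eq_map, Part.bind_eq_bind, Part.mem_bind_iff, Part.mem_map_iff]
  constructor
  · rintro ⟨_, ⟨a, ha, rfl⟩, b, hb, rfl⟩
    exact ⟨a, ha, b, hb, rfl⟩
  · rintro ⟨a, ha, b, hb, rfl⟩
    exact ⟨_, ⟨a, ha, rfl⟩, b, hb, rfl⟩
theorem mem_ev_rfind (c : Nat.Partrec.Code) (i j y : ℕ) :
    y ∈ (Nat.Partrec.Code.rfind' c).eval (Nat.pair i j) ↔
      ∃ k, y = k + j ∧ 0 ∈ c.eval (Nat.pair i (k + j)) ∧ ∀ l, l < k → ∃ x, x + 1 ∈ c.eval (Nat.pair i (l + j)) := by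
  have e : (Nat.Partrec.Code.rfind' c).eval (Nat.pair i j) =
      (Nat.rfind (fun n => Part.map (fun m => decide (m = 0)) (c.eval (Nat.pair i (n + j))) : ℕ →. Bool)).map (· + j) := by
    rw [Nat.Partrec.Code.eval, Nat.unpaired, Nat.unpair_pair]
    rfl
  have h1 : ∀ n, true ∈ (fun n => Part.map (fun m => decide (m = 0)) (c.eval (Nat.pair i (n + j))) : ℕ →. Bool) n ↔
      0 ∈ c.eval (Nat.pair i (n + j)) := by
    intro n
    refine (Part.mem_map_iff _).trans ⟨?_, ?_⟩
    · rintro ⟨a, ha, h⟩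
      rw [decide_eq_true_eq] at h
      rwa [h] at ha
    · intro h
      exact ⟨0, h, rfl⟩
  have h2 : ∀ n, false ∈ (fun n => Part.map (fun m => decide (m = 0)) (c.eval (Nat.pair i (n + j))) : ℕ →. Bool) n ↔
      ∃ x, x + 1 ∈ c.eval (Nat.pair i (n + j)) := by
    intro n
    refine (Part.mem_map_iff _).trans ⟨?_, ?_⟩
    · rintro ⟨a, ha, h⟩
      rw [decide_eq_false_iff_not] at h
      obtain ⟨x, rfl⟩ := Nat.exists_eq_succ_of_ne_zero h
      exact ⟨x, ha⟩
    · rintro ⟨x, h⟩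
      exact ⟨x + 1, h, by simp⟩
  rw [e, Part.mem_map_iff]
  refine exists_congr fun k => ?_
  rw [eq_comm (a := y), and_comm]
  refine and_congr_right fun _ => ?_
  refine (Nat.mem_rfind (p := (fun n => Part.map (fun m => decide (m = 0)) (c.eval (Nat.pair i (n + j))) : ℕ →. Bool))).trans ?_
  exact and_congr (h1 k) (forall_congr' fun l => imp_congr_right fun _ => h2 l)

set_option maxHeartbeats 1000000 in
theorem soundness (N : Type) [PAM N] (κc : Nat.Partrec.Code) (T : Thy)
    (hκ : ∀ x, 1 ∈ κc.eval x → ∃ φ ∈ T, gnum φ = x) (hN : ∀ φ ∈ T, N ⊨ φ) (F uF : BF 1) (β z : ℕ)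
    (hb1 : β = 1 → fv (fun _ => ((fc F : ℕ) : N)) F ∧ fv (fun _ => (z : N)) uF)
    (hb0 : β = 0 → ¬ fv (fun _ => ((fc F : ℕ) : N)) F ∧ ¬ fv (fun _ => (z : N)) uF) :
    Mdl (KP (cc κc) (fc uF) β) (fc F) z (vv N) := by
  rw [Mdl_iff]
  have hs : ∀ (G : BF 1) (k : ℕ), sat (en (cd 0 (cd 6 k 0) 0) : ℕ → N) (fc G) ↔ fv (fun _ => (k : N)) G := by
    intro G k
    refine sat_fc G _ _ fun i => ?_
    have := Fin.fin_one_eq_zero i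
    subst this
    simp [consE]
  intro a b c d e h
  cases h <;> simp only [vv_F, vv_E, vv_L, vv_GT, vv_GF, vv_C, cd_ne_zero, ne_eq, not_false_eq_true, true_and,
    not_true_eq_false, false_and, false_or, or_false, true_or, forall_const, nm_T, nm_H, nm_Z, nm_S, nm_A, nm_M, nm_Num,
    evt_var, evt_zero, evt_suc, evt_add, evt_mul, sat_fls, sat_eq, sat_le, sat_imp, sat_all, hs, dcode_zero, dcode_succ, dcode_left, dcode_right,
    dcode_pair, dcode_comp, dcode_prec, dcode_rfind, imp_self, en_cons, consE]
  case imp2 => tauto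
  case imp3 => tauto
  case all1 p r s => intro h; exact h _
  case all2 p r => intro h x; exact wit_spec _ _ h x
  case eucl => intro h1 h2; rw [← h1, h2]
  case congL => intro h1 h2; rw [h1, h2]; exact id
  case congS => intro h1; rw [h1]
  case congA => intro h1 h2; rw [h1, h2]
  case congM => intro h1 h2; rw [h1, h2]
  case num0 => simp
  case numS => simp [p_suc_eq]
  case gv i j l x h0 =>
    refine ⟨vT ⟨i, by omega⟩, ?_, ?_⟩
    · simp
    · rw [gT_var, h0]
  case gz m l x h0 => exact ⟨zeroT, rfl, by rw [gT_zero, h0]⟩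
  case gs m t l y x h0 =>
    rintro ⟨t, rfl, rfl⟩
    exact ⟨succT t, rfl, by rw [gT_succ, h0]⟩
  case ga m t u l y y1 x h0 =>
    rintro ⟨u, rfl, rfl⟩ ⟨t, rfl, rfl⟩
    exact ⟨addT t u, rfl, by rw [gT_add, h0]⟩
  case gm m t u l y y1 x h0 =>
    rintro ⟨u, rfl, rfl⟩ ⟨t, rfl, rfl⟩
    exact ⟨mulT t u, rfl, by rw [gT_mul, h0]⟩
  case gfls m l x h0 => exact ⟨⊥, rfl, by rw [gF_fls, h0]⟩
  case geq m t u l y y1 n n1 x1 x h0 h1 h2 h3 =>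
    rintro ⟨t, rfl, rfl⟩ ⟨u, rfl, rfl⟩
    exact ⟨t =' u, rfl, by rw [gF_eq, h0, h1, h2, h3]⟩
  case gle m t u l y y1 n n1 x1 x2 x3 x h0 h1 h2 h3 h4 h5 =>
    rintro ⟨t, rfl, rfl⟩ ⟨u, rfl, rfl⟩
    exact ⟨leF t u, rfl, by rw [gF_le, h0, h1, h2, h3, h4, h5]⟩
  case gimp m p q l y y1 x h0 =>
    rintro ⟨u, rfl, rfl⟩ ⟨t, rfl, rfl⟩
    exact ⟨t ⟹ u, rfl, by rw [gF_imp, h0]⟩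
  case gall m p l y x h0 =>
    rintro ⟨t, rfl, rfl⟩
    exact ⟨∀' t, rfl, by rw [gF_all, h0]⟩
  case cz => simp [Nat.Partrec.Code.eval, pure, PFun.pure]
  case cs => simp [Nat.Partrec.Code.eval]
  case cl y y1 x h0 => subst h0; simp [Nat.Partrec.Code.eval]
  case cr y y1 x h0 => subst h0; simp [Nat.Partrec.Code.eval]
  case cp g g1 x y y1 n h0 =>
    intro hf hg
    subst h0
    exact (mem_ev_pair _ _ _ _).2 ⟨_, hf, _, hg, rfl⟩
  case cc g g1 x y y1 =>
    intro hf hg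
    rw [Nat.Partrec.Code.eval]
    exact Part.mem_bind hf hg
  case cq0 g g1 i x y h0 =>
    intro hf
    subst h0
    rwa [Nat.Partrec.Code.eval_prec_zero]
  case cqS g g1 i j x x1 y y1 n n1 h0 h1 h2 h3 =>
    intro hf hg
    subst h0 h1 h2 h3
    rw [Nat.Partrec.Code.eval_prec_succ]
    exact Part.mem_bind hf hg
  case cf0 g i j x h0 =>
    intro hf
    subst h0
    exact (mem_ev_rfind _ _ _ _).2 ⟨0, by simp, by simpa using hf, by simp⟩
  case cfS g i j x x1 y y1 h0 h1 =>
    intro hf hg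
    subst h0 h1
    obtain ⟨k, rfl, h1, h2⟩ := (mem_ev_rfind _ _ _ _).1 hg
    refine (mem_ev_rfind _ _ _ _).2 ⟨k + 1, by omega, ?_, fun l hl => ?_⟩
    · rwa [← add_assoc, add_right_comm] at h1
    · rcases l with _ | l
      · exact ⟨y, by simpa using hf⟩
      · have := h2 l (by omega)
        rwa [← add_assoc, add_right_comm] at this
  case ax p x =>
    rintro ⟨φ, rfl, rfl⟩ h1
    rw [dcode_cc] at h1
    obtain ⟨ψ, hψ, e⟩ := hκ _ h1
    rw [← gnum_eq] at e
    rw [← gnum_inj e]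
    rw [sat_fc ψ _ default (fun i => i.elim0), fv_snt]
    exact hN _ hψ
  case af1 h0 => have := hb1 h0; rw [← hs] at this; simpa using this.1
  case af0 h0 => have := hb0 h0; rw [← hs] at this; simpa using this.1
  case az1 h0 => have := hb1 h0; rw [← hs F, ← hs uF] at this; simpa using this.2
  case az0 h0 => have := hb0 h0; rw [← hs F, ← hs uF] at this; simpa using this.2

/-- the term model -/
def qStr (v : ℕ → Prop) (r : Setoid ℕ) (hS : ∀ s s', r s s' → r (cd 3 s 0) (cd 3 s' 0))
    (hA : ∀ s s', r s s' → ∀ t t', r t t' → r (cd 4 s t) (cd 4 s' t'))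
    (hM : ∀ s s', r s s' → ∀ t t', r t t' → r (cd 5 s t) (cd 5 s' t'))
    (hL : ∀ s t s' t', r s s' → r t t' → v (cd 4 s t) = v (cd 4 s' t')) : LA.Structure (Quotient r) where
  funMap {n} := match n with
    | 0 => fun _ _ => Quotient.mk r (cd 2 0 0)
    | 1 => fun _ w => Quotient.map (fun s => cd 3 s 0) (fun s s' h => hS s s' h) (w 0)
    | 2 => fun f w => match f with
      | false => Quotient.map₂ (fun s t => cd 4 s t) (fun s s' h t t' h' => hA s s' h t t' h') (w 0) (w 1)
      | true => Quotient.map₂ (fun s t => cd 5 s t) (fun s s' h t t' h' => hM s s' h t t' h') (w 0) (w 1)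
    | (_ + 3) => fun f _ => f.elim
  RelMap {n} := match n with
    | 0 => fun r _ => r.elim
    | 1 => fun r _ => r.elim
    | 2 => fun _ w => Quotient.lift₂ (fun s t => v (cd 4 s t)) (fun s t s' t' h h' => hL s t s' t' h h') (w 0) (w 1)
    | (_ + 3) => fun r _ => r.elim

/-- codes of environments -/
def ec : {m : ℕ} → (Fin m → ℕ) → ℕ
  | 0, _ => 0
  | m + 1, w => cd 0 (w (Fin.last m)) (ec fun i => w i.castSucc)
theorem ec_snoc {m : ℕ} (w : Fin m → ℕ) (x : ℕ) : ec (Fin.snoc w x : Fin (m + 1) → ℕ) = cd 0 x (ec w) := by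
  simp [ec]

theorem completeness (T : Thy) (hT : ExtPA T) (κc : Nat.Partrec.Code)
    (hκ : ∀ φ ∈ T, 1 ∈ κc.eval (gnum φ)) (F uF : BF 1) (β z : ℕ) (v : ℕ → Prop)
    (hv : Mdl (KP (cc κc) (fc uF) β) (fc F) z v) :
    ∃ (N : Type) (_ : PAM N), (∀ φ ∈ T, N ⊨ φ) ∧
      (β = 1 → fv (fun _ => ((fc F : ℕ) : N)) F ∧ fv (fun _ => (z : N)) uF) ∧
      (β = 0 → ¬ fv (fun _ => ((fc F : ℕ) : N)) F ∧ ¬ fv (fun _ => (z : N)) uF) := by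
  rw [Mdl_iff] at hv
  have c3 : ∀ {a b c d}, KN (cc κc) (fc uF) β (fc F) z a b c d 0 → v a → v b → v c → v d := by
    intro a b c d hk ha hb hc
    rcases hv _ _ _ _ _ hk (Or.inr ha) (Or.inr hb) (Or.inr hc) with h | h
    · exact h.2
    · exact absurd rfl h.1
  have c2 : ∀ {a b d}, KN (cc κc) (fc uF) β (fc F) z a b 0 d 0 → v a → v b → v d := by
    intro a b d hk ha hb
    rcases hv _ _ _ _ _ hk (Or.inr ha) (Or.inr hb) (Or.inl rfl) with h | h
    · exact h.2
    · exact absurd rfl h.1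
  have c1 : ∀ {a d}, KN (cc κc) (fc uF) β (fc F) z a 0 0 d 0 → v a → v d := by
    intro a d hk ha
    rcases hv _ _ _ _ _ hk (Or.inr ha) (Or.inl rfl) (Or.inl rfl) with h | h
    · exact h.2
    · exact absurd rfl h.1
  have c0 : ∀ {d}, KN (cc κc) (fc uF) β (fc F) z 0 0 0 d 0 → v d := by
    intro d hk
    rcases hv _ _ _ _ _ hk (Or.inl rfl) (Or.inl rfl) (Or.inl rfl) with h | h
    · exact h.2
    · exact absurd rfl h.1
  have cN : ∀ {a}, KN (cc κc) (fc uF) β (fc F) z a 0 0 0 0 → ¬ v a := by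
    intro a hk ha
    rcases hv _ _ _ _ _ hk (Or.inr ha) (Or.inl rfl) (Or.inl rfl) with h | h
    · exact absurd rfl h.1
    · exact absurd rfl h.1
  have hsymm : ∀ s t, v (cd 3 s t) → v (cd 3 t s) := fun s t h => c2 (.eucl s t s) h (c0 (.refl s))
  let r : Setoid ℕ := ⟨fun s t => v (cd 3 s t), fun s => c0 (.refl s), fun {s t} h => hsymm _ _ h,
    fun {s t u} h h' => c2 (.eucl t s u) (hsymm _ _ h) h'⟩
  have hrv : ∀ {s t}, r s t ↔ v (cd 3 s t) := Iff.rfl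
  let st : LA.Structure (Quotient r) := qStr v r (fun s s' h => c1 (.congS s s') h)
    (fun s s' h t t' h' => c2 (.congA s t s' t') h h') (fun s s' h t t' h' => c2 (.congM s t s' t') h h')
    (fun s t s' t' h h' => propext ⟨fun hl => c3 (.congL s t s' t') h h' hl,
      fun hl => c3 (.congL s' t' s t) (hsymm _ _ h) (hsymm _ _ h') hl⟩)
  have q : ∀ {s t}, v (cd 3 s t) → Quotient.mk r s = Quotient.mk r t := fun h => Quotient.sound h
  have htm : ∀ {m : ℕ} (w : Fin m → ℕ) (t : Tm m),
      Quotient.mk r (cd 0 (tc t) (ec w)) = tv (fun i => Quotient.mk r (w i)) t := by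
    intro m w t
    induction t using tm_ind with
    | hv i =>
      rw [tc_var, tv_var]
      induction m with
      | zero => exact i.elim0
      | succ m ih =>
        refine Fin.lastCases ?_ (fun i => ?_) i
        · have e : m + 1 - 1 - ((Fin.last m : Fin (m + 1)) : ℕ) = 0 := by simp
          rw [e]
          exact q (c0 (.var0 _ _))
        · have e : m + 1 - 1 - ((i.castSucc : Fin (m + 1)) : ℕ) = (m - 1 - i) + 1 := by
            have := i.2
            simp; omega
          rw [e, ← ih (fun i => w i.castSucc) i]
          exact q (c0 (.varS _ _ _))
    | h0 => rw [tv_zero]; exact q (c0 (.tz _))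
    | hs t ih => rw [tv_succ, ← ih]; exact q (c0 (.ts _ _))
    | ha t u h1 h2 => rw [tv_add, ← h1, ← h2]; exact q (c0 (.ta _ _ _))
    | hm t u h1 h2 => rw [tv_mul, ← h1, ← h2]; exact q (c0 (.tm _ _ _))
  have hfm : ∀ {m : ℕ} (φ : BF m) (w : Fin m → ℕ), v (cd 2 (fc φ) (ec w)) ↔ fv (fun i => Quotient.mk r (w i)) φ := by
    intro m φ
    induction φ using bf_ind with
    | h0 => intro w; exact iff_of_false (cN (.fls _)) (by simp)
    | he m t u =>
      intro w
      rw [fv_eq, ← htm, ← htm, Quotient.eq, hrv]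
      exact ⟨c1 (.eq1 _ _ _), c1 (.eq2 _ _ _)⟩
    | hl m t u =>
      intro w
      rw [fv_le, ← htm, ← htm]
      exact ⟨c1 (.le1 _ _ _), c1 (.le2 _ _ _)⟩
    | hi m φ ψ h1 h2 =>
      intro w
      rw [fv_imp, ← h1, ← h2]
      refine ⟨c2 (.imp1 _ _ _), fun h => ?_⟩
      rcases hv _ _ _ _ _ (.imp3 (fc φ) (fc ψ) (ec w)) (Or.inl rfl) (Or.inl rfl) (Or.inl rfl) with h' | h'
      · exact h'.2
      · exact c1 (.imp2 _ _ _) (h h'.2)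
    | ha m φ ih =>
      intro w
      have key : ∀ s, v (cd 2 (fc φ) (cd 0 s (ec w))) ↔ fv (Fin.snoc (fun i => Quotient.mk r (w i)) (Quotient.mk r s)) φ := by
        intro s
        rw [← ec_snoc, ih]
        have e : (fun i => Quotient.mk r ((Fin.snoc w s : Fin (m + 1) → ℕ) i)) =
            (Fin.snoc (fun i => Quotient.mk r (w i)) (Quotient.mk r s) : Fin (m + 1) → Quotient r) := by
          funext i
          refine Fin.lastCases ?_ (fun i => ?_) i <;> simp
        rw [e]
      rw [fv_all]
      constructor
      · intro h x
        obtain ⟨s, rfl⟩ := Quotient.exists_rep x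
        exact (key s).1 (c1 (.all1 _ _ _) h)
      · intro h
        exact c1 (.all2 _ _) ((key _).2 (h _))
  have hgt : ∀ {m : ℕ} (t : Tm m) (l : ℕ), v (cd 5 (cd 0 m (tc t)) (cd 0 l (gT t l))) := by
    intro m t
    induction t using tm_ind with
    | hv i =>
      intro l
      have := c0 (.gv i (m - 1 - i) l _ rfl)
      rw [gT_var]
      have e : (i : ℕ) + (m - 1 - i) + 1 = m := by have := i.2; omega
      rwa [e] at this
    | h0 => intro l; exact c0 (.gz _ _ _ rfl)
    | hs t ih => intro l; rw [gT_succ]; exact c1 (.gs _ _ _ _ _ rfl) (ih l)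
    | ha t u h1 h2 => intro l; rw [gT_add]; exact c2 (.ga _ _ _ _ _ _ _ rfl) (h2 l) (h1 _)
    | hm t u h1 h2 => intro l; rw [gT_mul]; exact c2 (.gm _ _ _ _ _ _ _ rfl) (h2 l) (h1 _)
  have hgf : ∀ {m : ℕ} (φ : BF m) (l : ℕ), v (cd 6 (cd 0 m (fc φ)) (cd 0 l (gF φ l))) := by
    intro m φ
    induction φ using bf_ind with
    | h0 => intro l; rw [gF_fls]; exact c0 (.gfls _ _ _ rfl)
    | he m t u =>
      intro l; rw [gF_eq]
      exact c2 (.geq _ _ _ _ _ _ _ _ _ _ rfl rfl rfl rfl) (hgt t 0) (hgt u 0)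
    | hl m t u =>
      intro l; rw [gF_le]
      exact c2 (.gle _ _ _ _ _ _ _ _ _ _ _ _ rfl rfl rfl rfl rfl rfl) (hgt t 0) (hgt u 0)
    | hi m φ ψ h1 h2 => intro l; rw [gF_imp]; exact c2 (.gimp _ _ _ _ _ _ _ rfl) (h2 l) (h1 _)
    | ha m φ ih => intro l; rw [gF_all]; exact c1 (.gall _ _ _ _ _ rfl) (ih l)
  have hC : ∀ (c : Nat.Partrec.Code) (x y : ℕ), y ∈ c.eval x → v (cd 7 (cc c) (cd 0 x y)) := by
    intro c
    induction c with
    | zero =>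
      intro x y h
      have : y = 0 := by simpa [Nat.Partrec.Code.eval, pure, PFun.pure] using h
      subst this
      exact c0 (.cz _)
    | succ =>
      intro x y h
      have : y = x + 1 := by simpa [Nat.Partrec.Code.eval] using h
      subst this
      exact c0 (.cs _)
    | left =>
      intro x y h
      have : y = x.unpair.1 := by simpa [Nat.Partrec.Code.eval] using h
      subst this
      exact c0 (.cl _ _ _ (Nat.pair_unpair x))
    | right =>
      intro x y h
      have : y = x.unpair.2 := by simpa [Nat.Partrec.Code.eval] using h
      subst this
      exact c0 (.cr _ _ _ (Nat.pair_unpair x))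
    | pair f g h1 h2 =>
      intro x y h
      obtain ⟨a, ha, b, hb, rfl⟩ := (mem_ev_pair _ _ _ _).1 h
      exact c2 (.cp _ _ _ _ _ _ rfl) (h1 _ _ ha) (h2 _ _ hb)
    | comp f g h1 h2 =>
      intro x y h
      rw [Nat.Partrec.Code.eval] at h
      obtain ⟨a, ha, hb⟩ := Part.mem_bind_iff.1 h
      exact c2 (.cc _ _ _ _ _) (h2 _ _ ha) (h1 _ _ hb)
    | prec f g h1 h2 =>
      intro x y h
      obtain ⟨i, j, rfl⟩ : ∃ i j, x = Nat.pair i j := ⟨_, _, (Nat.pair_unpair x).symm⟩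
      induction j generalizing y with
      | zero =>
        rw [Nat.Partrec.Code.eval_prec_zero] at h
        exact c1 (.cq0 _ _ _ _ _ rfl) (h1 _ _ h)
      | succ j ih =>
        rw [Nat.Partrec.Code.eval_prec_succ] at h
        obtain ⟨a, ha, hb⟩ := Part.mem_bind_iff.1 h
        exact c2 (.cqS _ _ _ _ _ _ _ _ _ _ rfl rfl rfl rfl) (ih _ ha) (h2 _ _ hb)
    | rfind' f h1 =>
      intro x y h
      obtain ⟨i, j, rfl⟩ : ∃ i j, x = Nat.pair i j := ⟨_, _, (Nat.pair_unpair x).symm⟩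
      obtain ⟨k, rfl, h2, h3⟩ := (mem_ev_rfind _ _ _ _).1 h
      clear h
      induction k generalizing j with
      | zero =>
        rw [zero_add] at h2 ⊢
        exact c1 (.cf0 _ _ _ _ rfl) (h1 _ _ h2)
      | succ k ih =>
        obtain ⟨x, hx⟩ := h3 0 (by omega)
        rw [zero_add] at hx
        have e : ∀ k, k + 1 + j = k + (j + 1) := fun k => by omega
        rw [e] at h2 ⊢
        refine c2 (.cfS _ _ _ _ _ _ _ rfl rfl) (h1 _ _ hx) (ih (j + 1) h2 fun l hl => ?_)
        rw [← e]
        exact h3 (l + 1) (by omega)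
  have hmod : ∀ φ ∈ T, Quotient r ⊨ φ := by
    intro φ hφ
    rw [← fv_snt (fun i => Quotient.mk r ((default : Fin 0 → ℕ) i)), ← hfm]
    have := hC κc _ _ (hκ φ hφ)
    rw [gnum_eq] at this
    exact c2 (.ax _ _) (hgf φ 0) this
  haveI : Nonempty (Quotient r) := ⟨Quotient.mk r 0⟩
  haveI : (Quotient r) ⊨ T := ⟨fun {φ} hφ => hmod φ hφ⟩
  let pm : PAM (Quotient r) := { st with ax := fun φ hφ => (hT φ hφ).realize_sentence (Quotient r) }
  have hnum : ∀ k : ℕ, Quotient.mk r (cd 6 k 0) = (k : Quotient r) := by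
    intro k
    induction k with
    | zero => rw [Nat.cast_zero]; exact q (c0 .num0)
    | succ k ih => rw [Nat.cast_succ, ← ih, ← p_suc_eq]; exact q (c0 (.numS k))
  have hfn : ∀ (G : BF 1) (k : ℕ), v (cd 2 (fc G) (cd 0 (cd 6 k 0) 0)) ↔ fv (fun _ => (k : Quotient r)) G := by
    intro G k
    have := hfm G (fun _ => cd 6 k 0)
    rw [hnum] at this
    exact this
  refine ⟨Quotient r, pm, hmod, ?_, ?_⟩
  · intro hb
    rw [← hfn, ← hfn]
    exact ⟨c0 (.af1 hb), c0 (.az1 hb)⟩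
  · intro hb
    rw [← hfn, ← hfn]
    exact ⟨cN (.af0 hb), cN (.az0 hb)⟩

theorem Prv_iff {S : Thy} (hS : ExtPA S) (φ : Snt) :
    Prv S φ ↔ ∀ (M : Type) [PAM M], (∀ ψ ∈ S, M ⊨ ψ) → M ⊨ φ := by
  constructor
  · intro h M _ hM
    have : M ⊨ S := ⟨fun ψ hψ => hM ψ hψ⟩
    have : Nonempty M := ⟨0⟩
    exact Theory.ModelsBoundedFormula.realize_sentence h M
  · intro h
    unfold Prv
    rw [Theory.models_sentence_iff]
    intro M
    let _ : PAM M := { (inferInstance : LA.Structure M) with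
      ax := fun ψ hψ => Theory.ModelsBoundedFormula.realize_sentence (hS ψ hψ) M }
    exact h M fun ψ hψ => Theory.realize_sentence_of_mem S hψ
theorem ext_PA : ExtPA PAAx := fun φ hφ => by
  unfold Prv
  rw [Theory.models_sentence_iff]
  exact fun M => Theory.realize_sentence_of_mem _ hφ
theorem Prv_mono {S S' : Thy} (h : S ⊆ S') {φ : Snt} (hp : Prv S φ) : Prv S' φ := by
  unfold Prv at *
  rw [Theory.models_sentence_iff] at *
  intro M
  have : M ⊨ S := ⟨fun ψ hψ => Theory.realize_sentence_of_mem S' (h hψ)⟩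
  exact Theory.ModelsBoundedFormula.realize_sentence (Theory.models_sentence_iff.2 hp) M
theorem ext_add {S : Thy} (h : ExtPA S) (φ : Snt) : ExtPA (add S φ) :=
  fun ψ hψ => Prv_mono (Set.subset_insert _ _) (h ψ hψ)
theorem PA_iff (φ : Snt) : Prv PAAx φ ↔ ∀ (M : Type) [PAM M], M ⊨ φ := by
  rw [Prv_iff ext_PA]
  exact ⟨fun h M _ => h M PAM.ax, fun h M _ _ => h M⟩
theorem Prv_add {S : Thy} (hS : ExtPA S) (χ φ : Snt) :
    Prv (add S χ) φ ↔ ∀ (M : Type) [PAM M], (∀ ψ ∈ S, M ⊨ ψ) → M ⊨ χ → M ⊨ φ := by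
  rw [Prv_iff (ext_add hS χ)]
  constructor
  · intro h M _ hM hc
    refine h M fun ψ hψ => ?_
    rcases hψ with rfl | hψ
    · exact hc
    · exact hM ψ hψ
  · intro h M _ hM
    exact h M (fun ψ hψ => hM ψ (Set.mem_insert_of_mem _ hψ)) (hM χ (Set.mem_insert _ _))
section
variable {M : Type} [LA.Structure M] (φ ψ : Snt)
theorem r_and : M ⊨ (φ ⊓ ψ : Snt) ↔ M ⊨ φ ∧ M ⊨ ψ := by simp only [← fv_snt default]; exact fv_and _ _ _
theorem r_or : M ⊨ (φ ⊔ ψ : Snt) ↔ M ⊨ φ ∨ M ⊨ ψ := by simp only [← fv_snt default]; exact fv_or _ _ _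
theorem r_imp : M ⊨ (φ ⟹ ψ : Snt) ↔ (M ⊨ φ → M ⊨ ψ) := by simp only [← fv_snt default]; exact fv_imp _ _ _
theorem r_not : M ⊨ (∼φ : Snt) ↔ ¬ M ⊨ φ := by simp only [← fv_snt default]; exact fv_not _ _
end

theorem code_ex {T : Thy} (h : CompThy T) : ∃ κ : Nat.Partrec.Code, ∀ x, 1 ∈ κ.eval x ↔ ∃ φ ∈ T, gnum φ = x := by
  classical
  obtain ⟨hd, hc⟩ := h
  have hc' : Computable (fun x : ℕ => cond (decide (∃ φ ∈ T, gnum φ = x)) 1 0) :=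
    Computable.cond (by convert hc) (Computable.const 1) (Computable.const 0)
  obtain ⟨κ, hκ⟩ := Nat.Partrec.Code.exists_code.1 (Partrec.nat_iff.1 hc'.partrec)
  refine ⟨κ, fun x => ?_⟩
  rw [hκ]
  by_cases hx : ∃ φ ∈ T, gnum φ = x <;> simp [hx]

/-- the combinatorial core -/
theorem core {T : Thy} (U : ∀ (M : Type) [PAM M], M → Prop) (D0' D1 : ℕ → ℕ → Prop)
    (d0 d1 : ∀ (M : Type) [PAM M], M → M → Prop) (Φ : ∀ (M : Type) [PAM M], Prop)
    (h0 : ∀ (M : Type) [PAM M] (x z : ℕ), d0 M x z ↔ D0' x z)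
    (h1 : ∀ (M : Type) [PAM M] (x z : ℕ), d1 M x z ↔ D1 x z)
    (hΦ : ∀ (M : Type) [PAM M], Φ M ↔ ∃ p, (∃ x, x ≤ p ∧ ∃ z, z ≤ p ∧ d1 M x z ∧ U M z) ∧
      ∀ y, y ≤ p → ∀ w, w ≤ p → d0 M y w → U M w)
    (k1 : ∀ z, (∃ x, D1 x z) ↔ ∀ (N : Type) [PAM N], (∀ φ ∈ T, N ⊨ φ) → Φ N → ¬ U N z)
    (k0 : ∀ z, (∃ x, D0' x z) ↔ ∀ (N : Type) [PAM N], (∀ φ ∈ T, N ⊨ φ) → Φ N ∨ U N z)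
    (h4 : ∀ z w : ℕ, (∀ (N : Type) [PAM N], (∀ φ ∈ T, N ⊨ φ) → ¬ U N z ∧ U N w) →
      ∀ (N : Type) [PAM N], ¬ U N z ∨ U N w) :
    (∀ z : ℕ, (∀ (N : Type) [PAM N], (∀ φ ∈ T, N ⊨ φ) → Φ N → ¬ U N z) →
      ∀ (N : Type) [PAM N], Φ N ∨ ¬ U N z) ∧
    (∀ w : ℕ, (∀ (N : Type) [PAM N], (∀ φ ∈ T, N ⊨ φ) → Φ N ∨ U N w) →
      ∀ (N : Type) [PAM N], Φ N → U N w) := by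
  classical
  have key : ∀ z w, (∃ x, D1 x z) → (∃ x, D0' x w) →
      ∀ (N : Type) [PAM N], (∀ φ ∈ T, N ⊨ φ) → ¬ U N z ∧ U N w := by
    rintro z w ⟨x, hx⟩ ⟨y, hy⟩ N _ hN
    by_contra hcon
    let A : ℕ → Prop := fun p => ∃ x, x ≤ p ∧ ∃ z, z ≤ p ∧ D1 x z ∧ U N z
    let B : ℕ → Prop := fun p => ∃ x, x ≤ p ∧ ∃ z, z ≤ p ∧ D0' x z ∧ ¬ U N z
    have hex : ∃ p, A p ∨ B p := by
      by_cases hz : U N z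
      · exact ⟨max x z, Or.inl ⟨x, le_max_left _ _, z, le_max_right _ _, hx, hz⟩⟩
      · have hw : ¬ U N w := fun hw => hcon ⟨hz, hw⟩
        exact ⟨max y w, Or.inr ⟨y, le_max_left _ _, w, le_max_right _ _, hy, hw⟩⟩
    obtain ⟨hp, hmin⟩ : (A (Nat.find hex) ∨ B (Nat.find hex)) ∧ ∀ q < Nat.find hex, ¬ (A q ∨ B q) :=
      ⟨Nat.find_spec hex, fun q hq => Nat.find_min hex hq⟩
    generalize Nat.find hex = p at hp hmin
    by_cases hB : B p
    · obtain ⟨y', hy', w', hw', hd, hu⟩ := hB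
      have hΦN : Φ N := ((k0 w').1 ⟨y', hd⟩ N hN).resolve_right hu
      obtain ⟨q, ⟨x1, hx1, z1, hz1, hd1, hu1⟩, hq⟩ := (hΦ N).1 hΦN
      have hlt : q < (p : N) := by
        by_contra hge
        have hge := not_lt.1 hge
        exact hu (hq y' (le_trans (Nat.cast_le.2 hy') hge) w' (le_trans (Nat.cast_le.2 hw') hge) ((h0 N _ _).2 hd))
      obtain ⟨q, rfl, -⟩ := std_le p q hlt.le
      obtain ⟨x1, rfl, hx1'⟩ := std_le _ _ hx1
      obtain ⟨z1, rfl, hz1'⟩ := std_le _ _ hz1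
      exact hmin q (Nat.cast_lt.1 hlt) (Or.inl ⟨x1, hx1', z1, hz1', (h1 N _ _).1 hd1, hu1⟩)
    · obtain ⟨x1, hx1, z1, hz1, hd1, hu1⟩ := hp.resolve_right hB
      refine (k1 z1).1 ⟨x1, hd1⟩ N hN ((hΦ N).2 ⟨p, ⟨x1, Nat.cast_le.2 hx1, z1, Nat.cast_le.2 hz1, (h1 N _ _).2 hd1, hu1⟩, ?_⟩) hu1
      intro y hy w hw hd
      obtain ⟨y, rfl, hy'⟩ := std_le _ _ hy
      obtain ⟨w, rfl, hw'⟩ := std_le _ _ hw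
      by_contra hu
      exact hB ⟨y, hy', w, hw', (h0 N _ _).1 hd, hu⟩
  constructor
  · intro z hz N _
    by_contra hcon
    push Not at hcon
    obtain ⟨hn, hu⟩ := hcon
    obtain ⟨x, hx⟩ := (k1 z).2 hz
    apply hn
    refine (hΦ N).2 ⟨((max x z : ℕ) : N), ⟨x, Nat.cast_le.2 (le_max_left _ _), z, Nat.cast_le.2 (le_max_right _ _), (h1 N _ _).2 hx, hu⟩, ?_⟩
    intro y hy w hw hd
    obtain ⟨y, rfl, -⟩ := std_le _ _ hy
    obtain ⟨w, rfl, -⟩ := std_le _ _ hw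
    exact (h4 z w (key z w ⟨x, hx⟩ ⟨y, (h0 N _ _).1 hd⟩) N).resolve_left (not_not.2 hu)
  · intro w hw N _ hΦN
    obtain ⟨y, hy⟩ := (k0 w).2 hw
    by_contra hu
    obtain ⟨q, ⟨x1, hx1, z1, hz1, hd1, hu1⟩, hq⟩ := (hΦ N).1 hΦN
    have hlt : q < ((max y w : ℕ) : N) := by
      by_contra hge
      have hge := not_lt.1 hge
      exact hu (hq y (le_trans (Nat.cast_le.2 (le_max_left _ _)) hge) w (le_trans (Nat.cast_le.2 (le_max_right _ _)) hge) ((h0 N _ _).2 hy))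
    obtain ⟨q, rfl, -⟩ := std_le _ q hlt.le
    obtain ⟨x1, rfl, hx1'⟩ := std_le _ _ hx1
    obtain ⟨z1, rfl, hz1'⟩ := std_le _ _ hz1
    exact (h4 z1 w (key z1 w ⟨x1, (h1 N _ _).1 hd1⟩ ⟨y, hy⟩) N).elim (fun h => h hu1) hu

set_option maxHeartbeats 2000000 in
theorem hard {T : Thy} (hT : GoodThy T) {n : ℕ} (hn : 1 ≤ n) (h4 : ThySPConsPA n T) :
    ∃ φ ∈ SigmaS n,
      (∀ π ∈ PiS n, (∀ (N : Type) [PAM N], (∀ ψ ∈ T, N ⊨ ψ) → N ⊨ φ → N ⊨ π) →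
        ∀ (N : Type) [PAM N], N ⊨ φ ∨ N ⊨ π) ∧
      (∀ σ ∈ SigmaS n, (∀ (N : Type) [PAM N], (∀ ψ ∈ T, N ⊨ ψ) → N ⊨ φ ∨ N ⊨ σ) →
        ∀ (N : Type) [PAM N], N ⊨ φ → N ⊨ σ) := by
  obtain ⟨hcomp, hcon, hext⟩ := hT
  obtain ⟨κ, hκ⟩ := code_ex hcomp
  obtain ⟨U, hU, hUs, hUp⟩ := univ_ex n hn
  obtain ⟨uF, huF⟩ := hU.fd 1 [vT 0]
  simp only [List.map_cons, List.map_nil, tv_var, List.headD_cons] at huF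
  let δ : ℕ → ∀ (M : Type) [PAM M], M → M → M → Prop := fun b M _ => Ref (KP (cc κ) (fc uF) b) M
  have hδ : ∀ b, D0 (fun M _ v => δ b M (v.headD 0) (v.tail.headD 0) (v.tail.tail.headD 0)) :=
    fun b => Ref_D0 _ (KP_D0 _ _ b)
  let G : ∀ (M : Type) [PAM M], M → Prop := fun M _ f => ∃ p, (∃ x, x ≤ p ∧ ∃ z, z ≤ p ∧ δ 1 M x f z ∧ U M z) ∧
      ∀ y, y ≤ p → ∀ w, w ≤ p → δ 0 M y f w → U M w
  have hG : Sg n (fun M _ v => G M (v.headD 0)) := by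
    obtain ⟨k, rfl⟩ : ∃ k, n = k + 1 := ⟨n - 1, by omega⟩
    have iU : CS (k+1) (fun M _ v => U M (v.headD 0)) := ⟨hU⟩
    have i1 : ∀ b, CD0 (fun M _ (v : List M) => δ b M (v.tail.headD 0) (v.tail.tail.tail.headD 0) (v.headD 0)) := fun b =>
      ⟨(hδ b).sub (inferInstance : CE (fun M _ (v : List M) => [v.tail.headD 0, v.tail.tail.tail.headD 0, v.headD 0])).out⟩
    exact (inferInstance : CS (k+1) (fun M _ v => ∃ p, (∃ x, x ≤ p ∧ ∃ z, z ≤ p ∧ δ 1 M x (v.headD 0) z ∧ U M z) ∧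
      ∀ y, y ≤ p → ∀ w, w ≤ p → δ 0 M y (v.headD 0) w → U M w)).out
  obtain ⟨F, hF⟩ := hG.fd 1 [vT 0]
  simp only [List.map_cons, List.map_nil, tv_var, List.headD_cons] at hF
  have hnum : ∀ k : ℕ, ∃ t : Tm 0, ∀ (M : Type) [PAM M] (v : Fin 0 → M), tv v t = (k : M) := fun k => TD.nat k 0 []
  obtain ⟨t, ht⟩ := hnum (fc F)
  obtain ⟨φ, hφ, hφ'⟩ := (hG.fml 0 [t]).1
  simp only [List.map_cons, List.map_nil, List.headD_cons, ht, fv_snt] at hφ'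
  have hφ2 : ∀ (M : Type) [PAM M], M ⊨ φ ↔ G M ((fc F : ℕ) : M) := fun M _ => hφ' M default
  have habs : ∀ b (M : Type) [PAM M] (x f z : ℕ), δ b M x f z ↔ δ b NN x f z := fun b M _ x f z =>
    (hδ b).abs [x, f, z] M NN
  have hcore := core (T := T) U (fun x z => δ 0 NN x (fc F : ℕ) z) (fun x z => δ 1 NN x (fc F : ℕ) z)
    (fun M _ x z => δ 0 M x (fc F : ℕ) z) (fun M _ x z => δ 1 M x (fc F : ℕ) z) (fun M _ => M ⊨ φ)
    (fun M _ x z => habs 0 M x _ z) (fun M _ x z => habs 1 M x _ z) (fun M _ => hφ2 M) ?_ ?_ ?_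
  · refine ⟨φ, hφ, fun π hπ h => ?_, fun σ hσ h => ?_⟩
    · obtain ⟨z, hz⟩ := hUp π hπ
      simp only [hz] at h ⊢
      exact hcore.1 z h
    · obtain ⟨z, hz⟩ := hUs σ hσ
      simp only [hz] at h ⊢
      exact hcore.2 z h
  · intro z
    refine (Ref_iff _ _ _).trans ?_
    constructor
    · intro h N _ hN h1 h2
      refine h ⟨_, soundness N κ T (fun x => (hκ x).1) hN F uF 1 z (fun _ => ⟨?_, ?_⟩) (fun h => absurd h (by norm_num))⟩
      · exact (hF _ _).2 ((hφ2 N).1 h1)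
      · exact (huF _ _).2 h2
    · rintro h ⟨v, hv⟩
      obtain ⟨N, _, hN, h1, -⟩ := completeness T hext κ (fun φ hφ => (hκ _).2 ⟨φ, hφ, rfl⟩) F uF 1 z v hv
      obtain ⟨h1, h2⟩ := h1 rfl
      exact h N hN ((hφ2 N).2 ((hF N (fun _ => ((fc F : ℕ) : N))).1 h1)) ((huF N (fun _ => (z : N))).1 h2)
  · intro z
    refine (Ref_iff _ _ _).trans ?_
    constructor
    · intro h N _ hN
      by_contra hcc
      push Not at hcc
      refine h ⟨_, soundness N κ T (fun x => (hκ x).1) hN F uF 0 z (fun h => absurd h (by norm_num)) (fun _ => ⟨?_, ?_⟩)⟩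
      · exact fun hh => hcc.1 ((hφ2 N).2 ((hF N (fun _ => ((fc F : ℕ) : N))).1 hh))
      · exact fun hh => hcc.2 ((huF N (fun _ => (z : N))).1 hh)
    · rintro h ⟨v, hv⟩
      obtain ⟨N, _, hN, -, h1⟩ := completeness T hext κ (fun φ hφ => (hκ _).2 ⟨φ, hφ, rfl⟩) F uF 0 z v hv
      obtain ⟨h1, h2⟩ := h1 rfl
      rcases h N hN with h | h
      · exact h1 ((hF _ _).2 ((hφ2 N).1 h))
      · exact h2 ((huF _ _).2 h)
  · intro z w h
    obtain ⟨tz, htz⟩ := hnum z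
    obtain ⟨tw, htw⟩ := hnum w
    obtain ⟨π, hπ, hπ'⟩ := (hU.fml 0 [tz]).2
    obtain ⟨σ, hσ, hσ'⟩ := (hU.fml 0 [tw]).1
    simp only [List.map_cons, List.map_nil, List.headD_cons, htz, htw, fv_snt] at hπ' hσ'
    have := h4 σ hσ π hπ ((Prv_iff hext _).2 fun N _ hN => by
      rw [r_and]
      exact ⟨(hσ' N default).2 (h N hN).2, (hπ' N default).2 (h N hN).1⟩)
    intro N _
    have := (PA_iff _).1 this N
    rw [r_or] at this
    exact this.symm.imp (hπ' N default).1 (hσ' N default).1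

theorem sub_add {T : Thy} (hT : ExtPA T) {χ : Snt} (h : Prv T χ) : SubThy (add PAAx χ) T := by
  refine ⟨ext_add ext_PA _, fun φ hφ => ?_⟩
  rw [Prv_add ext_PA] at hφ
  rw [Prv_iff hT] at *
  exact fun M _ hM => hφ M PAM.ax (h M hM)

/-- Theorem 5.6: characterization of the existence of a `Σ_n` sentence which is
hereditarily doubly `Π_n`-conservative over `T`. -/
theorem stmt_5 (T : Thy) (hT : GoodThy T) (n : ℕ) (hn : 1 ≤ n) :
    List.TFAE
      [∃ φ ∈ SigmaS n, HDCons n T φ,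
       ThIn (SigmaS n) T ⊆ {φ | HConsIn (PiS n) T φ},
       ThIn (PiS n) T ⊆ {φ | HConsIn (SigmaS n) T φ},
       ThySPConsPA n T] := by
  have hext := hT.2.2
  tfae_have 4 → 2 := by
    rintro h σ ⟨hσ, hσT⟩ V ⟨hV, hVT⟩ π hπ hp
    have h1 : Prv T (σ ⊓ π) := by
      have : Prv V (σ ⟹ π) := by
        rw [Prv_add hV] at hp
        rw [Prv_iff hV]
        exact fun M _ hM => (r_imp _ _).2 (hp M hM)
      have := hVT _ this
      have hσT : Prv T σ := hσT
      rw [Prv_iff hext] at *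
      exact fun M _ hM => (r_and _ _).2 ⟨hσT M hM, (r_imp _ _).1 (this M hM) (hσT M hM)⟩
    have h2 := (PA_iff _).1 (h σ hσ π hπ h1)
    rw [Prv_add hV] at hp
    rw [Prv_iff hV]
    exact fun M _ hM => ((r_or _ _).1 (h2 M)).elim (hp M hM) id
  tfae_have 4 → 3 := by
    rintro h π ⟨hπ, hπT⟩ V ⟨hV, hVT⟩ σ hσ hp
    have h1 : Prv T (σ ⊓ π) := by
      have : Prv V (π ⟹ σ) := by
        rw [Prv_add hV] at hp
        rw [Prv_iff hV]
        exact fun M _ hM => (r_imp _ _).2 (hp M hM)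
      have := hVT _ this
      have hπT : Prv T π := hπT
      rw [Prv_iff hext] at *
      exact fun M _ hM => (r_and _ _).2 ⟨(r_imp _ _).1 (this M hM) (hπT M hM), hπT M hM⟩
    have h2 := (PA_iff _).1 (h σ hσ π hπ h1)
    rw [Prv_add hV] at hp
    rw [Prv_iff hV]
    exact fun M _ hM => ((r_or _ _).1 (h2 M)).elim id (hp M hM)
  tfae_have 2 → 4 := by
    intro h σ hσ π hπ hp
    rw [Prv_iff hext] at hp
    have hs : Prv T σ := (Prv_iff hext _).2 fun M _ hM => ((r_and _ _).1 (hp M hM)).1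
    have hi : Prv T (σ ⟹ π) := (Prv_iff hext _).2 fun M _ hM => (r_imp _ _).2 fun _ => ((r_and _ _).1 (hp M hM)).2
    have := h ⟨hσ, hs⟩ _ (sub_add hext hi) π hπ ((Prv_add (ext_add ext_PA _) _ _).2 fun M _ hM h1 =>
      (r_imp _ _).1 (hM _ (Set.mem_insert _ _)) h1)
    rw [Prv_add ext_PA] at this
    rw [PA_iff]
    intro M _
    rw [r_or]
    by_cases h1 : M ⊨ σ
    · exact Or.inl h1
    · exact Or.inr (this M PAM.ax ((r_imp _ _).2 fun h => absurd h h1))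
  tfae_have 3 → 4 := by
    intro h σ hσ π hπ hp
    rw [Prv_iff hext] at hp
    have hs : Prv T π := (Prv_iff hext _).2 fun M _ hM => ((r_and _ _).1 (hp M hM)).2
    have hi : Prv T (π ⟹ σ) := (Prv_iff hext _).2 fun M _ hM => (r_imp _ _).2 fun _ => ((r_and _ _).1 (hp M hM)).1
    have := h ⟨hπ, hs⟩ _ (sub_add hext hi) σ hσ ((Prv_add (ext_add ext_PA _) _ _).2 fun M _ hM h1 =>
      (r_imp _ _).1 (hM _ (Set.mem_insert _ _)) h1)
    rw [Prv_add ext_PA] at this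
    rw [PA_iff]
    intro M _
    rw [r_or]
    by_cases h1 : M ⊨ π
    · exact Or.inr h1
    · exact Or.inl (this M PAM.ax ((r_imp _ _).2 fun h => absurd h h1))
  tfae_have 1 → 4 := by
    rintro ⟨φ, hφ, h⟩ σ hσ π hπ hp
    rw [Prv_iff hext] at hp
    have hi : Prv T (φ ⟹ π) := (Prv_iff hext _).2 fun M _ hM => (r_imp _ _).2 fun _ => ((r_and _ _).1 (hp M hM)).2
    have hj : Prv T (∼φ ⟹ σ) := (Prv_iff hext _).2 fun M _ hM => (r_imp _ _).2 fun _ => ((r_and _ _).1 (hp M hM)).1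
    have h1 := (h _ (sub_add hext hi)).1 π hπ ((Prv_add (ext_add ext_PA _) _ _).2 fun M _ hM h1 =>
      (r_imp _ _).1 (hM _ (Set.mem_insert _ _)) h1)
    have h2 := (h _ (sub_add hext hj)).2 σ hσ ((Prv_add (ext_add ext_PA _) _ _).2 fun M _ hM h1 =>
      (r_imp _ _).1 (hM _ (Set.mem_insert _ _)) h1)
    rw [Prv_add ext_PA] at h1 h2
    rw [PA_iff]
    intro M _
    rw [r_or]
    by_cases hc : M ⊨ φ
    · exact Or.inl (h2 M PAM.ax ((r_imp _ _).2 fun h => absurd hc ((r_not _).1 h)))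
    · exact Or.inr (h1 M PAM.ax ((r_imp _ _).2 fun h => absurd h hc))
  tfae_have 4 → 1 := by
    intro h
    obtain ⟨φ, hφ, ha, hb⟩ := hard hT hn h
    refine ⟨φ, hφ, fun V hV => ⟨fun π hπ hp => ?_, fun σ hσ hp => ?_⟩⟩
    · have hp' := (Prv_add hV.1 _ _).1 hp
      have hi : Prv T (φ ⟹ π) := hV.2 _ ((Prv_iff hV.1 _).2 fun M _ hM => (r_imp _ _).2 (hp' M hM))
      have h1 := ha π hπ fun N _ hN => (r_imp _ _).1 ((Prv_iff hext _).1 hi N hN)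
      exact (Prv_iff hV.1 _).2 fun M _ hM => (h1 M).elim (hp' M hM) id
    · have hp' := (Prv_add hV.1 _ _).1 hp
      have hi : Prv T (∼φ ⟹ σ) := hV.2 _ ((Prv_iff hV.1 _).2 fun M _ hM => (r_imp _ _).2 (hp' M hM))
      have h1 := hb σ hσ fun N _ hN => by
        have := (r_imp _ _).1 ((Prv_iff hext _).1 hi N hN)
        rw [r_not] at this
        exact or_iff_not_imp_left.2 this
      refine (Prv_iff hV.1 _).2 fun M _ hM => ?_
      by_cases hc : M ⊨ φ
      · exact h1 M hc
      · exact hp' M hM ((r_not _).2 hc)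
  tfae_finish

end Guaspari
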